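/- For every m ≥ 2, the topological complexity of the connected sum of m copies of the 4-torus satisfies TC(#ₘT⁴) = 9, where T⁴ = S¹ × S¹ × S¹ × S¹. -/

import Mathlib

/-!
Common definitions: rational singular (co)homology, homotopy groups and asphericity,
classifying maps, closed oriented manifolds, connected sums, wedges, topological
complexity, sectional category weights, and (a)toroidal classes.
-/

open CategoryTheory unitInterval Topology

noncomputable section

/-- The singular chain complex with rational coefficients. -/
def singularChainComplex : TopCat.{0} ⥤ ChainComplex (ModuleCat.{0} ℚ) ℕ :=
  TopCat.toSSet ⋙ ((SimplicialObject.whiskering _ _).obj (ModuleCat.free ℚ)) ⋙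
    AlgebraicTopology.alternatingFaceMapComplex (ModuleCat ℚ)

/-- The `k`-th singular homology functor with rational coefficients. -/
def singularHomologyFunctor (k : ℕ) : TopCat.{0} ⥤ ModuleCat.{0} ℚ :=
  singularChainComplex ⋙ HomologicalComplex.homologyFunctor (ModuleCat ℚ) (ComplexShape.down ℕ) k

/-- `H k X` is the `k`-th rational singular homology group `H_k(X; ℚ)`. -/
abbrev H (k : ℕ) (X : Type) [TopologicalSpace X] : Type :=
  (singularHomologyFunctor k).obj (TopCat.of X)

/-- The map `H_k(f; ℚ)` induced on rational singular homology by a continuous map `f`. -/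
def Hmap (k : ℕ) {X Y : Type} [TopologicalSpace X] [TopologicalSpace Y] (f : C(X, Y)) :
    H k X →ₗ[ℚ] H k Y :=
  ((singularHomologyFunctor k).map (TopCat.ofHom f : TopCat.of X ⟶ TopCat.of Y)).hom

/-- `Hco k X` is the `k`-th rational singular cohomology group `H^k(X; ℚ)`; over the
field `ℚ`, universal coefficients identify it naturally with the dual of homology. -/
abbrev Hco (k : ℕ) (X : Type) [TopologicalSpace X] : Type :=
  Module.Dual ℚ (H k X)

/-- The map `H^k(f; ℚ)` induced on rational singular cohomology (the Kronecker-dual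
of the map induced on homology). -/
def Hcomap (k : ℕ) {X Y : Type} [TopologicalSpace X] [TopologicalSpace Y] (f : C(X, Y)) :
    Hco k Y →ₗ[ℚ] Hco k X :=
  (Hmap k f).dualMap

/-- Transport of a cohomology class along an equality of degrees. -/
def coCast {X : Type} [TopologicalSpace X] {p q : ℕ} (h : p = q) :
    Hco p X →ₗ[ℚ] Hco q X := by
  subst h; exact LinearMap.id

/-- A non-zero element spanning a rational vector space (necessarily one-dimensional);
this characterises fundamental classes in the top (co)homology of closed connected
oriented manifolds with rational coefficients. -/
def IsGenerator {W : Type} [AddCommGroup W] [Module ℚ W] (w : W) : Prop :=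
  w ≠ 0 ∧ ∀ v : W, ∃ c : ℚ, v = c • w

/-- `π₂(X) = 0`. -/
def Pi2Trivial (X : Type) [TopologicalSpace X] : Prop :=
  ∀ x : X, Subsingleton (HomotopyGroup (Fin 2) X x)

/-- A space is aspherical iff all its homotopy groups in degrees `≥ 2` vanish
(for manifolds this is equivalent to contractibility of the universal cover). -/
def Aspherical (X : Type) [TopologicalSpace X] : Prop :=
  ∀ k : ℕ, 2 ≤ k → ∀ x : X, Subsingleton (HomotopyGroup (Fin k) X x)

/-- A continuous map, regarded as a morphism in `TopCat`. -/
def toTopHom {X Y : Type} [TopologicalSpace X] [TopologicalSpace Y] (f : C(X, Y)) :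
    TopCat.of X ⟶ TopCat.of Y := TopCat.ofHom f

/-- The homomorphism induced by a continuous map on fundamental groups. -/
def π₁map {X Y : Type} [TopologicalSpace X] [TopologicalSpace Y] (f : C(X, Y)) (x : X) :
    Aut (FundamentalGroupoid.mk x) →* Aut (FundamentalGroupoid.mk (f x)) :=
  Functor.mapAut (X := FundamentalGroupoid.mk x)
    (show FundamentalGroupoid X ⥤ FundamentalGroupoid Y from
      FundamentalGroupoid.fundamentalGroupoidFunctor.map (toTopHom f))

/-- `B` is a model for an Eilenberg–MacLane space `K(G, 1)`:  it is path-connected and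
all its higher homotopy groups vanish. -/
def IsAsphericalSpace (B : Type) [TopologicalSpace B] : Prop :=
  PathConnectedSpace B ∧ Aspherical B

/-- `c : M → B` is a classifying map for `M`, i.e. `B` is a model for `Bπ₁(M)`
(path-connected with vanishing higher homotopy groups) and `c` induces an isomorphism
on fundamental groups. -/
def IsClassifyingMap {M B : Type} [TopologicalSpace M] [TopologicalSpace B]
    (c : C(M, B)) : Prop :=
  IsAsphericalSpace B ∧ ∀ x : M, Function.Bijective (π₁map c x)

/-- Every point has a neighbourhood homeomorphic to `ℝⁿ`. -/
def IsLocallyEuclidean (n : ℕ) (M : Type) [TopologicalSpace M] : Prop :=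
  ∀ x : M, ∃ U : Set M, x ∈ U ∧ IsOpen U ∧ Nonempty (U ≃ₜ EuclideanSpace ℝ (Fin n))

/-- A closed connected oriented topological `n`-manifold.  (For a closed connected
`n`-manifold, orientability is equivalent to `H_n(M; ℚ) ≠ 0`.) -/
def IsClosedOrientedManifold (n : ℕ) (M : Type) [TopologicalSpace M] : Prop :=
  CompactSpace M ∧ T2Space M ∧ SecondCountableTopology M ∧ ConnectedSpace M ∧
    IsLocallyEuclidean n M ∧ Nontrivial (H n M)

/-- Data exhibiting `N` as a connected sum `M₁ # M₂` of `n`-manifolds:  `N` is covered by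
two closed pieces `C₁`, `C₂`, homeomorphic to `M₁` resp. `M₂` with an embedded open ball
removed, which overlap exactly along the boundary spheres.  (Gluing along any
homeomorphism of the sphere yields a space homeomorphic to the connected sum.) -/
structure ConnectedSumData (n : ℕ) (N M₁ M₂ : Type) [TopologicalSpace N]
    [TopologicalSpace M₁] [TopologicalSpace M₂] where
  φ₁ : EuclideanSpace ℝ (Fin n) → M₁
  φ₂ : EuclideanSpace ℝ (Fin n) → M₂
  emb₁ : IsOpenEmbedding φ₁
  emb₂ : IsOpenEmbedding φ₂
  C₁ : Set N
  C₂ : Set N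
  closed₁ : IsClosed C₁
  closed₂ : IsClosed C₂
  cover : C₁ ∪ C₂ = Set.univ
  h₁ : C₁ ≃ₜ ((φ₁ '' Metric.ball 0 1)ᶜ : Set M₁)
  h₂ : C₂ ≃ₜ ((φ₂ '' Metric.ball 0 1)ᶜ : Set M₂)
  inter₁ : ∀ x : C₁, (x : N) ∈ C₂ ↔ ((h₁ x : M₁) ∈ φ₁ '' Metric.sphere 0 1)
  inter₂ : ∀ x : C₂, (x : N) ∈ C₁ ↔ ((h₂ x : M₂) ∈ φ₂ '' Metric.sphere 0 1)

/-- `N` is a connected sum of `M₁` and `M₂` (as `n`-manifolds). -/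
def IsConnectedSum (n : ℕ) (N M₁ M₂ : Type) [TopologicalSpace N]
    [TopologicalSpace M₁] [TopologicalSpace M₂] : Prop :=
  Nonempty (ConnectedSumData n N M₁ M₂)

/-- The degree-one pinch map `N = M₁ # M₂ → M₁`:  it restricts to the canonical
identification on the `M₁`-piece and sends the `M₂`-piece into the closed ball. -/
def ConnectedSumData.IsPinchFst {n : ℕ} {N M₁ M₂ : Type} [TopologicalSpace N]
    [TopologicalSpace M₁] [TopologicalSpace M₂] (D : ConnectedSumData n N M₁ M₂)
    (p : C(N, M₁)) : Prop :=
  (∀ x : D.C₁, p (x : N) = (D.h₁ x : M₁)) ∧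
    ∀ x : D.C₂, p (x : N) ∈ D.φ₁ '' Metric.closedBall 0 1

/-- The degree-one pinch map `N = M₁ # M₂ → M₂`. -/
def ConnectedSumData.IsPinchSnd {n : ℕ} {N M₁ M₂ : Type} [TopologicalSpace N]
    [TopologicalSpace M₁] [TopologicalSpace M₂] (D : ConnectedSumData n N M₁ M₂)
    (p : C(N, M₂)) : Prop :=
  (∀ x : D.C₂, p (x : N) = (D.h₂ x : M₂)) ∧
    ∀ x : D.C₁, p (x : N) ∈ D.φ₂ '' Metric.closedBall 0 1

/-- `N` is an iterated connected sum `M 0 # M 1 # ⋯ # M (m-1)` of `n`-manifolds. -/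
def IsIteratedConnectedSum (n : ℕ) (N : Type) [TopologicalSpace N] :
    (m : ℕ) → (Fin m → TopCat.{0}) → Prop
  | 0, _ => False
  | 1, M => Nonempty (N ≃ₜ (M 0))
  | (m + 2), M =>
      ∃ P : TopCat.{0}, IsIteratedConnectedSum n P (m + 1) (fun i => M i.castSucc) ∧
        IsConnectedSum n N P (M (Fin.last (m + 1)))

/-- `W` is the wedge (one-point union) of the pointed spaces `(M₁, x₁)` and `(M₂, x₂)`. -/
def IsWedge (W M₁ M₂ : Type) [TopologicalSpace W] [TopologicalSpace M₁]
    [TopologicalSpace M₂] (x₁ : M₁) (x₂ : M₂) : Prop :=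
  ∃ (j₁ : C(M₁, W)) (j₂ : C(M₂, W)), IsClosedEmbedding j₁ ∧ IsClosedEmbedding j₂ ∧
    Set.range j₁ ∪ Set.range j₂ = Set.univ ∧
    Set.range j₁ ∩ Set.range j₂ = {j₁ x₁} ∧ j₁ x₁ = j₂ x₂

/-- `X × X` admits a cover by `m` open sets over each of which there is a continuous
motion planning rule (a continuous local section of the free path fibration). -/
def TCCoverable (X : Type) [TopologicalSpace X] (m : ℕ) : Prop :=
  ∃ U : Fin m → Set (X × X), (∀ i, IsOpen (U i)) ∧ (⋃ i, U i) = Set.univ ∧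
    ∀ i, ∃ s : C(U i, C(I, X)),
      ∀ p : U i, (s p) 0 = (p : X × X).1 ∧ (s p) 1 = (p : X × X).2

/-- The (unreduced) topological complexity of `X`:  the smallest number of open sets in a
cover of `X × X` admitting continuous motion planning rules (`⊤` if there is none). -/
def topologicalComplexity (X : Type) [TopologicalSpace X] : ℕ∞ :=
  sInf {c : ℕ∞ | ∃ m : ℕ, c = m ∧ TCCoverable X m}

/-- The free path fibration `X^{[0,1]} → X × X`, `γ ↦ (γ(0), γ(1))`. -/
def pathFibration (X : Type) [TopologicalSpace X] : C(C(I, X), X × X) :=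
  ⟨fun γ => (γ 0, γ 1), (continuous_eval_const 0).prodMk (continuous_eval_const 1)⟩

/-- The Schwarz genus (sectional category) of the pullback of `p` along `f` is at most
`k`:  `Y` is covered by `k` open sets over each of which `f` lifts continuously
through `p`. -/
def GenusPullbackLE {E B : Type} [TopologicalSpace E] [TopologicalSpace B] (p : C(E, B))
    {Y : Type} [TopologicalSpace Y] (f : C(Y, B)) (k : ℕ) : Prop :=
  ∃ U : Fin k → Set Y, (∀ i, IsOpen (U i)) ∧ (⋃ i, U i) = Set.univ ∧
    ∀ i, ∃ s : C(U i, E), ∀ y : U i, p (s y) = f (y : Y)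

/-- The sectional category weight of a cohomology class `u` on the base of `p`:  the
supremum of those `m` such that `u` pulls back to zero along every map `f` for which
the pullback of `p` along `f` has Schwarz genus at most `m`. -/
def secatWeight {E B : Type} [TopologicalSpace E] [TopologicalSpace B] (p : C(E, B))
    {k : ℕ} (u : Hco k B) : ℕ∞ :=
  sSup {w : ℕ∞ | ∃ m : ℕ, w = m ∧ ∀ (Y : Type) [TopologicalSpace Y] (f : C(Y, B)),
    GenusPullbackLE p f m → Hcomap k f u = 0}

/-- The topological complexity weight:  sectional category weight with respect to the
free path fibration. -/
def tcWeight {X : Type} [TopologicalSpace X] {k : ℕ} (u : Hco k (X × X)) : ℕ∞ :=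
  secatWeight (pathFibration X) u

/-- The `n`-dimensional sphere. -/
abbrev unitSphere (n : ℕ) : Type :=
  ↥(Metric.sphere (0 : EuclideanSpace ℝ (Fin (n + 1))) 1)

/-- The 2-torus `T² = S¹ × S¹`. -/
abbrev Torus2 : Type := unitSphere 1 × unitSphere 1

/-- A degree-two rational homology class `v` is toroidal (relative to a fundamental class
`ωT` of the torus) if some map from the torus realises a non-zero multiple of `v`. -/
def IsToroidal {X : Type} [TopologicalSpace X] (ωT : H 2 Torus2) (v : H 2 X) : Prop :=
  ∃ (f : C(Torus2, X)) (α : ℚ), α ≠ 0 ∧ Hmap 2 f ωT = α • v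

/-- A non-zero degree-two rational homology class is atoroidal if it is not toroidal. -/
def IsAtoroidal {X : Type} [TopologicalSpace X] (ωT : H 2 Torus2) (v : H 2 X) : Prop :=
  v ≠ 0 ∧ ¬ IsToroidal ωT v

/-- A degree-two rational cohomology class `u` is toroidal if it pulls back non-trivially
under some map from the torus. -/
def IsCoToroidal {X : Type} [TopologicalSpace X] (u : Hco 2 X) : Prop :=
  ∃ f : C(Torus2, X), Hcomap 2 f u ≠ 0

/-- A non-zero degree-two rational cohomology class is atoroidal if it pulls back to zero
under every map from the torus. -/
def IsCoAtoroidal {X : Type} [TopologicalSpace X] (u : Hco 2 X) : Prop :=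
  u ≠ 0 ∧ ∀ f : C(Torus2, X), Hcomap 2 f u = 0


namespace Vietoris

variable {X Y : Type*}

/-- Finite formal real combinations of ordered simplices, a simplex being the list of its
vertices; the empty list is the augmentation simplex. -/
abbrev Chain (X : Type*) := List X →₀ ℝ

/-- The chain consisting of one simplex. -/
abbrev smp (l : List X) : Chain X := Finsupp.single l 1

lemma chain_hom_ext {M : Type*} [AddCommMonoid M] [Module ℝ M] {f g : Chain X →ₗ[ℝ] M}
    (h : ∀ l, f (smp l) = g (smp l)) : f = g :=
  Finsupp.lhom_ext' fun l => LinearMap.ext_ring (h l)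

/-- Prepend a vertex to every simplex. -/
def cone (x : X) : Chain X →ₗ[ℝ] Chain X := Finsupp.lmapDomain ℝ ℝ (List.cons x)

/-- Evaluation of a cochain. -/
def ev (φ : List X → ℝ) : Chain X →ₗ[ℝ] ℝ := Finsupp.linearCombination ℝ φ

/-- Apply a vertex map. -/
def push (f : X → Y) : Chain X →ₗ[ℝ] Chain Y := Finsupp.lmapDomain ℝ ℝ (List.map f)

/-- The boundary of a simplex. -/
def bdryList : List X → Chain X
  | [] => 0
  | x :: l => smp l - cone x (bdryList l)

/-- The augmented boundary operator. -/
def bdry : Chain X →ₗ[ℝ] Chain X := Finsupp.linearCombination ℝ bdryList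

@[simp] lemma cone_smp (x : X) (l : List X) : cone x (smp l) = smp (x :: l) := by
  simp [cone, Finsupp.mapDomain_single]

@[simp] lemma ev_smp (φ : List X → ℝ) (l : List X) : ev φ (smp l) = φ l := by
  simp [ev]

@[simp] lemma push_smp (f : X → Y) (l : List X) : push f (smp l) = smp (l.map f) := by
  simp [push, Finsupp.mapDomain_single]

lemma bdry_smp (l : List X) : bdry (smp l) = bdryList l := by simp [bdry]

@[simp] lemma bdry_smp_nil : bdry (smp ([] : List X)) = 0 := by simp [bdry_smp, bdryList]

@[simp] lemma bdry_smp_cons (x : X) (l : List X) :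
    bdry (smp (x :: l)) = smp l - cone x (bdry (smp l)) := by simp [bdry_smp, bdryList]

lemma bdry_cone (x : X) (c : Chain X) : bdry (cone x c) = c - cone x (bdry c) := by
  have : bdry ∘ₗ cone x = LinearMap.id - cone x ∘ₗ bdry := chain_hom_ext fun l => by simp
  exact LinearMap.congr_fun this c

lemma bdry_bdry (c : Chain X) : bdry (bdry c) = 0 := by
  have : (bdry ∘ₗ bdry : Chain X →ₗ[ℝ] Chain X) = 0 := chain_hom_ext fun l => by
    induction l with
    | nil => simp
    | cons x l ih =>
      simp only [LinearMap.comp_apply, LinearMap.zero_apply] at ih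
      simp [bdry_cone, ih]
  exact LinearMap.congr_fun this c

lemma push_cone (f : X → Y) (x : X) (c : Chain X) :
    push f (cone x c) = cone (f x) (push f c) := by
  have : push f ∘ₗ cone x = cone (f x) ∘ₗ push f := chain_hom_ext fun l => by simp
  exact LinearMap.congr_fun this c

lemma bdry_push (f : X → Y) (c : Chain X) : bdry (push f c) = push f (bdry c) := by
  have : bdry ∘ₗ push f = push f ∘ₗ bdry := chain_hom_ext fun l => by
    induction l with
    | nil => simp
    | cons x l ih =>
      simp only [LinearMap.comp_apply, push_smp] at ih
      simp [push_cone, ih]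
  exact LinearMap.congr_fun this c

lemma push_push {Z : Type*} (g : Y → Z) (f : X → Y) (c : Chain X) :
    push g (push f c) = push (g ∘ f) c := by
  have : push g ∘ₗ push f = push (g ∘ f) := chain_hom_ext fun l => by simp
  exact LinearMap.congr_fun this c

lemma ev_push (φ : List Y → ℝ) (f : X → Y) (c : Chain X) :
    ev φ (push f c) = ev (fun l => φ (l.map f)) c := by
  have : ev φ ∘ₗ push f = ev (fun l => φ (l.map f)) := chain_hom_ext fun l => by simp
  exact LinearMap.congr_fun this c

/-- The prism over a simplex. -/
def prismList (f g : X → Y) : List X → Chain Y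
  | [] => 0
  | x :: l => smp (f x :: g x :: l.map g) - cone (f x) (prismList f g l)

/-- The prism operator joining two vertex maps. -/
def prism (f g : X → Y) : Chain X →ₗ[ℝ] Chain Y := Finsupp.linearCombination ℝ (prismList f g)

lemma prism_smp (f g : X → Y) (l : List X) : prism f g (smp l) = prismList f g l := by
  simp [prism]

lemma prism_cone (f g : X → Y) (x : X) (c : Chain X) :
    prism f g (cone x c) = cone (f x) (cone (g x) (push g c)) - cone (f x) (prism f g c) := by
  have : prism f g ∘ₗ cone x =
      cone (f x) ∘ₗ cone (g x) ∘ₗ push g - cone (f x) ∘ₗ prism f g :=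
    chain_hom_ext fun l => by simp [prism_smp, prismList]
  exact LinearMap.congr_fun this c

lemma bdry_prism (f g : X → Y) (c : Chain X) :
    bdry (prism f g c) = push g c - push f c - prism f g (bdry c) := by
  have : bdry ∘ₗ prism f g = push g - push f - prism f g ∘ₗ bdry := chain_hom_ext fun l => by
    induction l with
    | nil => simp [prism_smp, prismList]
    | cons x l ih =>
      simp only [LinearMap.comp_apply, LinearMap.sub_apply] at ih ⊢
      rw [← cone_smp x l, prism_cone, map_sub, bdry_cone, bdry_cone, bdry_cone, ih,
        bdry_cone x, map_sub (prism f g), prism_cone, push_cone, push_cone, bdry_push]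
      simp only [map_sub]
      abel
  exact LinearMap.congr_fun this c

/-! ### Cup products of one-cochains -/

/-- The cup product of a one-cochain with a cochain. -/
def cupCons (a : X → X → ℝ) (ω : List X → ℝ) : List X → ℝ
  | x :: y :: l => a x y * ω (y :: l)
  | _ => 0

/-- The iterated cup product of one-cochains. -/
def cup : List (X → X → ℝ) → List X → ℝ
  | [] => fun l => if l.length = 1 then 1 else 0
  | a :: as => cupCons a (cup as)

/-- A one-cochain is additive on a simplex if it restricts to a cocycle there. -/
def AddOn (a : X → X → ℝ) (l : List X) : Prop :=
  ∀ x ∈ l, ∀ y ∈ l, ∀ z ∈ l, a x y + a y z = a x z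

lemma AddOn.mono {a : X → X → ℝ} {l l' : List X} (h : AddOn a l) (hl : l' ⊆ l) : AddOn a l' :=
  fun x hx y hy z hz => h x (hl hx) y (hl hy) z (hl hz)

lemma cup_nil_list (as : List (X → X → ℝ)) : cup as [] = 0 := by
  cases as <;> simp [cup, cupCons]

lemma ev_cupCons_cone_cone (a : X → X → ℝ) (ω : List X → ℝ) (x y : X) (c : Chain X) :
    ev (cupCons a ω) (cone x (cone y c)) = a x y * ev ω (cone y c) := by
  have : ev (cupCons a ω) ∘ₗ cone x ∘ₗ cone y = a x y • (ev ω ∘ₗ cone y) :=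
    chain_hom_ext fun l => by simp [cupCons]
  exact LinearMap.congr_fun this c

lemma ev_cupCons_bdry {a : X → X → ℝ} {ω : List X → ℝ} (hω : ω [] = 0) (x y : X) (l : List X)
    (ha : AddOn a (x :: y :: l)) :
    ev (cupCons a ω) (bdry (smp (x :: y :: l))) = - (a x y * ev ω (bdry (smp (y :: l)))) := by
  cases l with
  | nil => simp [cupCons, hω]
  | cons z l =>
    have h1 := ha x (by simp) y (by simp) z (by simp)
    rw [bdry_smp_cons, bdry_smp_cons y, map_sub, map_sub, map_sub, ev_cupCons_cone_cone,
      map_sub]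
    simp only [cone_smp, ev_smp, cupCons]
    rw [← h1]; ring

lemma ev_cup_bdry (as : List (X → X → ℝ)) (l : List X) (h : ∀ a ∈ as, AddOn a l) :
    ev (cup as) (bdry (smp l)) = 0 := by
  induction as generalizing l with
  | nil =>
    match l with
    | [] => simp
    | [x] => simp [cup]
    | [x, y] => simp [cup]
    | x :: y :: z :: l =>
      have key : ∀ c : Chain X, ev (cup []) (cone x (cone y c)) = 0 := fun c => by
        have : ev (cup []) ∘ₗ cone x ∘ₗ cone y = 0 := chain_hom_ext fun l => by simp [cup]
        exact LinearMap.congr_fun this c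
      rw [bdry_smp_cons, bdry_smp_cons y, map_sub, map_sub, map_sub, key]
      simp [cup]
  | cons a as ih =>
    match l with
    | [] => simp
    | [x] => simp [cup, cupCons]
    | x :: y :: l =>
      rw [cup, ev_cupCons_bdry (cup_nil_list as) x y l (h a (by simp)), ih, mul_zero, neg_zero]
      intro b hb
      exact (h b (by simp [hb])).mono (by simp)

/-- Changing each one-cochain by the coboundary of a function. -/
def shift (p : (X → X → ℝ) × (X → ℝ)) : X → X → ℝ := fun x y => p.1 x y - (p.2 y - p.2 x)

lemma AddOn.shift {a : X → X → ℝ} {g : X → ℝ} {l : List X} (h : AddOn a l) :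
    AddOn (shift (a, g)) l := fun x hx y hy z hz => by
  have := h x hx y hy z hz
  simp only [Vietoris.shift]; linarith

lemma exists_primitive (ps : List ((X → X → ℝ) × (X → ℝ))) :
    ∃ η : List X → ℝ, η [] = 0 ∧ ∀ l, (∀ p ∈ ps, AddOn p.1 l) →
      cup (ps.map Prod.fst) l - cup (ps.map shift) l = ev η (bdry (smp l)) := by
  induction ps with
  | nil => exact ⟨0, rfl, fun l _ => by simp [ev]⟩
  | cons p ps ih =>
    obtain ⟨η, h0, hη⟩ := ih
    obtain ⟨a, g⟩ := p
    let θ : List X → ℝ := fun l => match l with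
      | [] => 0
      | x :: l => g x * cup (ps.map Prod.fst) (x :: l)
    have hθcone : ∀ x (c : Chain X),
        ev θ (cone x c) = g x * ev (cup (ps.map Prod.fst)) (cone x c) := fun x c => by
      have : ev θ ∘ₗ cone x = g x • (ev (cup (ps.map Prod.fst)) ∘ₗ cone x) :=
        chain_hom_ext fun l => by simp [θ]
      exact LinearMap.congr_fun this c
    refine ⟨fun l => θ l - cupCons (shift (a, g)) η l, by simp [θ, cupCons], fun l hl => ?_⟩
    have hev : ∀ c, ev (fun l => θ l - cupCons (shift (a, g)) η l) c
        = ev θ c - ev (cupCons (shift (a, g)) η) c := fun c => by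
      have : ev (fun l => θ l - cupCons (shift (a, g)) η l)
        = ev θ - ev (cupCons (shift (a, g)) η) := chain_hom_ext fun l => by simp
      exact LinearMap.congr_fun this c
    rw [hev]
    match l with
    | [] => simp [cup, cupCons]
    | [x] => simp [cup, cupCons, θ]
    | x :: y :: l =>
      have hps : ∀ l' ⊆ x :: y :: l, ∀ p ∈ ps, AddOn p.1 l' := fun l' hl' p hp =>
        (hl p (by simp [hp])).mono hl'
      rw [ev_cupCons_bdry h0 x y l (hl (a, g) (by simp)).shift, ← hη _ (hps _ (by simp))]
      have hc := ev_cup_bdry (ps.map Prod.fst) (x :: y :: l) (by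
        simp only [List.mem_map, forall_exists_index, and_imp]
        rintro b p hp rfl; exact hps _ (by simp) p hp)
      rw [bdry_smp_cons, map_sub, ev_smp] at hc ⊢
      rw [hθcone, ← sub_eq_zero.1 hc]
      simp only [List.map_cons, cup, cupCons, shift, θ]
      ring

/-- Cohomologous one-cochains have the same cup product on cycles. -/
lemma ev_cup_shift (ps : List ((X → X → ℝ) × (X → ℝ))) (S : Set (List X))
    (hS : ∀ l ∈ S, ∀ p ∈ ps, AddOn p.1 l) (c : Chain X) (hc : c ∈ Finsupp.supported ℝ ℝ S)
    (hz : bdry c = 0) :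
    ev (cup (ps.map Prod.fst)) c = ev (cup (ps.map shift)) c := by
  obtain ⟨η, -, hη⟩ := exists_primitive ps
  have key : ∀ c ∈ Finsupp.supported ℝ ℝ S,
      ev (cup (ps.map Prod.fst)) c - ev (cup (ps.map shift)) c = ev η (bdry c) := by
    intro c hc
    rw [Finsupp.supported_eq_span_single] at hc
    induction hc using Submodule.span_induction with
    | mem c hc =>
      obtain ⟨l, hl, rfl⟩ := hc
      simpa using hη l (hS l hl)
    | zero => simp
    | add a b _ _ ha hb => simp only [map_add, ← ha, ← hb]; ring
    | smul r a _ ha => simp only [map_smul, ← ha, smul_eq_mul]; ring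
  have := key c hc
  rw [hz, map_zero] at this
  linarith

lemma ev_eq_zero_of_supported {φ : List X → ℝ} {S : Set (List X)} (h : ∀ l ∈ S, φ l = 0)
    {c : Chain X} (hc : c ∈ Finsupp.supported ℝ ℝ S) : ev φ c = 0 := by
  rw [Finsupp.supported_eq_span_single] at hc
  induction hc using Submodule.span_induction with
  | mem c hc => obtain ⟨l, hl, rfl⟩ := hc; simpa using h l hl
  | zero => simp
  | add a b _ _ ha hb => simp [ha, hb]
  | smul r a _ ha => simp [ha]

lemma ev_cup_bdry_of_supported (as : List (X → X → ℝ)) {S : Set (List X)}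
    (hS : ∀ l ∈ S, ∀ a ∈ as, AddOn a l) {c : Chain X} (hc : c ∈ Finsupp.supported ℝ ℝ S) :
    ev (cup as) (bdry c) = 0 := by
  rw [Finsupp.supported_eq_span_single] at hc
  induction hc using Submodule.span_induction with
  | mem c hc => obtain ⟨l, hl, rfl⟩ := hc; exact ev_cup_bdry as l (hS l hl)
  | zero => simp
  | add a b _ _ ha hb => simp [ha, hb]
  | smul r a _ ha => simp [ha]

lemma cup_eq_zero {as : List (X → X → ℝ)} {l : List X}
    (h : ∃ a ∈ as, ∀ x ∈ l, ∀ y ∈ l, a x y = 0) : cup as l = 0 := by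
  induction as generalizing l with
  | nil => simp at h
  | cons b as ih =>
    match l with
    | [] => simp [cup, cupCons]
    | [x] => simp [cup, cupCons]
    | x :: y :: l =>
      simp only [cup, cupCons]
      obtain ⟨a, ha, h⟩ := h
      rcases List.mem_cons.1 ha with rfl | ha
      · rw [h x (by simp) y (by simp), zero_mul]
      · rw [ih ⟨a, ha, fun x hx y hy => h x (by simp [hx]) y (by simp [hy])⟩, mul_zero]

lemma cup_map (f : X → Y) (as : List (Y → Y → ℝ)) (l : List X) :
    cup as (l.map f) = cup (as.map fun a x y => a (f x) (f y)) l := by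
  induction as generalizing l with
  | nil => simp [cup]
  | cons a as ih =>
    match l with
    | [] => simp [cup, cupCons]
    | [x] => simp [cup, cupCons]
    | x :: y :: l =>
      have := ih (y :: l)
      rw [List.map_cons] at this
      simp [cup, cupCons, this]

variable {X Y : Type*}

/-! ### The cross product -/

/-- The shuffle product of two simplices. -/
def crossList : List X → List Y → Chain (X × Y)
  | [], _ => 0
  | _ :: _, [] => 0
  | x :: l, y :: m => cone (x, y)
      ((if l.length = 0 ∧ m.length = 0 then smp [] else 0) + crossList l (y :: m)
        + (-1 : ℝ) ^ l.length • crossList (x :: l) m)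
termination_by l m => l.length + m.length

/-- The cross product of chains. -/
def cross : Chain X →ₗ[ℝ] Chain Y →ₗ[ℝ] Chain (X × Y) :=
  Finsupp.linearCombination ℝ fun l => Finsupp.linearCombination ℝ (crossList l)

@[simp] lemma cross_smp (l : List X) (m : List Y) : cross (smp l) (smp m) = crossList l m := by
  simp [cross]

/-- The sign operator. -/
def sgn : Chain X →ₗ[ℝ] Chain X :=
  Finsupp.linearCombination ℝ fun l => (-1 : ℝ) ^ l.length • smp l

lemma sgn_smp (l : List X) : sgn (smp l) = (-1 : ℝ) ^ l.length • smp l := by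
  simp [sgn]

lemma sgn_cone (x : X) (c : Chain X) : sgn (cone x c) = - cone x (sgn c) := by
  have : sgn ∘ₗ cone x = - (cone x ∘ₗ sgn) := chain_hom_ext fun l => by
    simp only [LinearMap.comp_apply, LinearMap.neg_apply, cone_smp, sgn_smp, map_smul,
      List.length_cons, pow_succ]
    simp
  exact LinearMap.congr_fun this c

lemma sgn_bdry_smp (l : List X) : sgn (bdry (smp l)) = - (-1 : ℝ) ^ l.length • bdry (smp l) := by
  induction l with
  | nil => simp
  | cons x l ih =>
    rw [bdry_smp_cons, map_sub, sgn_cone, ih, sgn_smp, List.length_cons, pow_succ]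
    simp only [map_smul, smul_sub]
    module

/-- The product of the augmentation simplices. -/
def unitPart : Chain X →ₗ[ℝ] Chain Y →ₗ[ℝ] Chain (X × Y) :=
  Finsupp.linearCombination ℝ fun l => Finsupp.linearCombination ℝ fun m =>
    if l.length = 0 ∧ m.length = 0 then smp [] else 0

lemma unitPart_smp (l : List X) (m : List Y) :
    unitPart (smp l) (smp m) = if l.length = 0 ∧ m.length = 0 then smp [] else 0 := by
  simp [unitPart]

lemma cross_cone_cone (x : X) (y : Y) (u : Chain X) (v : Chain Y) :
    cross (cone x u) (cone y v) = cone (x, y)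
      (unitPart u v + cross u (cone y v) + cross (cone x (sgn u)) v) := by
  have : (cross ∘ₗ cone x).compl₂ (cone y) =
      ((unitPart + cross.compl₂ (cone y) + cross ∘ₗ cone x ∘ₗ sgn).compr₂ (cone (x, y)) :
        Chain X →ₗ[ℝ] Chain Y →ₗ[ℝ] Chain (X × Y)) :=
    chain_hom_ext fun l => chain_hom_ext fun m => by
      simp only [LinearMap.compl₂_apply, LinearMap.comp_apply, LinearMap.compr₂_apply,
        LinearMap.add_apply, cone_smp, cross_smp, sgn_smp, unitPart_smp, map_smul,
        LinearMap.smul_apply]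
      rw [crossList]
  exact LinearMap.congr_fun (LinearMap.congr_fun this u) v

@[simp] lemma cross_nil_left (v : Chain Y) : cross (smp ([] : List X)) v = 0 := by
  have : cross (smp ([] : List X)) = (0 : Chain Y →ₗ[ℝ] Chain (X × Y)) :=
    chain_hom_ext fun m => by simp [crossList]
  exact LinearMap.congr_fun this v

@[simp] lemma cross_nil_right (u : Chain X) : cross u (smp ([] : List Y)) = 0 := by
  have : cross.flip (smp ([] : List Y)) = (0 : Chain X →ₗ[ℝ] Chain (X × Y)) :=
    chain_hom_ext fun l => by cases l <;> simp [crossList]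
  exact LinearMap.congr_fun this u

lemma unitPart_bdry_left (l : List X) (m : List Y) :
    unitPart (bdry (smp l)) (smp m) =
      if l.length = 1 ∧ m.length = 0 then smp [] else 0 := by
  have key : ∀ (x : X) (u : Chain X) (v : Chain Y), unitPart (cone x u) v = 0 := fun x u v => by
    have : unitPart ∘ₗ cone x = (0 : Chain X →ₗ[ℝ] Chain Y →ₗ[ℝ] Chain (X × Y)) :=
      chain_hom_ext fun l => chain_hom_ext fun m => by simp [unitPart_smp]
    exact LinearMap.congr_fun (LinearMap.congr_fun this u) v
  cases l with
  | nil => simp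
  | cons x l =>
    rw [bdry_smp_cons, map_sub, LinearMap.sub_apply, key, unitPart_smp]
    simp

lemma unitPart_bdry_right (l : List X) (m : List Y) :
    unitPart (smp l) (bdry (smp m)) =
      if l.length = 0 ∧ m.length = 1 then smp [] else 0 := by
  have key : ∀ (y : Y) (u : Chain X) (v : Chain Y), unitPart u (cone y v) = 0 := fun y u v => by
    have : unitPart.compl₂ (cone y) = (0 : Chain X →ₗ[ℝ] Chain Y →ₗ[ℝ] Chain (X × Y)) :=
      chain_hom_ext fun l => chain_hom_ext fun m => by simp [unitPart_smp]
    exact LinearMap.congr_fun (LinearMap.congr_fun this u) v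
  cases m with
  | nil => simp
  | cons x l =>
    rw [bdry_smp_cons, map_sub, key, unitPart_smp]
    simp

lemma bdry_crossList (l : List X) (m : List Y) :
    bdry (cross (smp l) (smp m)) = cross (bdry (smp l)) (smp m)
      - (-1 : ℝ) ^ l.length • cross (smp l) (bdry (smp m))
      + if l.length = 1 ∧ m.length = 1 then smp [] else 0 := by
  match l, m with
  | [], m => simp [crossList]
  | x :: l, [] => simp
  | x :: l, y :: m =>
    have h1 := bdry_crossList l (y :: m)
    have h2 := bdry_crossList (x :: l) m
    have e0 : cross (smp (x :: l)) (smp (y :: m)) = cone (x, y)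
        ((if l.length = 0 ∧ m.length = 0 then smp [] else 0) + cross (smp l) (smp (y :: m))
        + (-1 : ℝ) ^ l.length • cross (smp (x :: l)) (smp m)) := by
      simp [crossList]
    have e1 : cross (cone x (bdry (smp l))) (smp (y :: m)) = cone (x, y)
        ((if l.length = 1 ∧ m.length = 0 then smp [] else 0)
          + cross (bdry (smp l)) (smp (y :: m))
          - (-1 : ℝ) ^ l.length • cross (cone x (bdry (smp l))) (smp m)) := by
      rw [← cone_smp y m, cross_cone_cone, unitPart_bdry_left, sgn_bdry_smp]
      simp only [map_smul, LinearMap.smul_apply, neg_smul, ← sub_eq_add_neg, map_neg,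
        LinearMap.neg_apply]
    have e2 : cross (smp (x :: l)) (cone y (bdry (smp m))) = cone (x, y)
        ((if l.length = 0 ∧ m.length = 1 then smp [] else 0)
          + cross (smp l) (cone y (bdry (smp m)))
          + (-1 : ℝ) ^ l.length • cross (smp (x :: l)) (bdry (smp m))) := by
      rw [← cone_smp x l, cross_cone_cone, unitPart_bdry_right, sgn_smp]
      simp only [map_smul, LinearMap.smul_apply, cone_smp]
    have e3 : bdry (if l.length = 0 ∧ m.length = 0 then smp [] else 0 : Chain (X × Y)) = 0 := by
      split_ifs <;> simp
    have l1 : ∀ i j : ℕ, (if i = 1 ∧ j + 1 = 1 then smp [] else 0 : Chain (X × Y)) =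
        if i = 1 ∧ j = 0 then smp [] else 0 := fun i j => by simp
    have l2 : ∀ i j : ℕ, (if i + 1 = 1 ∧ j = 1 then smp [] else 0 : Chain (X × Y)) =
        if i = 0 ∧ j = 1 then smp [] else 0 := fun i j => by simp
    have l3 : ∀ i j : ℕ, (if i + 1 = 1 ∧ j = 0 then smp [] else 0 : Chain (X × Y)) =
        if i = 0 ∧ j = 0 then smp [] else 0 := fun i j => by simp
    rw [e0, bdry_cone, map_add bdry, map_add bdry, map_smul bdry, e3, h1, h2]
    simp only [bdry_smp_cons, map_sub, LinearMap.sub_apply]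
    rw [e1, e2]
    simp only [List.length_cons, l1, l2, l3, pow_succ, map_sub, map_add, map_smul,
      map_zero]
    rcases neg_one_pow_eq_or ℝ l.length with h | h <;> simp only [h] <;> module
termination_by l.length + m.length

/-- The cross product of cycles is a cycle. -/
lemma bdry_cross {S : Set (List X)} {k : ℕ} (hS : ∀ l ∈ S, l.length = k)
    (hk : k ≠ 1) {u : Chain X} {v : Chain Y}
    (hu : u ∈ Finsupp.supported ℝ ℝ S) (hu0 : bdry u = 0) (hv0 : bdry v = 0) :
    bdry (cross u v) = 0 := by
  have key : ∀ u ∈ Finsupp.supported ℝ ℝ S, bdry (cross u v) = cross (bdry u) v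
      - (-1 : ℝ) ^ k • cross u (bdry v) := by
    intro u hu
    rw [Finsupp.supported_eq_span_single] at hu
    induction hu using Submodule.span_induction with
    | mem c hc =>
      obtain ⟨l, hl, rfl⟩ := hc
      have : bdry ∘ₗ cross (smp l) = cross (bdry (smp l))
          - (-1 : ℝ) ^ k • (cross (smp l) ∘ₗ bdry : Chain Y →ₗ[ℝ] Chain (X × Y)) :=
        chain_hom_ext fun m => by
          have := bdry_crossList l m
          rw [hS l hl] at this
          simpa [hk] using this
      exact LinearMap.congr_fun this v
    | zero => simp
    | add a b _ _ ha hb => simp only [map_add, LinearMap.add_apply, ha, hb]; module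
    | smul r a _ ha => simp only [map_smul, LinearMap.smul_apply, ha]; module
  rw [key u hu, hu0, hv0]; simp

lemma cross_mem_supported {S : Set (List X)} {T : Set (List Y)} {R : Set (List (X × Y))}
    (h : ∀ l ∈ S, ∀ m ∈ T, crossList l m ∈ Finsupp.supported ℝ ℝ R)
    {u : Chain X} {v : Chain Y} (hu : u ∈ Finsupp.supported ℝ ℝ S)
    (hv : v ∈ Finsupp.supported ℝ ℝ T) : cross u v ∈ Finsupp.supported ℝ ℝ R := by
  rw [Finsupp.supported_eq_span_single] at hu hv
  induction hu using Submodule.span_induction with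
  | mem c hc =>
    obtain ⟨l, hl, rfl⟩ := hc
    induction hv using Submodule.span_induction with
    | mem c hc =>
      obtain ⟨m, hm, rfl⟩ := hc
      simpa using h l hl m hm
    | zero => simp
    | add a b _ _ ha hb => rw [map_add]; exact add_mem ha hb
    | smul r a _ ha => rw [map_smul]; exact Submodule.smul_mem _ _ ha
  | zero => simp
  | add a b _ _ ha hb => rw [map_add]; exact add_mem ha hb
  | smul r a _ ha => rw [map_smul]; exact Submodule.smul_mem _ _ ha

lemma cone_mem_supported {S T : Set (List X)} {x : X} (h : ∀ l ∈ S, x :: l ∈ T)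
    {c : Chain X} (hc : c ∈ Finsupp.supported ℝ ℝ S) : cone x c ∈ Finsupp.supported ℝ ℝ T := by
  rw [Finsupp.supported_eq_span_single] at hc
  induction hc using Submodule.span_induction with
  | mem c hc =>
    obtain ⟨l, hl, rfl⟩ := hc
    rw [cone_smp]; exact Finsupp.single_mem_supported _ _ (h l hl)
  | zero => simp
  | add a b _ _ ha hb => rw [map_add]; exact add_mem ha hb
  | smul r a _ ha => rw [map_smul]; exact Submodule.smul_mem _ _ ha

lemma crossList_mem_supported (l : List X) (m : List Y) :
    crossList l m ∈ Finsupp.supported ℝ ℝ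
      {s : List (X × Y) | s.length + 1 = l.length + m.length ∧ ∀ p ∈ s, p.1 ∈ l ∧ p.2 ∈ m} := by
  match l, m with
  | [], m => simp [crossList]
  | x :: l, [] => simp [crossList]
  | x :: l, y :: m =>
    have h1 := crossList_mem_supported l (y :: m)
    have h2 := crossList_mem_supported (x :: l) m
    rw [crossList]
    refine cone_mem_supported (S := {s : List (X × Y) | s.length + 2 = (x :: l).length
      + (y :: m).length ∧ ∀ p ∈ s, p.1 ∈ x :: l ∧ p.2 ∈ y :: m}) ?_ (add_mem (add_mem ?_ ?_) ?_)
    · rintro s ⟨hs, h⟩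
      refine ⟨by simp at hs ⊢; omega, fun p hp => ?_⟩
      rcases List.mem_cons.1 hp with rfl | hp
      · simp
      · exact h p hp
    · split_ifs with h
      · apply Finsupp.single_mem_supported
        simp [h.1, h.2]
      · simp
    · refine Finsupp.supported_mono ?_ h1
      rintro s ⟨hs, h⟩
      refine ⟨by simp at hs ⊢; omega, fun p hp => ⟨List.mem_cons_of_mem _ (h p hp).1, (h p hp).2⟩⟩
    · refine Submodule.smul_mem _ _ (Finsupp.supported_mono ?_ h2)
      rintro s ⟨hs, h⟩
      refine ⟨by simp at hs ⊢; omega, fun p hp => ⟨(h p hp).1, List.mem_cons_of_mem _ (h p hp).2⟩⟩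
termination_by l.length + m.length

variable {X Y : Type*}

/-! ### Evaluation of cup products on cross products -/

lemma cup_congr {ι : Type*} {cs : List ι} {F G : ι → X → X → ℝ} {l : List X}
    (h : ∀ c ∈ cs, ∀ x ∈ l, ∀ y ∈ l, F c x y = G c x y) : cup (cs.map F) l = cup (cs.map G) l := by
  induction cs generalizing l with
  | nil => rfl
  | cons c cs ih =>
    match l with
    | [] => simp [cup, cupCons]
    | [x] => simp [cup, cupCons]
    | x :: y :: l =>
      simp only [List.map_cons, cup, cupCons]
      rw [h c (by simp) x (by simp) y (by simp), ih]
      exact fun d hd x hx y hy => h d (by simp [hd]) x (by simp [hx]) y (by simp [hy])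

lemma cup_neg {ι : Type*} (cs : List ι) (F : ι → X → X → ℝ) (l : List X) :
    cup (cs.map fun c x y => - F c x y) l = (-1) ^ cs.length * cup (cs.map F) l := by
  induction cs generalizing l with
  | nil => simp
  | cons c cs ih =>
    match l with
    | [] => simp [cup, cupCons]
    | [x] => simp [cup, cupCons]
    | x :: y :: l =>
      simp only [List.map_cons, cup, cupCons, ih, List.length_cons, pow_succ]
      ring

lemma crossList_singleton_left (x : X) (m : List Y) (hm : m ≠ []) :
    crossList [x] m = smp (m.map (Prod.mk x)) := by
  induction m with
  | nil => simp at hm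
  | cons y m ih =>
    rw [crossList]
    rcases m with _ | ⟨z, m⟩
    · simp [crossList]
    · rw [ih (by simp)]; simp [crossList]

lemma crossList_singleton_right (l : List X) (y : Y) (hl : l ≠ []) :
    crossList l [y] = smp (l.map fun x => (x, y)) := by
  induction l with
  | nil => simp at hl
  | cons x l ih =>
    rw [crossList]
    rcases l with _ | ⟨z, l⟩
    · simp [crossList]
    · rw [ih (by simp)]; simp [crossList]

lemma ev_cupCons_cone_crossList (a : X × Y → X × Y → ℝ) (ω : List (X × Y) → ℝ) (p : X × Y)
    (x : X) (l : List X) (y : Y) (m : List Y) :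
    ev (cupCons a ω) (cone p (crossList (x :: l) (y :: m)))
      = a p (x, y) * ev ω (crossList (x :: l) (y :: m)) := by
  rw [crossList, ev_cupCons_cone_cone]

lemma ev_cup_crossList (as : List (X → X → ℝ)) (bs : List (Y → Y → ℝ))
    (ha : ∀ a ∈ as, ∀ x, a x x = 0) (l : List X) (m : List Y)
    (hl : l.length = as.length + 1) (hm : m.length = bs.length + 1) :
    ev (cup (as.map (fun a p q => a p.1 q.1) ++ bs.map fun b p q => b p.2 q.2)) (crossList l m)
      = cup as l * cup bs m := by
  induction as generalizing l with
  | nil =>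
    obtain ⟨x, rfl⟩ := List.length_eq_one_iff.1 (by simpa using hl)
    rw [crossList_singleton_left x m (by rintro rfl; simp at hm), ev_smp, List.map_nil,
      List.nil_append, cup_map]
    simp [cup, Function.comp_def]
  | cons a as ih =>
    match l, m with
    | x :: x' :: l, y :: m =>
      rw [crossList]
      simp only [List.length_cons, Nat.succ_ne_zero, false_and, if_false, zero_add, map_add,
        map_smul, List.map_cons, List.cons_append, cup]
      rw [ev_cupCons_cone_crossList, ih (fun b hb => ha b (by simp [hb])) _ (by simpa using hl)]
      have : ev (cupCons (fun p q => a p.1 q.1) (cup (as.map (fun a p q => a p.1 q.1) ++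
          bs.map fun b p q => b p.2 q.2))) (cone (x, y) (crossList (x :: x' :: l) m)) = 0 := by
        match m with
        | [] => simp [crossList]
        | z :: m => rw [ev_cupCons_cone_crossList]; simp [ha a (by simp) x]
      rw [this]
      simp [cupCons]; ring
    | [x], m => simp at hl
    | [], m => simp at hl
    | _, [] => simp at hm

lemma ev_cup_crossList_swap (as : List (X → X → ℝ)) (bs : List (Y → Y → ℝ))
    (hb : ∀ b ∈ bs, ∀ y, b y y = 0) (l : List X) (m : List Y)
    (hl : l.length = as.length + 1) (hm : m.length = bs.length + 1) :
    ev (cup (bs.map (fun b p q => b p.2 q.2) ++ as.map fun a p q => a p.1 q.1)) (crossList l m)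
      = (-1) ^ (as.length * bs.length) * (cup as l * cup bs m) := by
  induction bs generalizing m with
  | nil =>
    obtain ⟨y, rfl⟩ := List.length_eq_one_iff.1 (by simpa using hm)
    rw [crossList_singleton_right l y (by rintro rfl; simp at hl), ev_smp, List.map_nil,
      List.nil_append, cup_map]
    simp [cup, Function.comp_def]
  | cons b bs ih =>
    match l, m with
    | x :: l, y :: y' :: m =>
      rw [crossList]
      simp only [List.length_cons, Nat.succ_ne_zero, and_false, if_false, zero_add, map_add,
        map_smul, List.map_cons, List.cons_append, cup]
      rw [ev_cupCons_cone_crossList, ih (fun b h => hb b (by simp [h])) _ (by simpa using hm)]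
      have : ev (cupCons (fun p q => b p.2 q.2) (cup (bs.map (fun b p q => b p.2 q.2) ++
          as.map fun a p q => a p.1 q.1))) (cone (x, y) (crossList l (y :: y' :: m))) = 0 := by
        match l with
        | [] => simp [crossList]
        | z :: m => rw [ev_cupCons_cone_crossList]; simp [hb b (by simp) y]
      rw [this]
      have h : l.length = as.length := by simpa using hl
      simp [cupCons, h, mul_add, pow_add]; ring
    | l, [y] => simp at hm
    | l, [] => simp at hm
    | [], _ => simp at hl

lemma ev_cross_eq {Φ : List (X × Y) → ℝ} {φ : List X → ℝ} {ψ : List Y → ℝ} {S : Set (List X)}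
    {T : Set (List Y)} {r : ℝ} (h : ∀ l ∈ S, ∀ m ∈ T, ev Φ (crossList l m) = r * (φ l * ψ m))
    {u : Chain X} {v : Chain Y} (hu : u ∈ Finsupp.supported ℝ ℝ S)
    (hv : v ∈ Finsupp.supported ℝ ℝ T) : ev Φ (cross u v) = r * (ev φ u * ev ψ v) := by
  rw [Finsupp.supported_eq_span_single] at hu hv
  induction hu using Submodule.span_induction with
  | mem c hc =>
    obtain ⟨l, hl, rfl⟩ := hc
    induction hv using Submodule.span_induction with
    | mem c hc =>
      obtain ⟨m, hm, rfl⟩ := hc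
      simpa using h l hl m hm
    | zero => simp
    | add a b _ _ ha hb => rw [map_add, map_add, ha, hb, map_add]; ring
    | smul r a _ ha => rw [map_smul, map_smul, ha, map_smul]; simp only [smul_eq_mul]; ring
  | zero => simp
  | add a b _ _ ha hb =>
    rw [map_add, LinearMap.add_apply, map_add, ha, hb, map_add]; ring
  | smul r a _ ha =>
    rw [map_smul, LinearMap.smul_apply, map_smul, ha, map_smul]; simp only [smul_eq_mul]; ring

variable {X Y : Type*}

/-! ### Small chains -/

lemma map_mem_of_supported {M : Type*} [AddCommGroup M] [Module ℝ M] (f : Chain X →ₗ[ℝ] M)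
    (p : Submodule ℝ M) {S : Set (List X)} (h : ∀ l ∈ S, f (smp l) ∈ p) {c : Chain X}
    (hc : c ∈ Finsupp.supported ℝ ℝ S) : f c ∈ p := by
  rw [Finsupp.supported_eq_span_single] at hc
  have : Submodule.span ℝ ((fun i => Finsupp.single i (1 : ℝ)) '' S) ≤ p.comap f :=
    Submodule.span_le.2 (by rintro _ ⟨l, hl, rfl⟩; exact h l hl)
  exact this hc

/-- The simplices with `n` vertices in `A`, any two of them related by `E`. -/
def smallSimp (E : Set (X × X)) (A : Set X) (n : ℕ) : Set (List X) :=
  {l | l.length = n ∧ (∀ x ∈ l, x ∈ A) ∧ ∀ x ∈ l, ∀ y ∈ l, (x, y) ∈ E}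

/-- Chains of small simplices. -/
def Ch (E : Set (X × X)) (A : Set X) (n : ℕ) : Submodule ℝ (Chain X) :=
  Finsupp.supported ℝ ℝ (smallSimp E A n)

lemma smallSimp_mono {E E' : Set (X × X)} {A A' : Set X} {n : ℕ} (hE : E ⊆ E') (hA : A ⊆ A') :
    smallSimp E A n ⊆ smallSimp E' A' n := fun _ h =>
  ⟨h.1, fun x hx => hA (h.2.1 x hx), fun x hx y hy => hE (h.2.2 x hx y hy)⟩

lemma Ch_mono {E E' : Set (X × X)} {A A' : Set X} {n : ℕ} (hE : E ⊆ E') (hA : A ⊆ A') :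
    Ch E A n ≤ Ch E' A' n := Finsupp.supported_mono (smallSimp_mono hE hA)

lemma smp_mem_Ch {E : Set (X × X)} {A : Set X} {n : ℕ} {l : List X} (h : l ∈ smallSimp E A n) :
    smp l ∈ Ch E A n := Finsupp.single_mem_supported _ _ h

lemma bdryList_mem (l : List X) :
    bdryList l ∈ Finsupp.supported ℝ ℝ {l' : List X | l'.length + 1 = l.length ∧ l' ⊆ l} := by
  induction l with
  | nil => simp [bdryList]
  | cons x l ih =>
    refine sub_mem (Finsupp.single_mem_supported _ _ (by simp)) (cone_mem_supported ?_ ih)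
    rintro l' ⟨h1, h2⟩
    exact ⟨by simpa using h1, List.cons_subset_cons _ h2⟩

lemma bdry_mem {E : Set (X × X)} {A : Set X} {n : ℕ} {c : Chain X} (hc : c ∈ Ch E A (n + 1)) :
    bdry c ∈ Ch E A n := by
  refine map_mem_of_supported bdry _ (fun l hl => ?_) hc
  rw [bdry_smp]
  refine Finsupp.supported_mono ?_ (bdryList_mem l)
  rintro l' ⟨h1, h2⟩
  exact ⟨by have := hl.1; omega, fun x hx => hl.2.1 x (h2 hx),
    fun x hx y hy => hl.2.2 x (h2 hx) y (h2 hy)⟩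

lemma push_mem {E : Set (X × X)} {E' : Set (Y × Y)} {A : Set X} {B : Set Y} {n : ℕ} {f : X → Y}
    (hf : ∀ x ∈ A, f x ∈ B) (hE : ∀ x ∈ A, ∀ y ∈ A, (x, y) ∈ E → (f x, f y) ∈ E')
    {c : Chain X} (hc : c ∈ Ch E A n) : push f c ∈ Ch E' B n := by
  refine map_mem_of_supported (push f) _ (fun l hl => ?_) hc
  rw [push_smp]
  refine smp_mem_Ch ⟨by simpa using hl.1, ?_, ?_⟩
  · simp only [List.mem_map, forall_exists_index, and_imp, forall_apply_eq_imp_iff₂]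
    exact fun x hx => hf x (hl.2.1 x hx)
  · simp only [List.mem_map, forall_exists_index, and_imp, forall_apply_eq_imp_iff₂]
    exact fun x hx y hy => hE x (hl.2.1 x hx) y (hl.2.1 y hy) (hl.2.2 x hx y hy)

lemma push_congr {E : Set (X × X)} {A : Set X} {n : ℕ} {f g : X → Y} (h : ∀ x ∈ A, f x = g x)
    {c : Chain X} (hc : c ∈ Ch E A n) : push f c = push g c := by
  have := map_mem_of_supported (push f - push g) ⊥ (fun l hl => ?_) hc
  · simpa [sub_eq_zero] using this
  · simp only [LinearMap.sub_apply, push_smp, Submodule.mem_bot]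
    rw [List.map_congr_left (fun x hx => h x (hl.2.1 x hx)), sub_self]

lemma push_id (c : Chain X) : push id c = c := by
  have : push id = (LinearMap.id : Chain X →ₗ[ℝ] Chain X) := chain_hom_ext fun l => by simp
  exact LinearMap.congr_fun this c

lemma prismList_mem (f g : X → Y) (l : List X) :
    prismList f g l ∈ Finsupp.supported ℝ ℝ
      {l' : List Y | l'.length = l.length + 1 ∧ ∀ p ∈ l', ∃ x ∈ l, p = f x ∨ p = g x} := by
  induction l with
  | nil => simp [prismList]
  | cons x l ih =>
    refine sub_mem (Finsupp.single_mem_supported _ _ ⟨by simp, ?_⟩) (cone_mem_supported ?_ ih)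
    · intro p hp
      simp only [List.mem_cons, List.mem_map] at hp
      rcases hp with rfl | rfl | ⟨y, hy, rfl⟩
      · exact ⟨x, by simp, Or.inl rfl⟩
      · exact ⟨x, by simp, Or.inr rfl⟩
      · exact ⟨y, by simp [hy], Or.inr rfl⟩
    · rintro l' ⟨h1, h2⟩
      refine ⟨by simpa using h1, fun p hp => ?_⟩
      rcases List.mem_cons.1 hp with rfl | hp
      · exact ⟨x, by simp, Or.inl rfl⟩
      · obtain ⟨y, hy, h⟩ := h2 p hp
        exact ⟨y, by simp [hy], h⟩

lemma prism_mem {E : Set (X × X)} {E' : Set (Y × Y)} {A : Set X} {B : Set Y} {n : ℕ}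
    {f g : X → Y} (hf : ∀ x ∈ A, f x ∈ B) (hg : ∀ x ∈ A, g x ∈ B)
    (hE : ∀ x ∈ A, ∀ y ∈ A, (x, y) ∈ E → (f x, f y) ∈ E' ∧ (f x, g y) ∈ E' ∧ (g x, f y) ∈ E' ∧
      (g x, g y) ∈ E')
    {c : Chain X} (hc : c ∈ Ch E A n) : prism f g c ∈ Ch E' B (n + 1) := by
  refine map_mem_of_supported (prism f g) _ (fun l hl => ?_) hc
  rw [prism_smp]
  refine Finsupp.supported_mono ?_ (prismList_mem f g l)
  rintro l' ⟨h1, h2⟩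
  refine ⟨by rw [h1, hl.1], fun p hp => ?_, fun p hp q hq => ?_⟩
  · obtain ⟨x, hx, rfl | rfl⟩ := h2 p hp
    exacts [hf x (hl.2.1 x hx), hg x (hl.2.1 x hx)]
  · obtain ⟨x, hx, h⟩ := h2 p hp
    obtain ⟨y, hy, h'⟩ := h2 q hq
    have := hE x (hl.2.1 x hx) y (hl.2.1 y hy) (hl.2.2 x hx y hy)
    rcases h with rfl | rfl <;> rcases h' with rfl | rfl <;> simp [this]

lemma mem_Ch_inter {E : Set (X × X)} {A B : Set X} {n : ℕ} {c : Chain X} (hA : c ∈ Ch E A n)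
    (hB : c ∈ Ch E B n) : c ∈ Ch E (A ∩ B) n := by
  have : c ∈ Ch E A n ⊓ Ch E B n := ⟨hA, hB⟩
  rw [Ch, Ch, ← Finsupp.supported_inter] at this
  refine Finsupp.supported_mono ?_ this
  rintro l ⟨h1, h2⟩
  exact ⟨h1.1, fun x hx => ⟨h1.2.1 x hx, h2.2.1 x hx⟩, h1.2.2⟩

/-! ### Homotopies -/

section Uniform

variable [UniformSpace X] [UniformSpace Y]

open Uniformity

lemma exists_entourage_of_continuousOn {K : Set X} (hK : IsCompact K) {f : X → Y}
    (hf : ContinuousOn f K) {E : Set (Y × Y)} (hE : E ∈ 𝓤 Y) :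
    ∃ D ∈ 𝓤 X, ∀ x ∈ K, ∀ y ∈ K, (x, y) ∈ D → (f x, f y) ∈ E := by
  have h := hK.uniformContinuousOn_of_continuous hf hE
  rw [Filter.mem_map, Filter.mem_inf_principal] at h
  exact ⟨_, h, fun x hx y hy hxy => hxy ⟨hx, hy⟩⟩

lemma exists_push_mem {K : Set X} (hK : IsCompact K) {f : X → Y} {B : Set Y}
    (hf : ContinuousOn f K) (hB : ∀ x ∈ K, f x ∈ B) {E : Set (Y × Y)} (hE : E ∈ 𝓤 Y) :
    ∃ D ∈ 𝓤 X, ∀ n, ∀ z ∈ Ch D K n, push f z ∈ Ch E B n := by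
  obtain ⟨D, hD, h⟩ := exists_entourage_of_continuousOn hK hf hE
  exact ⟨D, hD, fun n z hz => push_mem hB h hz⟩

lemma exists_bound_of_homotopy {K : Set X} (hK : IsCompact K) {B : Set Y} (F : ℝ → X → Y)
    (hF : ContinuousOn (Function.uncurry F) (Set.Icc 0 1 ×ˢ K))
    (hB : ∀ t ∈ Set.Icc (0 : ℝ) 1, ∀ x ∈ K, F t x ∈ B) {E : Set (Y × Y)} (hE : E ∈ 𝓤 Y) :
    ∃ D ∈ 𝓤 X, ∀ n, ∀ z ∈ Ch D K n, bdry z = 0 →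
      ∃ w ∈ Ch E B (n + 1), bdry w = push (F 1) z - push (F 0) z := by
  have hu := (isCompact_Icc.prod hK).uniformContinuousOn_of_continuous hF
  rw [UniformContinuousOn, Filter.tendsto_def] at hu
  have h1 := hu E hE
  rw [Filter.mem_inf_principal, uniformity_prod_eq_prod, Filter.mem_map,
    Filter.mem_prod_iff] at h1
  obtain ⟨V, hV, D, hD, hVD⟩ := h1
  obtain ⟨δ, hδ, hδV⟩ := Metric.mem_uniformity_dist.1 hV
  obtain ⟨M, hM⟩ := exists_nat_one_div_lt hδ
  have key : ∀ s ∈ Set.Icc (0 : ℝ) 1, ∀ t ∈ Set.Icc (0 : ℝ) 1, dist s t < δ → ∀ x ∈ K, ∀ y ∈ K,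
      (x, y) ∈ D → (F s x, F t y) ∈ E := by
    intro s hs t ht hst x hx y hy hxy
    have := @hVD ((s, t), (x, y)) ⟨hδV hst, hxy⟩
    exact this ⟨⟨hs, hx⟩, ⟨ht, hy⟩⟩
  have hM0 : (0 : ℝ) < M + 1 := by positivity
  have hIcc : ∀ i ≤ M + 1, (i : ℝ) / (M + 1) ∈ Set.Icc (0 : ℝ) 1 := fun i hi =>
    ⟨by positivity, by rw [div_le_one hM0]; exact_mod_cast hi⟩
  refine ⟨D, hD, fun n z hz hz0 =>
    ⟨∑ i ∈ Finset.range (M + 1), prism (F ((i : ℝ) / (M + 1))) (F ((i + 1 : ℕ) / (M + 1))) z,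
      Submodule.sum_mem _ fun i hi => ?_, ?_⟩⟩
  · have hi' := Finset.mem_range.1 hi
    have s0 := hIcc i hi'.le
    have s1 := hIcc (i + 1) hi'
    have hd : dist ((i : ℝ) / (M + 1)) ((i + 1 : ℕ) / (M + 1)) < δ := by
      rw [Real.dist_eq, ← sub_div]
      push_cast
      rw [show (i : ℝ) - (i + 1) = -1 by ring, abs_div, abs_neg, abs_one, abs_of_pos hM0]
      exact hM
    refine prism_mem (hB _ s0) (hB _ s1) (fun x hx y hy hxy => ⟨?_, ?_, ?_, ?_⟩) hz
    · exact key _ s0 _ s0 (by simpa using hδ) x hx y hy hxy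
    · exact key _ s0 _ s1 hd x hx y hy hxy
    · exact key _ s1 _ s0 (by rwa [dist_comm]) x hx y hy hxy
    · exact key _ s1 _ s1 (by simpa using hδ) x hx y hy hxy
  · rw [map_sum]
    simp only [bdry_prism, hz0, map_zero, sub_zero]
    rw [Finset.sum_range_sub (fun i : ℕ => push (F ((i : ℝ) / (M + 1))) z)]
    simp [div_self (ne_of_gt hM0)]

/-- Small cycles bound. -/
def Acyc (K : Set X) : Prop :=
  ∀ E ∈ 𝓤 X, ∃ D ∈ 𝓤 X, ∀ n, ∀ z ∈ Ch D K n, bdry z = 0 → ∃ w ∈ Ch E K (n + 1), bdry w = z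

lemma acyc_of_contraction {K : Set X} (hK : IsCompact K) {p : X} (hp : p ∈ K) (F : ℝ → X → X)
    (hF : ContinuousOn (Function.uncurry F) (Set.Icc 0 1 ×ˢ K))
    (hB : ∀ t ∈ Set.Icc (0 : ℝ) 1, ∀ x ∈ K, F t x ∈ K) (h0 : ∀ x ∈ K, F 0 x = x)
    (h1 : ∀ x ∈ K, F 1 x = p) : Acyc K := by
  intro E hE
  obtain ⟨D, hD, h⟩ := exists_bound_of_homotopy hK F hF hB hE
  refine ⟨D, hD, fun n z hz hz0 => ?_⟩
  obtain ⟨w, hw, hwz⟩ := h n z hz hz0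
  rw [push_congr (g := id) h0 hz, push_id, push_congr (g := fun _ => p) h1 hz] at hwz
  have hc : cone p (push (fun _ => p) z) ∈ Ch E K (n + 1) := by
    have : push (fun _ => p) z ∈ Ch E {p} n :=
      push_mem (by simp) (fun x _ y _ _ => refl_mem_uniformity hE) hz
    refine cone_mem_supported (S := smallSimp E {p} n) (T := smallSimp E K (n + 1))
      (fun l hl => ⟨by simp [hl.1], ?_, ?_⟩) this
    · intro x hx
      rcases List.mem_cons.1 hx with rfl | hx
      · exact hp
      · rw [hl.2.1 x hx]; exact hp
    · have : ∀ x ∈ p :: l, x = p := fun x hx => by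
        rcases List.mem_cons.1 hx with rfl | hx
        · rfl
        · exact hl.2.1 x hx
      intro x hx y hy
      rw [this x hx, this y hy]; exact refl_mem_uniformity hE
  refine ⟨cone p (push (fun _ => p) z) - w, sub_mem hc hw, ?_⟩
  rw [map_sub, hwz, bdry_cone, bdry_push, hz0]; simp

/-! ### Subdivision along two closed pieces -/

lemma exists_near_inter [T2Space X] {A B : Set X} (hA : IsCompact A) (hB : IsCompact B)
    {E : Set (X × X)} (hE : E ∈ 𝓤 X) :
    ∃ D ∈ 𝓤 X, ∀ x ∈ A, ∀ y ∈ B, (x, y) ∈ D → ∃ s ∈ A ∩ B, (x, s) ∈ E ∧ (y, s) ∈ E := by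
  by_contra! hcon
  set V : Set (X × X) := {p | ∃ s ∈ A ∩ B, (p.1, s) ∈ E ∧ (p.2, s) ∈ E} with hV
  have hne : (𝓤 X ⊓ Filter.principal ((A ×ˢ B) \ V)).NeBot := by
    rw [Filter.inf_principal_neBot_iff]
    intro D hD
    obtain ⟨x, hx, y, hy, hxy, h⟩ := hcon D hD
    exact ⟨(x, y), hxy, ⟨hx, hy⟩, fun ⟨s, hs, h1, h2⟩ => h s hs h1 h2⟩
  obtain ⟨⟨x, y⟩, ⟨hx, hy⟩, hcl⟩ := (hA.prod hB) (f := 𝓤 X ⊓ Filter.principal ((A ×ˢ B) \ V))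
    (inf_le_right.trans (Filter.principal_mono.2 Set.sdiff_subset))
  have hxy : x = y := by
    refine eq_of_uniformity_basis uniformity_hasBasis_closed fun {D} hD => ?_
    have := hcl.mono (inf_le_left.trans (Filter.le_principal_iff.2 hD.1))
    rwa [← mem_closure_iff_clusterPt, hD.2.closure_eq] at this
  subst hxy
  have hnV : V ∈ 𝓝 (x, x) := by
    have h1 : {p : X × X | (p.1, x) ∈ E} ∈ 𝓝 (x, x) :=
      (continuous_fst.tendsto (x, x)).eventually (mem_nhds_right x hE)
    have h2 : {p : X × X | (p.2, x) ∈ E} ∈ 𝓝 (x, x) :=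
      (continuous_snd.tendsto (x, x)).eventually (mem_nhds_right x hE)
    filter_upwards [h1, h2] with p hp1 hp2
    exact ⟨x, ⟨hx, hy⟩, hp1, hp2⟩
  have := hcl.mono inf_le_right
  rw [← mem_closure_iff_clusterPt, mem_closure_iff_nhds] at this
  obtain ⟨p, hp, hp'⟩ := this V hnV
  exact hp'.2 hp

lemma exists_split [T2Space X] {A B : Set X} (hA : IsCompact A) (hB : IsCompact B)
    {E : Set (X × X)} (hE : E ∈ 𝓤 X) :
    ∃ D ∈ 𝓤 X, ∀ n, ∀ z ∈ Ch D (A ∪ B) n, bdry z = 0 →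
      ∃ a ∈ Ch E A n, ∃ b ∈ Ch E B n, ∃ w ∈ Ch E (A ∪ B) (n + 1), a + b = z + bdry w := by
  obtain ⟨E₁, hE₁, hsymm, hcomp⟩ := comp_symm_mem_uniformity_sets hE
  obtain ⟨E₂, hE₂, hsymm₂, hcomp₂⟩ := comp_symm_mem_uniformity_sets hE₁
  obtain ⟨D, hD, hDs⟩ := exists_near_inter hA hB hE₂
  classical
  let f : X → X := fun x => if h : ∃ s ∈ A ∩ B, (x, s) ∈ E₂ then h.choose else x
  have hf1 : ∀ x, (∃ s ∈ A ∩ B, (x, s) ∈ E₂) → f x ∈ A ∩ B := fun x hx => by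
    simp only [f, dif_pos hx]; exact hx.choose_spec.1
  have hf2 : ∀ x, (x, f x) ∈ E₂ := fun x => by
    by_cases hx : ∃ s ∈ A ∩ B, (x, s) ∈ E₂
    · simp only [f, dif_pos hx]; exact hx.choose_spec.2
    · simp only [f, dif_neg hx]; exact refl_mem_uniformity hE₂
  have hf3 : ∀ x, f x = x ∨ f x ∈ A ∩ B := fun x => by
    by_cases hx : ∃ s ∈ A ∩ B, (x, s) ∈ E₂
    · exact Or.inr (hf1 x hx)
    · left; simp only [f, dif_neg hx]
  have hfA : ∀ x ∈ A, f x ∈ A := fun x hx => by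
    rcases hf3 x with h | h
    · rwa [h]
    · exact h.1
  have hfB : ∀ x ∈ B, f x ∈ B := fun x hx => by
    rcases hf3 x with h | h
    · rwa [h]
    · exact h.2
  have hfU : ∀ x ∈ A ∪ B, f x ∈ A ∪ B := fun x hx => hx.imp (hfA x) (hfB x)
  have sub21 : E₂ ⊆ E₁ := (subset_comp_self_of_mem_uniformity hE₂).trans hcomp₂
  have sub10 : E₁ ⊆ E := (subset_comp_self_of_mem_uniformity hE₁).trans hcomp
  have c1 : ∀ x y, (x, y) ∈ E₂ → (x, f y) ∈ E₁ := fun x y h => hcomp₂ ⟨y, h, hf2 y⟩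
  have c1' : ∀ x y, (x, y) ∈ E₂ → (f x, y) ∈ E₁ := fun x y h =>
    hcomp₂ ⟨x, hsymm₂.symm _ _ (hf2 x), h⟩
  have c2 : ∀ x y, (x, y) ∈ E₂ → (f x, f y) ∈ E := fun x y h =>
    hcomp ⟨y, c1' x y h, sub21 (hf2 y)⟩
  refine ⟨D ∩ E₂, Filter.inter_mem hD hE₂, fun n z hz hz0 => ?_⟩
  have hw : prism id f z ∈ Ch E (A ∪ B) (n + 1) :=
    prism_mem (fun x hx => hx) hfU (fun x _ y _ hxy => ⟨sub10 (sub21 hxy.2), sub10 (c1 _ _ hxy.2),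
      sub10 (c1' _ _ hxy.2), c2 _ _ hxy.2⟩) hz
  have hp : push f z ∈ Ch E A n ⊔ Ch E B n := by
    refine map_mem_of_supported (push f) _ (fun l hl => ?_) hz
    rw [push_smp]
    have hsmall : ∀ x ∈ l.map f, ∀ y ∈ l.map f, (x, y) ∈ E := by
      simp only [List.mem_map, forall_exists_index, and_imp, forall_apply_eq_imp_iff₂]
      exact fun x hx y hy => c2 _ _ (hl.2.2 x hx y hy).2
    have hall : (∀ x ∈ l, f x ∈ A) ∨ (∀ x ∈ l, f x ∈ B) := by
      by_cases h1 : ∀ x ∈ l, x ∈ A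
      · exact Or.inl fun x hx => hfA x (h1 x hx)
      by_cases h2 : ∀ x ∈ l, x ∈ B
      · exact Or.inr fun x hx => hfB x (h2 x hx)
      push Not at h1 h2
      obtain ⟨x, hx, hxA⟩ := h1
      obtain ⟨y, hy, hyB⟩ := h2
      have hxB := (hl.2.1 x hx).resolve_left hxA
      have hyA := (hl.2.1 y hy).resolve_right hyB
      refine Or.inl fun v hv => (hf1 v ?_).1
      rcases hl.2.1 v hv with hvA | hvB
      · obtain ⟨s, hs, h, -⟩ := hDs v hvA x hxB (hl.2.2 v hv x hx).1
        exact ⟨s, hs, h⟩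
      · obtain ⟨s, hs, -, h⟩ := hDs y hyA v hvB (hl.2.2 y hy v hv).1
        exact ⟨s, hs, h⟩
    rcases hall with h | h
    · refine Submodule.mem_sup_left (smp_mem_Ch ⟨by simpa using hl.1, ?_, hsmall⟩)
      simpa using h
    · refine Submodule.mem_sup_right (smp_mem_Ch ⟨by simpa using hl.1, ?_, hsmall⟩)
      simpa using h
  obtain ⟨a, ha, b, hb, hab⟩ := Submodule.mem_sup.1 hp
  refine ⟨a, ha, b, hb, _, hw, ?_⟩
  rw [hab, bdry_prism, hz0, push_id]; simp

/-- Any two small cycles are homologically dependent. -/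
def Dep (K : Set X) (n : ℕ) : Prop :=
  ∀ E ∈ 𝓤 X, ∃ D ∈ 𝓤 X, ∀ z₁ ∈ Ch D K n, ∀ z₂ ∈ Ch D K n, bdry z₁ = 0 → bdry z₂ = 0 →
    ∃ k₁ k₂ : ℝ, (k₁ ≠ 0 ∨ k₂ ≠ 0) ∧ ∃ w ∈ Ch E K (n + 1), bdry w = k₁ • z₁ + k₂ • z₂

lemma dep_zero (K : Set X) : Dep K 0 := by
  intro E hE
  refine ⟨E, hE, fun z₁ h₁ z₂ h₂ _ _ => ?_⟩
  have key : ∀ z ∈ Ch E K 0, ∃ r : ℝ, z = r • smp [] := fun z hz => by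
    have : z ∈ Submodule.span ℝ {smp ([] : List X)} := by
      refine map_mem_of_supported LinearMap.id _ (fun l hl => ?_) hz
      obtain rfl := List.length_eq_zero_iff.1 hl.1
      exact Submodule.mem_span_singleton_self _
    obtain ⟨r, hr⟩ := Submodule.mem_span_singleton.1 this
    exact ⟨r, hr.symm⟩
  obtain ⟨r, rfl⟩ := key z₁ h₁
  obtain ⟨s, rfl⟩ := key z₂ h₂
  by_cases hs : s = 0
  · exact ⟨0, 1, by simp, 0, zero_mem _, by simp [hs]⟩
  · exact ⟨s, -r, by simp [hs], 0, zero_mem _, by rw [map_zero, smul_smul, smul_smul]; module⟩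

lemma Dep.suspend [T2Space X] {A B : Set X} {n : ℕ} (hA : IsCompact A) (hB : IsCompact B)
    (aA : Acyc A) (aB : Acyc B) (h : Dep (A ∩ B) n) : Dep (A ∪ B) (n + 1) := by
  intro E hE
  obtain ⟨D₁, hD₁, h₁⟩ := aA E hE
  obtain ⟨D₂, hD₂, h₂⟩ := aB E hE
  obtain ⟨D₃, hD₃, h₃⟩ := h (D₁ ∩ D₂) (Filter.inter_mem hD₁ hD₂)
  obtain ⟨D₄, hD₄, h₄⟩ := exists_split hA hB
    (Filter.inter_mem (Filter.inter_mem hD₁ hD₂) (Filter.inter_mem hD₃ hE))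
  refine ⟨D₄, hD₄, fun z₁ hz₁ z₂ hz₂ c₁ c₂ => ?_⟩
  obtain ⟨a₁, ha₁, b₁, hb₁, w₁, hw₁, e₁⟩ := h₄ _ z₁ hz₁ c₁
  obtain ⟨a₂, ha₂, b₂, hb₂, w₂, hw₂, e₂⟩ := h₄ _ z₂ hz₂ c₂
  have s3 : D₁ ∩ D₂ ∩ (D₃ ∩ E) ⊆ D₃ := fun x hx => hx.2.1
  have s12 : D₁ ∩ D₂ ∩ (D₃ ∩ E) ⊆ D₁ ∩ D₂ := fun x hx => hx.1
  have sE : D₁ ∩ D₂ ∩ (D₃ ∩ E) ⊆ E := fun x hx => hx.2.2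
  have d : ∀ {z a b w : Chain X}, bdry z = 0 → a + b = z + bdry w → bdry b = - bdry a := by
    intro z a b w hz hab
    have := congrArg bdry hab
    rw [map_add, map_add, hz, bdry_bdry, add_zero] at this
    exact (neg_eq_of_add_eq_zero_right this).symm
  have m : ∀ {z a b w : Chain X}, a ∈ Ch (D₁ ∩ D₂ ∩ (D₃ ∩ E)) A (n + 1) →
      b ∈ Ch (D₁ ∩ D₂ ∩ (D₃ ∩ E)) B (n + 1) → bdry z = 0 → a + b = z + bdry w →
      bdry a ∈ Ch D₃ (A ∩ B) n := by
    intro z a b w ha hb hz hab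
    refine Ch_mono s3 subset_rfl (mem_Ch_inter (bdry_mem ha) ?_)
    have := Submodule.neg_mem _ (bdry_mem hb)
    rwa [d hz hab, neg_neg] at this
  obtain ⟨k₁, k₂, hk, v, hv, hbv⟩ := h₃ _ (m ha₁ hb₁ c₁ e₁) _ (m ha₂ hb₂ c₂ e₂)
    (bdry_bdry _) (bdry_bdry _)
  have hcA : k₁ • a₁ + k₂ • a₂ - v ∈ Ch D₁ A (n + 1) :=
    Ch_mono Set.inter_subset_left subset_rfl (sub_mem (add_mem (Submodule.smul_mem _ _
      (Ch_mono s12 subset_rfl ha₁)) (Submodule.smul_mem _ _ (Ch_mono s12 subset_rfl ha₂)))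
      (Ch_mono subset_rfl Set.inter_subset_left hv))
  have hcB : k₁ • b₁ + k₂ • b₂ + v ∈ Ch D₂ B (n + 1) :=
    Ch_mono Set.inter_subset_right subset_rfl (add_mem (add_mem (Submodule.smul_mem _ _
      (Ch_mono s12 subset_rfl hb₁)) (Submodule.smul_mem _ _ (Ch_mono s12 subset_rfl hb₂)))
      (Ch_mono subset_rfl Set.inter_subset_right hv))
  obtain ⟨wA, hwA, eA⟩ := h₁ _ _ hcA (by simp only [map_sub, map_add, map_smul, hbv, sub_self])
  obtain ⟨wB, hwB, eB⟩ := h₂ _ _ hcB (by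
    simp only [map_add, map_smul, hbv, d c₁ e₁, d c₂ e₂]; module)
  refine ⟨k₁, k₂, hk, wA + wB - (k₁ • w₁ + k₂ • w₂), sub_mem (add_mem
    (Ch_mono subset_rfl Set.subset_union_left hwA) (Ch_mono subset_rfl Set.subset_union_right hwB))
    (add_mem (Submodule.smul_mem _ _ (Ch_mono sE subset_rfl hw₁))
      (Submodule.smul_mem _ _ (Ch_mono sE subset_rfl hw₂))), ?_⟩
  have f₁ : bdry w₁ = a₁ + b₁ - z₁ := by rw [e₁]; abel
  have f₂ : bdry w₂ = a₂ + b₂ - z₂ := by rw [e₂]; abel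
  simp only [map_sub, map_add, map_smul, eA, eB, f₁, f₂]
  module

lemma Dep.image {K : Set X} {n : ℕ} (h : Dep K n) {f : X → Y} {g : Y → X}
    (hK : IsCompact K) (hf : ContinuousOn f K) (hg : ContinuousOn g (f '' K))
    (hgf : ∀ x ∈ K, g (f x) = x) : Dep (f '' K) n := by
  have gK : ∀ y ∈ f '' K, g y ∈ K := by
    rintro _ ⟨x, hx, rfl⟩; rwa [hgf x hx]
  have fg : ∀ y ∈ f '' K, (f ∘ g) y = id y := by
    rintro _ ⟨x, hx, rfl⟩; simp [hgf x hx]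
  intro E hE
  obtain ⟨D₁, hD₁, h₁⟩ := exists_push_mem hK hf (fun x hx => Set.mem_image_of_mem f hx) hE
  obtain ⟨D, hD, hDd⟩ := h _ hD₁
  obtain ⟨D₂, hD₂, h₂⟩ := exists_push_mem (hK.image_of_continuousOn hf) hg gK hD
  refine ⟨D₂, hD₂, fun z₁ hz₁ z₂ hz₂ c₁ c₂ => ?_⟩
  obtain ⟨k₁, k₂, hk, w, hw, hbw⟩ := hDd _ (h₂ _ _ hz₁) _ (h₂ _ _ hz₂)
    (by rw [bdry_push, c₁, map_zero]) (by rw [bdry_push, c₂, map_zero])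
  refine ⟨k₁, k₂, hk, push f w, h₁ _ _ hw, ?_⟩
  rw [bdry_push, hbw, map_add, map_smul, map_smul, push_push, push_push,
    push_congr fg hz₁, push_congr fg hz₂, push_id, push_id]

end Uniform

/-! ### Spheres -/

/-- The unit sphere of the span of the first `j` basis vectors. -/
def subsphere (n j : ℕ) : Set (EuclideanSpace ℝ (Fin n)) :=
  {x | ‖x‖ = 1 ∧ ∀ i : Fin n, j ≤ i → x i = 0}

/-- A hemisphere of the unit sphere of the span of the first `j + 1` basis vectors. -/
def hemisphere (n : ℕ) (ε : ℝ) (j : Fin n) : Set (EuclideanSpace ℝ (Fin n)) :=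
  {x | x ∈ subsphere n (j + 1) ∧ 0 ≤ ε * x j}

lemma isCompact_hemisphere (n : ℕ) (ε : ℝ) (j : Fin n) : IsCompact (hemisphere n ε j) := by
  refine (isCompact_sphere (0 : EuclideanSpace ℝ (Fin n)) 1).of_isClosed_subset ?_
    fun x hx => by simpa using hx.1.1
  have h1 : IsClosed {x : EuclideanSpace ℝ (Fin n) | ‖x‖ = 1} :=
    isClosed_eq continuous_norm continuous_const
  have h2 : IsClosed {x : EuclideanSpace ℝ (Fin n) | ∀ i : Fin n, (j : ℕ) + 1 ≤ i → x i = 0} := by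
    simp only [Set.ofPred_forall]
    exact isClosed_iInter fun i => isClosed_iInter fun _ =>
      isClosed_eq (by fun_prop) continuous_const
  have h3 : IsClosed {x : EuclideanSpace ℝ (Fin n) | 0 ≤ ε * x j} :=
    isClosed_le continuous_const (by fun_prop)
  exact (h1.inter h2).inter h3

lemma acyc_hemisphere (n : ℕ) {ε : ℝ} (hε : ε * ε = 1) (j : Fin n) :
    Acyc (hemisphere n ε j) := by
  have hε1 : |ε| = 1 := by
    rw [← Real.sqrt_mul_self_eq_abs, hε, Real.sqrt_one]
  set p : EuclideanSpace ℝ (Fin n) := EuclideanSpace.single j ε with hp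
  have hpj : p j = ε := by simp [hp]
  have hpi : ∀ i, i ≠ j → p i = 0 := fun i hi => by simp [hp, hi]
  have hpn : ‖p‖ = 1 := by simp [hp, hε1]
  set v : ℝ → EuclideanSpace ℝ (Fin n) → EuclideanSpace ℝ (Fin n) :=
    fun t x => (1 - t) • x + t • p with hv
  have hvj : ∀ t x, ε * v t x j = (1 - t) * (ε * x j) + t := fun t x => by
    simp only [hv, PiLp.add_apply, PiLp.smul_apply, smul_eq_mul, hpj]
    linear_combination t * hε
  have hv0 : ∀ t ∈ Set.Icc (0 : ℝ) 1, ∀ x ∈ hemisphere n ε j, v t x ≠ 0 := by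
    intro t ht x hx h
    have h1 := hvj t x
    rw [h] at h1
    simp only [PiLp.zero_apply, mul_zero] at h1
    have h2 : 0 ≤ (1 - t) * (ε * x j) := mul_nonneg (by linarith [ht.2]) hx.2
    have ht0 : t = 0 := by linarith [ht.1]
    have hx0 : x = 0 := by simpa [hv, ht0] using h
    have hx1 := hx.1.1
    rw [hx0, norm_zero] at hx1
    exact zero_ne_one hx1
  refine acyc_of_contraction (p := p) (isCompact_hemisphere n ε j)
    ⟨⟨hpn, fun i hi => hpi i ?_⟩, by rw [hpj, hε]; norm_num⟩
    (fun t x => ‖v t x‖⁻¹ • v t x) ?_ ?_ ?_ ?_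
  · rintro rfl; omega
  · have hc : Continuous (fun q : ℝ × EuclideanSpace ℝ (Fin n) => v q.1 q.2) := by
      simp only [hv]; fun_prop
    exact (hc.norm.continuousOn.inv₀ fun q hq => norm_ne_zero_iff.2 (hv0 q.1 hq.1 q.2 hq.2)).smul
      hc.continuousOn
  · intro t ht x hx
    have h0 := hv0 t ht x hx
    refine ⟨⟨norm_smul_inv_norm h0, fun i hi => ?_⟩, ?_⟩
    · have hij : i ≠ j := by rintro rfl; omega
      simp [hv, hx.1.2 i hi, hpi i hij]
    · rw [PiLp.smul_apply, smul_eq_mul, mul_left_comm, hvj]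
      exact mul_nonneg (by positivity)
        (add_nonneg (mul_nonneg (by linarith [ht.2]) hx.2) ht.1)
  · intro x hx
    have : v 0 x = x := by simp [hv]
    simp [this, hx.1.1]
  · intro x hx
    have : v 1 x = p := by simp [hv]
    simp [this, hpn]

lemma dep_subsphere (n j : ℕ) (hj : j ≤ n) : Dep (subsphere n j) j := by
  induction j with
  | zero => exact dep_zero _
  | succ j ih =>
    have ih := ih (by omega)
    let k : Fin n := ⟨j, by omega⟩
    have hi : hemisphere n 1 k ∩ hemisphere n (-1) k = subsphere n j := by
      ext x
      constructor
      · rintro ⟨⟨⟨h1, h2⟩, h3⟩, -, h4⟩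
        refine ⟨h1, fun i hi => ?_⟩
        rcases hi.eq_or_lt with hi | hi
        · have : i = k := Fin.ext hi.symm
          rw [this]; linarith
        · exact h2 i hi
      · rintro ⟨h1, h2⟩
        have : x k = 0 := h2 k le_rfl
        exact ⟨⟨⟨h1, fun i hi => h2 i (Nat.le_of_succ_le hi)⟩, by simp [this]⟩,
          ⟨h1, fun i hi => h2 i (Nat.le_of_succ_le hi)⟩, by simp [this]⟩
    have hu : hemisphere n 1 k ∪ hemisphere n (-1) k = subsphere n (j + 1) := by
      ext x
      constructor
      · rintro (h | h) <;> exact h.1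
      · intro h
        rcases le_total 0 (x k) with h0 | h0
        · exact Or.inl ⟨h, by linarith⟩
        · exact Or.inr ⟨h, by linarith⟩
    rw [← hu]
    rw [← hi] at ih
    exact ih.suspend (isCompact_hemisphere _ _ _) (isCompact_hemisphere _ _ _)
      (acyc_hemisphere n (by norm_num) k) (acyc_hemisphere n (by norm_num) k)

lemma dep_sphere (n : ℕ) : Dep (Metric.sphere (0 : EuclideanSpace ℝ (Fin n)) 1) n := by
  convert dep_subsphere n n le_rfl using 1
  ext x
  simp only [mem_sphere_iff_norm, sub_zero, subsphere, Set.mem_ofPred_eq, iff_self_and]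
  intro _ i hi
  exact absurd i.2 (by omega)

variable {X Y : Type*}

/-! ### One-cochains of circle-valued maps -/

/-- The representative in `(-1/2, 1/2]` of a point of the circle `ℝ / ℤ`. -/
def shortRep (c : UnitAddCircle) : ℝ := (AddCircle.equivIoc (1 : ℝ) (-1 / 2) c : ℝ)

@[simp] lemma coe_shortRep (c : UnitAddCircle) : (shortRep c : UnitAddCircle) = c :=
  AddCircle.coe_equivIoc

lemma shortRep_mem (c : UnitAddCircle) : shortRep c ∈ Set.Ioc (-1 / 2 : ℝ) (1 / 2) := by
  have := (AddCircle.equivIoc (1 : ℝ) (-1 / 2) c).2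
  norm_num at this ⊢
  exact this

lemma shortRep_coe {r : ℝ} (hr : r ∈ Set.Ioc (-1 / 2 : ℝ) (1 / 2)) :
    shortRep (r : UnitAddCircle) = r :=
  AddCircle.equivIoc_coe_of_mem (by norm_num at hr ⊢; exact hr)

@[simp] lemma shortRep_zero : shortRep 0 = 0 := by
  have := shortRep_coe (r := 0) (by norm_num)
  rwa [AddCircle.coe_zero] at this

lemma abs_shortRep (c : UnitAddCircle) : |shortRep c| = ‖c‖ := by
  have h := shortRep_mem c
  conv_rhs => rw [← coe_shortRep c]
  refine ((AddCircle.norm_coe_eq_abs_iff 1 one_ne_zero).2 ?_).symm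
  rw [abs_le, abs_one]
  exact ⟨by linarith [h.1], by linarith [h.2]⟩

lemma shortRep_add {a b : UnitAddCircle} (ha : ‖a‖ < 1 / 4) (hb : ‖b‖ < 1 / 4) :
    shortRep (a + b) = shortRep a + shortRep b := by
  rw [← abs_shortRep, abs_lt] at ha hb
  rw [← shortRep_coe (r := shortRep a + shortRep b), AddCircle.coe_add, coe_shortRep, coe_shortRep]
  constructor <;> linarith

/-- The one-cochain of a circle-valued map. -/
def coch (f : X → UnitAddCircle) (x y : X) : ℝ := shortRep (f y - f x)

@[simp] lemma coch_self (f : X → UnitAddCircle) (x : X) : coch f x x = 0 := by simp [coch]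

lemma addOn_coch {f : X → UnitAddCircle} {l : List X}
    (h : ∀ x ∈ l, ∀ y ∈ l, ‖f y - f x‖ < 1 / 4) : AddOn (coch f) l := fun x hx y hy z hz => by
  have := shortRep_add (h y hy z hz) (h x hx y hy)
  simp only [coch]
  rw [add_comm, ← this, sub_add_sub_cancel]

/-- The set `V` carries a real-valued lift of `f`, up to a translation. -/
def LiftsOn [TopologicalSpace X] (f : X → UnitAddCircle) (V : Set X) : Prop :=
  ∃ g : X → ℝ, ContinuousOn g V ∧ ∃ c : UnitAddCircle, ∀ x ∈ V, (g x : UnitAddCircle) = f x + c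

section Uniform

variable [UniformSpace X] [UniformSpace Y]

open Uniformity

lemma exists_norm_lt {A : Set X} (hA : IsCompact A) {f : X → UnitAddCircle}
    (hf : ContinuousOn f A) :
    ∃ E ∈ 𝓤 X, ∀ x ∈ A, ∀ y ∈ A, (x, y) ∈ E → ‖f y - f x‖ < 1 / 4 := by
  obtain ⟨E, hE, h⟩ := exists_entourage_of_continuousOn hA hf
    (Metric.dist_mem_uniformity (show (0 : ℝ) < 1 / 4 by norm_num))
  refine ⟨E, hE, fun x hx y hy hxy => ?_⟩
  have := h x hx y hy hxy
  rwa [Set.mem_ofPred_eq, dist_comm, dist_eq_norm] at this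

lemma exists_forall_list {ι : Type*} {Z : Type*} {F : Filter Z} (ps : List ι)
    {P : ι → Set Z → Prop} (hP : ∀ i s t, s ⊆ t → P i t → P i s)
    (h : ∀ i ∈ ps, ∃ s ∈ F, P i s) : ∃ s ∈ F, ∀ i ∈ ps, P i s := by
  induction ps with
  | nil => exact ⟨Set.univ, Filter.univ_mem, by simp⟩
  | cons i ps ih =>
    obtain ⟨s, hs, h1⟩ := ih fun j hj => h j (by simp [hj])
    obtain ⟨t, ht, h2⟩ := h i (by simp)
    refine ⟨s ∩ t, Filter.inter_mem hs ht, fun j hj => ?_⟩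
    rcases List.mem_cons.1 hj with rfl | hj
    · exact hP _ _ _ Set.inter_subset_right h2
    · exact hP _ _ _ Set.inter_subset_left (h1 j hj)

lemma exists_addOn {A : Set X} (hA : IsCompact A) {fs : List (X → UnitAddCircle)}
    (hf : ∀ f ∈ fs, ContinuousOn f A) :
    ∃ E ∈ 𝓤 X, ∀ f ∈ fs, ∀ n, ∀ l ∈ smallSimp E A n, AddOn (coch f) l := by
  refine exists_forall_list fs (fun f s t hst h n l hl => h n l (smallSimp_mono hst subset_rfl hl))
    fun f hf' => ?_
  obtain ⟨E, hE, h⟩ := exists_norm_lt hA (hf f hf')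
  exact ⟨E, hE, fun n l hl => addOn_coch fun x hx y hy =>
    h x (hl.2.1 x hx) y (hl.2.1 y hy) (hl.2.2 x hx y hy)⟩

lemma exists_coch_eq {K : Set X} (hK : IsCompact K) {f : X → UnitAddCircle} {g : X → ℝ}
    (hg : ContinuousOn g K) {c : UnitAddCircle} (h : ∀ x ∈ K, (g x : UnitAddCircle) = f x + c) :
    ∃ E ∈ 𝓤 X, ∀ x ∈ K, ∀ y ∈ K, (x, y) ∈ E → coch f x y = g y - g x := by
  obtain ⟨E, hE, hE'⟩ := exists_entourage_of_continuousOn hK hg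
    (Metric.dist_mem_uniformity (show (0 : ℝ) < 1 / 2 by norm_num))
  refine ⟨E, hE, fun x hx y hy hxy => ?_⟩
  have := hE' x hx y hy hxy
  rw [Set.mem_ofPred_eq, dist_comm, Real.dist_eq, abs_lt] at this
  have e : f y - f x = ((g y - g x : ℝ) : UnitAddCircle) := by
    rw [AddCircle.coe_sub, h x hx, h y hy]; abel
  rw [coch, e, shortRep_coe]
  constructor <;> linarith

/-- Cup products vanish on small cycles in a set covered by open sets on which the respective
factors lift. -/
lemma exists_ev_cup_eq_zero {A : Set X} (hA : IsCompact A)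
    (ps : List ((X → UnitAddCircle) × Set X)) (hc : ∀ p ∈ ps, ContinuousOn p.1 A)
    (ho : ∀ p ∈ ps, IsOpen p.2) (hl : ∀ p ∈ ps, LiftsOn p.1 p.2)
    (hcov : ∀ x ∈ A, ∃ p ∈ ps, x ∈ p.2) :
    ∃ E ∈ 𝓤 X, ∀ n, ∀ z ∈ Ch E A n, bdry z = 0 →
      ev (cup (ps.map fun p => coch p.1)) z = 0 := by
  obtain ⟨E₀, hE₀, h₀⟩ := lebesgue_number_lemma (ι := {p // p ∈ ps}) hA
    (U := fun p => p.1.2) (fun p => ho _ p.2) (fun x hx => by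
      obtain ⟨p, hp, hxp⟩ := hcov x hx
      exact Set.mem_iUnion.2 ⟨⟨p, hp⟩, hxp⟩)
  obtain ⟨E₁, hE₁, hsymm, hcomp⟩ := comp_symm_mem_uniformity_sets hE₀
  choose! g hg c hgc using hl
  let W : (X → UnitAddCircle) × Set X → Set X := fun p => {x | x ∈ A ∧ UniformSpace.ball x E₁ ⊆ p.2}
  have hW : ∀ p, closure (W p) ⊆ p.2 := fun p y hy => by
    obtain ⟨x, hx, hx'⟩ := UniformSpace.mem_closure_iff_ball.1 hy hE₁
    exact hx'.2 (hsymm.symm _ _ hx)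
  obtain ⟨E₂, hE₂, h₂⟩ : ∃ E ∈ 𝓤 X, ∀ p ∈ ps, ∀ x ∈ A ∩ closure (W p), ∀ y ∈ A ∩ closure (W p),
      (x, y) ∈ E → coch p.1 x y = g p y - g p x := by
    refine exists_forall_list ps (fun p s t hst h x hx y hy hxy => h x hx y hy (hst hxy))
      fun p hp => ?_
    exact exists_coch_eq (hA.inter_right isClosed_closure)
      ((hg p hp).mono (Set.inter_subset_right.trans (hW p)))
      (fun x hx => hgc p hp x (hW p hx.2))
  obtain ⟨E₃, hE₃, h₃⟩ := exists_addOn hA (fs := ps.map Prod.fst) (by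
    simp only [List.mem_map, forall_exists_index, and_imp]
    rintro f p hp rfl; exact hc p hp)
  refine ⟨E₁ ∩ (E₂ ∩ E₃), Filter.inter_mem hE₁ (Filter.inter_mem hE₂ hE₃), fun n z hz hz0 => ?_⟩
  have key := ev_cup_shift (ps.map fun p => (coch p.1, g p)) (smallSimp (E₁ ∩ (E₂ ∩ E₃)) A n) (by
    intro l hl q hq
    obtain ⟨p, hp, rfl⟩ := List.mem_map.1 hq
    exact h₃ p.1 (List.mem_map_of_mem hp) n l (smallSimp_mono (fun x hx => hx.2.2) subset_rfl hl))
    z hz hz0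
  rw [List.map_map, List.map_map] at key
  refine key.trans (ev_eq_zero_of_supported (fun l hl => ?_) hz)
  match l, hl with
  | [], _ => exact cup_nil_list _
  | x :: l, hl =>
    obtain ⟨⟨p, hp⟩, hxp⟩ := h₀ x (hl.2.1 x (by simp))
    have hmem : ∀ y ∈ x :: l, y ∈ A ∩ closure (W p) := fun y hy =>
      ⟨hl.2.1 y hy, subset_closure ⟨hl.2.1 y hy, fun v hv =>
        hxp (hcomp ⟨y, (hl.2.2 x (by simp) y hy).1, hv⟩)⟩⟩
    refine cup_eq_zero ⟨_, List.mem_map_of_mem hp, fun y hy v hv => ?_⟩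
    simp only [Function.comp_apply, shift]
    rw [h₂ p hp y (hmem y hy) v (hmem v hv) (hl.2.2 y hy v hv).2.1, sub_self]

end Uniform

/-! ### Lifting circle-valued maps -/

lemma exists_lift_of_homotopy [TopologicalSpace X] (F : C(I × X, UnitAddCircle))
    {c : UnitAddCircle} (h0 : ∀ x, F (0, x) = c) :
    ∃ g : C(X, ℝ), ∀ x, (g x : UnitAddCircle) = F (1, x) := by
  have cov : IsCoveringMap (QuotientAddGroup.mk : ℝ → UnitAddCircle) :=
    AddCircle.isCoveringMap_coe 1
  have h : ∀ x, F (0, x) = QuotientAddGroup.mk ((ContinuousMap.const X (shortRep c)) x) :=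
    fun x => by rw [h0]; exact (coe_shortRep c).symm
  refine ⟨(cov.liftHomotopy F _ h).comp ⟨fun x => (1, x), by fun_prop⟩, fun x => ?_⟩
  exact congrFun (cov.liftHomotopy_lifts F _ h) (1, x)

lemma exists_lift_of_vectorSpace {V : Type*} [NormedAddCommGroup V] [NormedSpace ℝ V]
    {f : V → UnitAddCircle} (hf : Continuous f) :
    ∃ g : C(V, ℝ), ∀ x, (g x : UnitAddCircle) = f x := by
  obtain ⟨g, hg⟩ := exists_lift_of_homotopy (c := f 0)
    ⟨fun p : I × V => f ((p.1 : ℝ) • p.2), by fun_prop⟩ (by simp)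
  exact ⟨g, fun x => by simpa using hg x⟩

lemma continuousOn_invFun [TopologicalSpace X] [TopologicalSpace Y] [Nonempty Y] {φ : Y → X}
    (hφ : IsOpenEmbedding φ) : ContinuousOn (Function.invFun φ) (Set.range φ) := by
  rintro _ ⟨v, rfl⟩
  refine ContinuousAt.continuousWithinAt ?_
  rw [← hφ.continuousAt_iff, show Function.invFun φ ∘ φ = id from
    Function.invFun_comp hφ.injective]
  exact continuousAt_id

lemma liftsOn_range [TopologicalSpace X] {V : Type*} [NormedAddCommGroup V] [NormedSpace ℝ V]
    {f : X → UnitAddCircle} (hf : Continuous f) {φ : V → X} (hφ : IsOpenEmbedding φ) :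
    LiftsOn f (Set.range φ) := by
  obtain ⟨g, hg⟩ := exists_lift_of_vectorSpace (hf.comp hφ.continuous)
  refine ⟨fun x => g (Function.invFun φ x),
    g.continuous.comp_continuousOn (continuousOn_invFun hφ), 0, ?_⟩
  rintro _ ⟨v, rfl⟩
  beta_reduce
  rw [Function.leftInverse_invFun hφ.injective, hg]; simp

lemma liftsOn_ne [TopologicalSpace X] {f : X → UnitAddCircle} (hf : Continuous f)
    (c : UnitAddCircle) : LiftsOn f {x | f x ≠ c} := by
  refine ⟨fun x => AddCircle.equivIoc (1 : ℝ) 0 (f x - c), ?_, -c, fun x _ => ?_⟩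
  · intro x hx
    have h : f x - c ≠ ((0 : ℝ) : UnitAddCircle) := by
      rw [AddCircle.coe_zero]; exact sub_ne_zero.2 hx
    have h1 : ContinuousAt (fun y => f y - c) x := (hf.sub continuous_const).continuousAt
    exact (continuous_subtype_val.continuousAt.comp
      (ContinuousAt.comp (f := fun y => f y - c)
        (AddCircle.continuousAt_equivIoc (1 : ℝ) 0 h) h1)).continuousWithinAt
  · rw [AddCircle.coe_equivIoc, sub_eq_add_neg]

variable {X Y : Type*}

/-! ### Degrees -/

/-- The evaluation of the product of the classes of circle-valued maps on a chain. -/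
def deg (fs : List (X → UnitAddCircle)) : Chain X →ₗ[ℝ] ℝ := ev (cup (fs.map coch))

lemma deg_push (fs : List (Y → UnitAddCircle)) (p : X → Y) (z : Chain X) :
    deg fs (push p z) = deg (fs.map (· ∘ p)) z := by
  rw [deg, ev_push, deg]
  congr 2
  ext l
  rw [cup_map, List.map_map, List.map_map]
  rfl

/-- A closed connected topological manifold of dimension `n`. -/
structure IsMfd (n : ℕ) (P : Type*) [TopologicalSpace P] : Prop where
  compact : CompactSpace P
  t2 : T2Space P
  conn : ConnectedSpace P
  chart : ∀ x : P, ∃ φ : EuclideanSpace ℝ (Fin n) → P, IsOpenEmbedding φ ∧ x ∈ Set.range φ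

open Uniformity

variable [UniformSpace X] [UniformSpace Y]

lemma exists_deg_bdry {A : Set X} (hA : IsCompact A) {fs : List (X → UnitAddCircle)}
    (hf : ∀ f ∈ fs, ContinuousOn f A) :
    ∃ E ∈ 𝓤 X, ∀ n, ∀ w ∈ Ch E A n, deg fs (bdry w) = 0 := by
  obtain ⟨E, hE, h⟩ := exists_addOn hA hf
  refine ⟨E, hE, fun n w hw => ev_cup_bdry_of_supported _ (S := smallSimp E A n) ?_ hw⟩
  intro l hl a ha
  obtain ⟨f, hf, rfl⟩ := List.mem_map.1 ha
  exact h f hf n l hl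

/-- Small cycles in `K` are homologous to small cycles off `U`. -/
def Evac (K U : Set X) : Prop :=
  ∀ E ∈ 𝓤 X, ∃ D ∈ 𝓤 X, ∀ n, ∀ z ∈ Ch D K n, bdry z = 0 →
    ∃ z' ∈ Ch E Uᶜ n, bdry z' = 0 ∧ ∃ w ∈ Ch E Set.univ (n + 1), bdry w = z' - z

lemma Evac.trans {K U U' : Set X} (h : Evac K U) (h' : Evac Uᶜ U') : Evac K U' := by
  intro E hE
  obtain ⟨D, hD, h1⟩ := h' E hE
  obtain ⟨D', hD', h2⟩ := h (D ∩ E) (Filter.inter_mem hD hE)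
  refine ⟨D', hD', fun n z hz hz0 => ?_⟩
  obtain ⟨z', hz', hz'0, w, hw, hwz⟩ := h2 n z hz hz0
  obtain ⟨z'', hz'', hz''0, w', hw', hwz'⟩ :=
    h1 n z' (Ch_mono Set.inter_subset_left subset_rfl hz') hz'0
  exact ⟨z'', hz'', hz''0, w + w', add_mem (Ch_mono Set.inter_subset_right subset_rfl hw) hw',
    by rw [map_add, hwz, hwz']; abel⟩

lemma evac_of_homotopy {K U : Set X} (hK : IsCompact K) (F : ℝ → X → X)
    (hF : ContinuousOn (Function.uncurry F) (Set.Icc 0 1 ×ˢ K)) (h0 : ∀ x ∈ K, F 0 x = x)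
    (h1 : ∀ x ∈ K, F 1 x ∉ U) : Evac K U := by
  intro E hE
  obtain ⟨D, hD, h⟩ := exists_bound_of_homotopy hK F hF (B := Set.univ) (by simp) hE
  have hF1 : ContinuousOn (F 1) K := hF.comp (f := fun x => ((1 : ℝ), x)) (by fun_prop)
    (fun x hx => ⟨by simp, hx⟩)
  obtain ⟨D', hD', h'⟩ := exists_push_mem hK hF1 (B := Uᶜ) h1 hE
  refine ⟨D ∩ D', Filter.inter_mem hD hD', fun n z hz hz0 => ?_⟩
  obtain ⟨w, hw, hwz⟩ := h n z (Ch_mono Set.inter_subset_left subset_rfl hz) hz0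
  refine ⟨push (F 1) z, h' n z (Ch_mono Set.inter_subset_right subset_rfl hz), ?_, w, hw, ?_⟩
  · rw [bdry_push, hz0, map_zero]
  · rw [hwz, push_congr (g := id) h0 hz, push_id]

section Radial

variable {V : Type*} [NormedAddCommGroup V] [NormedSpace ℝ V]

/-- Push radially away from `v`, up to radius `R`. -/
def radial (v : V) (R t : ℝ) (y : V) : V := v + max 1 ((1 - t) + t * R / ‖y - v‖) • (y - v)

lemma continuousOn_radial (v : V) (R : ℝ) :
    ContinuousOn (fun p : ℝ × V => radial v R p.1 p.2) {p | p.2 ≠ v} := by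
  unfold radial
  have : ∀ p ∈ {p : ℝ × V | p.2 ≠ v}, ‖p.2 - v‖ ≠ 0 := fun p hp => by
    simpa [sub_eq_zero] using hp
  fun_prop (disch := assumption)

lemma radial_zero (v : V) (R : ℝ) (y : V) : radial v R 0 y = y := by simp [radial]

lemma radial_of_le (v : V) {R t : ℝ} (ht : t ∈ Set.Icc (0 : ℝ) 1) {y : V} (hR : 0 < R)
    (h : R ≤ ‖y - v‖) : radial v R t y = y := by
  have : t * R / ‖y - v‖ ≤ t := by
    rw [div_le_iff₀ (by linarith)]; exact mul_le_mul_of_nonneg_left h ht.1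
  rw [radial, max_eq_left (by linarith)]; simp

lemma le_norm_radial (v : V) (R : ℝ) {y : V} (hy : y ≠ v) : R ≤ ‖radial v R 1 y - v‖ := by
  have h : 0 < ‖y - v‖ := by simpa [sub_eq_zero] using hy
  rw [radial, add_sub_cancel_left, norm_smul, Real.norm_of_nonneg (by positivity)]
  calc R = R / ‖y - v‖ * ‖y - v‖ := by field_simp
    _ ≤ _ := by gcongr; simp

lemma evac_chart [CompactSpace X] [T2Space X] [ProperSpace V] {φ : V → X}
    (hφ : IsOpenEmbedding φ) {W : Set X} (hW : IsOpen W) {v : V} (hv : φ v ∈ W) (v₀ : V) :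
    Evac Wᶜ (φ '' Metric.ball v₀ 1) := by
  classical
  set R := ‖v - v₀‖ + 1 with hR
  have hR0 : 0 < R := by positivity
  have hsub : ∀ y ∈ Metric.ball v₀ 1, ‖y - v‖ < R := fun y hy => by
    rw [mem_ball_iff_norm] at hy
    calc ‖y - v‖ = ‖(y - v₀) - (v - v₀)‖ := by congr 1; abel
      _ ≤ ‖y - v₀‖ + ‖v - v₀‖ := norm_sub_le _ _
      _ < R := by linarith
  set B := φ '' Metric.closedBall v R
  have hB : IsClosed B := ((isCompact_closedBall v R).image hφ.continuous).isClosed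
  have hO : IsOpen (φ '' Metric.ball v R) := hφ.isOpenMap _ Metric.isOpen_ball
  have inv : ∀ y, Function.invFun φ (φ y) = y := Function.leftInverse_invFun hφ.injective
  let F : ℝ → X → X := fun t x => if x ∈ B then φ (radial v R t (Function.invFun φ x)) else x
  have hKv : ∀ x ∈ Wᶜ, ∀ y, φ y = x → y ≠ v := by
    rintro x hx y rfl rfl; exact hx hv
  refine evac_of_homotopy hW.isClosed_compl.isCompact F ?_ ?_ ?_
  · have hcov : Set.Icc (0 : ℝ) 1 ×ˢ Wᶜ ⊆ (Set.Icc (0 : ℝ) 1 ×ˢ (Wᶜ ∩ B)) ∪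
        (Set.Icc (0 : ℝ) 1 ×ˢ (Wᶜ ∩ (φ '' Metric.ball v R)ᶜ)) := by
      rintro ⟨t, x⟩ ⟨ht, hx⟩
      by_cases hxB : x ∈ B
      · exact Or.inl ⟨ht, hx, hxB⟩
      · exact Or.inr ⟨ht, hx, fun h => hxB (Set.image_mono Metric.ball_subset_closedBall h)⟩
    refine ContinuousOn.mono (ContinuousOn.union_of_isClosed ?_ ?_ ?_ ?_) hcov
    · have : ContinuousOn (fun p : ℝ × X => φ (radial v R p.1 (Function.invFun φ p.2)))
          (Set.Icc (0 : ℝ) 1 ×ˢ (Wᶜ ∩ B)) := by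
        refine hφ.continuous.comp_continuousOn ((continuousOn_radial v R).comp
          (f := fun p : ℝ × X => (p.1, Function.invFun φ p.2)) ?_ ?_)
        · refine continuousOn_fst.prodMk ((continuousOn_invFun hφ).comp continuousOn_snd ?_)
          rintro ⟨t, x⟩ ⟨_, _, y, _, rfl⟩; exact ⟨y, rfl⟩
        · rintro ⟨t, x⟩ ⟨_, hx, y, _, rfl⟩
          simpa [inv] using hKv _ hx y rfl
      exact this.congr fun p hp => if_pos hp.2.2
    · refine continuousOn_snd.congr ?_
      rintro ⟨t, x⟩ ⟨ht, hx, hxB⟩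
      simp only [Function.uncurry_apply_pair, F]
      split_ifs with h
      · obtain ⟨y, hy, rfl⟩ := h
        rw [inv, radial_of_le v ht hR0]
        by_contra! hlt
        exact hxB ⟨y, mem_ball_iff_norm.2 hlt, rfl⟩
      · rfl
    · exact isClosed_Icc.prod (hW.isClosed_compl.inter hB)
    · exact isClosed_Icc.prod (hW.isClosed_compl.inter hO.isClosed_compl)
  · intro x _
    simp only [F]
    split_ifs with h
    · obtain ⟨y, hy, rfl⟩ := h
      rw [inv, radial_zero]
    · rfl
  · rintro x hx ⟨y, hy, hyx⟩
    simp only [F] at hyx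
    split_ifs at hyx with h
    · obtain ⟨y', hy', rfl⟩ := h
      rw [inv] at hyx
      have := le_norm_radial v R (hKv _ hx y' rfl)
      rw [← hφ.injective hyx] at this
      exact absurd (hsub y hy) (by linarith)
    · exact h ⟨y, mem_closedBall_iff_norm.2 (hsub y hy).le, hyx⟩

end Radial

/-- Small cycles missing a nonempty open set of a manifold can be pushed off any point. -/
lemma IsMfd.exists_evac {n : ℕ} (hX : IsMfd n X) {O : Set X} (hO : IsOpen O) (hne : O.Nonempty)
    (x : X) : ∃ U, IsOpen U ∧ x ∈ U ∧ Evac Oᶜ U := by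
  have := hX.compact
  have := hX.t2
  have := hX.conn
  set S : Set X := {x | ∃ U, IsOpen U ∧ x ∈ U ∧ Evac Oᶜ U} with hS
  suffices h : S = Set.univ from h.ge (Set.mem_univ x)
  refine IsClopen.eq_univ ⟨⟨?_⟩, ?_⟩ ?_
  · rw [← isClosed_compl_iff, compl_compl, ← closure_subset_iff_isClosed]
    intro y hy
    obtain ⟨φ, hφ, v₀, rfl⟩ := hX.chart y
    obtain ⟨_, ⟨v, rfl⟩, U, hU, hvU, hev⟩ :=
      mem_closure_iff.1 hy _ hφ.isOpen_range ⟨v₀, rfl⟩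
    exact ⟨_, hφ.isOpenMap _ Metric.isOpen_ball, Set.mem_image_of_mem _ (by simp),
      hev.trans (evac_chart hφ hU hvU v₀)⟩
  · refine isOpen_iff_forall_mem_open.2 fun y ⟨U, hU, hy, h⟩ => ⟨U, fun y' hy' => ⟨U, hU, hy', h⟩,
      hU, hy⟩
  · obtain ⟨y, hy⟩ := hne
    refine ⟨y, O, hO, hy, fun E hE => ⟨E, hE, fun n z hz hz0 => ⟨z, hz, hz0, 0, zero_mem _, ?_⟩⟩⟩
    simp

/-- The degree vanishes on small cycles which are not onto. -/
lemma IsMfd.exists_deg_eq_zero {n : ℕ} (hX : IsMfd n X) {fs : List (X → UnitAddCircle)}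
    (hf : ∀ f ∈ fs, Continuous f) {x₀ : X} (hx₀ : ∀ x, (∀ f ∈ fs, f x = f x₀) → x = x₀)
    {O : Set X} (hO : IsOpen O) (hne : O.Nonempty) :
    ∃ D ∈ 𝓤 X, ∀ k, ∀ z ∈ Ch D Oᶜ k, bdry z = 0 → deg fs z = 0 := by
  have := hX.compact
  have := hX.t2
  obtain ⟨U, hU, hxU, hev⟩ := hX.exists_evac hO hne x₀
  obtain ⟨E₁, hE₁, h₁⟩ := exists_ev_cup_eq_zero hU.isClosed_compl.isCompact
    (fs.map fun f => (f, {x | f x ≠ f x₀}))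
    (by simp only [List.mem_map]; rintro _ ⟨f, h, rfl⟩; exact (hf f h).continuousOn)
    (by simp only [List.mem_map]; rintro _ ⟨f, h, rfl⟩
        exact isOpen_ne_fun (hf f h) continuous_const)
    (by simp only [List.mem_map]; rintro _ ⟨f, h, rfl⟩; exact liftsOn_ne (hf f h) _)
    (by
      intro x hx
      by_contra! hcon
      refine hx (?_ : x ∈ U)
      rw [hx₀ x fun f h => ?_]
      · exact hxU
      · simpa using hcon _ (List.mem_map_of_mem h))
  obtain ⟨E₂, hE₂, h₂⟩ := exists_deg_bdry (A := Set.univ) isCompact_univ (fs := fs)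
    fun f h => (hf f h).continuousOn
  obtain ⟨D, hD, h⟩ := hev (E₁ ∩ E₂) (Filter.inter_mem hE₁ hE₂)
  refine ⟨D, hD, fun k z hz hz0 => ?_⟩
  obtain ⟨z', hz', hz'0, w, hw, hwz⟩ := h k z hz hz0
  have e1 := h₁ k z' (Ch_mono Set.inter_subset_left subset_rfl hz') hz'0
  have e2 := h₂ _ w (Ch_mono Set.inter_subset_right subset_rfl hw)
  rw [List.map_map] at e1
  rw [hwz, map_sub, sub_eq_zero] at e2
  rw [← e2]
  exact e1

/-! ### Connected sums -/

/-- The connected sum with the two summands exchanged. -/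
def sumSwap {n : ℕ} {N P M : Type} [TopologicalSpace N] [TopologicalSpace P] [TopologicalSpace M]
    (D : ConnectedSumData n N P M) : ConnectedSumData n N M P :=
  ⟨D.φ₂, D.φ₁, D.emb₂, D.emb₁, D.C₂, D.C₁, D.closed₂, D.closed₁,
    by rw [Set.union_comm]; exact D.cover, D.h₂, D.h₁, D.inter₂, D.inter₁⟩

lemma t2Space_of_closed_cover {N : Type*} [TopologicalSpace N] {A B : Set N} (hA : IsClosed A)
    (hB : IsClosed B) (hAB : A ∪ B = Set.univ) [T2Space A] [T2Space B] : T2Space N := by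
  have key : ∀ (C : Set N), IsClosed C → T2Space C → ∀ (f : Ultrafilter N), C ∈ f → ∀ x y : N,
      (f : Filter N) ≤ 𝓝 x → (f : Filter N) ≤ 𝓝 y → x = y := by
    intro C hC _ f hCf x y hx hy
    have hx' : x ∈ C := hC.mem_of_frequently_of_tendsto (f := id) (b := (f : Filter N))
      (Filter.Eventually.frequently hCf) hx
    have hy' : y ∈ C := hC.mem_of_frequently_of_tendsto (f := id) (b := (f : Filter N))
      (Filter.Eventually.frequently hCf) hy
    have hne : (Filter.comap ((↑) : C → N) f).NeBot :=
      Filter.comap_neBot_iff_compl_range.2 fun h => by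
        rw [Subtype.range_coe] at h
        exact Ultrafilter.compl_notMem_iff.2 hCf h
    have e : (⟨x, hx'⟩ : C) = ⟨y, hy'⟩ := tendsto_nhds_unique
      (f := id) (l := Filter.comap ((↑) : C → N) f)
      (by rw [Filter.tendsto_id', nhds_subtype_eq_comap]; exact Filter.comap_mono hx)
      (by rw [Filter.tendsto_id', nhds_subtype_eq_comap]; exact Filter.comap_mono hy)
    exact congrArg Subtype.val e
  refine t2_iff_ultrafilter.2 fun {x y} f hx hy => ?_
  have : A ∪ B ∈ f := by rw [hAB]; exact Filter.univ_mem
  rcases Ultrafilter.union_mem_iff.1 this with h | h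
  · exact key A hA inferInstance f h x y hx hy
  · exact key B hB inferInstance f h x y hx hy

/-- The properties of the pinch map `p` of a connected sum onto one of its summands, and of the
inverse `i` to its restriction to the corresponding piece `C`. -/
structure IsPinch {N P V : Type*} [TopologicalSpace N] [TopologicalSpace P]
    [NormedAddCommGroup V] (C C' : Set N) (φ : V → P) (p : N → P) (i : P → N) : Prop where
  emb : IsOpenEmbedding φ
  closed : IsClosed C
  cont : Continuous p
  cont_inv : ContinuousOn i (φ '' Metric.ball 0 1)ᶜ
  not_mem : ∀ x ∈ C, p x ∉ φ '' Metric.ball 0 1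
  inv_mem : ∀ y ∉ φ '' Metric.ball 0 1, i y ∈ C
  inv_pinch : ∀ x ∈ C, i (p x) = x
  pinch_inv : ∀ y ∉ φ '' Metric.ball 0 1, p (i y) = y
  mem_closedBall : ∀ x ∈ C', p x ∈ φ '' Metric.closedBall 0 1
  mem_iff : ∀ x ∈ C, x ∈ C' ↔ p x ∈ φ '' Metric.sphere 0 1

section

variable {n : ℕ} {N P M : Type} [TopologicalSpace N] [TopologicalSpace P] [TopologicalSpace M]

lemma sum_t2 (D : ConnectedSumData n N P M) [T2Space P] [T2Space M] : T2Space N :=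
  have : T2Space D.C₁ := D.h₁.symm.t2Space
  have : T2Space D.C₂ := D.h₂.symm.t2Space
  t2Space_of_closed_cover D.closed₁ D.closed₂ D.cover

lemma isCompact_piece (D : ConnectedSumData n N P M) [CompactSpace P] : IsCompact D.C₁ := by
  have h : IsClosed (D.φ₁ '' Metric.ball 0 1)ᶜ :=
    (D.emb₁.isOpenMap _ Metric.isOpen_ball).isClosed_compl
  have := isCompact_iff_compactSpace.1 h.isCompact
  exact isCompact_iff_compactSpace.2 D.h₁.symm.compactSpace

lemma sum_compact (D : ConnectedSumData n N P M) [CompactSpace P] [CompactSpace M] :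
    CompactSpace N :=
  ⟨D.cover ▸ (isCompact_piece D).union (isCompact_piece (sumSwap D))⟩

lemma exists_pinch (D : ConnectedSumData n N P M) [NormalSpace N] [Nonempty N] :
    ∃ p i, IsPinch D.C₁ D.C₂ D.φ₁ p i := by
  classical
  have inv : ∀ y, Function.invFun D.φ₁ (D.φ₁ y) = y :=
    Function.leftInverse_invFun D.emb₁.injective
  let f : C(↥(D.C₁ ∩ D.C₂), EuclideanSpace ℝ (Fin n)) :=
    ⟨fun x => Function.invFun D.φ₁ (D.h₁ ⟨x, x.2.1⟩), by
      refine (continuousOn_invFun D.emb₁).comp_continuous ?_ fun x => ?_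
      · exact continuous_subtype_val.comp (D.h₁.continuous.comp
          (Continuous.subtype_mk continuous_subtype_val _))
      · obtain ⟨y, -, hy⟩ := (D.inter₁ ⟨x, x.2.1⟩).1 x.2.2
        exact ⟨y, hy⟩⟩
  have hf : ∀ x : ↥(D.C₁ ∩ D.C₂), D.φ₁ (f x) = D.h₁ ⟨x, x.2.1⟩ ∧ f x ∈ Metric.closedBall 0 1 := by
    intro x
    obtain ⟨y, hy, hxy⟩ := (D.inter₁ ⟨x, x.2.1⟩).1 x.2.2
    have : f x = y := by simp only [f, ContinuousMap.coe_mk]; rw [← hxy, inv]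
    rw [this]
    exact ⟨hxy, Metric.sphere_subset_closedBall hy⟩
  have : TietzeExtension (Metric.closedBall (0 : EuclideanSpace ℝ (Fin n)) 1) :=
    Set.instTietzeExtensionUnitClosedBall (𝕜 := ℝ)
  obtain ⟨g, hg, hgf⟩ := f.exists_forall_mem_restrict_eq (D.closed₁.inter D.closed₂)
    (fun x => (hf x).2)
  have hgf' : ∀ x (h : x ∈ D.C₁ ∩ D.C₂), g x = f ⟨x, h⟩ := fun x h =>
    DFunLike.congr_fun hgf ⟨x, h⟩
  let p : N → P := fun x => if h : x ∈ D.C₁ then D.h₁ ⟨x, h⟩ else D.φ₁ (g x)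
  let i : P → N := fun y =>
    if h : y ∈ (D.φ₁ '' Metric.ball 0 1)ᶜ then D.h₁.symm ⟨y, h⟩ else Classical.arbitrary N
  have hp₁ : ∀ x (h : x ∈ D.C₁), p x = D.h₁ ⟨x, h⟩ := fun x h => dif_pos h
  have hp₂ : ∀ x ∈ D.C₂, p x = D.φ₁ (g x) := fun x h => by
    by_cases h1 : x ∈ D.C₁
    · rw [hp₁ x h1, hgf' x ⟨h1, h⟩, (hf _).1]
    · exact dif_neg h1
  have hi : ∀ y (h : y ∈ (D.φ₁ '' Metric.ball 0 1)ᶜ), i y = D.h₁.symm ⟨y, h⟩ := fun y h => dif_pos h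
  refine ⟨p, i, D.emb₁, D.closed₁, ?_, ?_, ?_, ?_, ?_, ?_, ?_, ?_⟩
  · rw [← continuousOn_univ, ← D.cover]
    refine ContinuousOn.union_of_isClosed ?_ ?_ D.closed₁ D.closed₂
    · rw [continuousOn_iff_continuous_domRestrict]
      convert continuous_subtype_val.comp D.h₁.continuous
      ext x
      exact hp₁ x x.2
    · exact (D.emb₁.continuous.comp g.continuous).continuousOn.congr hp₂
  · rw [continuousOn_iff_continuous_domRestrict]
    convert continuous_subtype_val.comp D.h₁.symm.continuous
    ext x
    exact hi x x.2
  · intro x hx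
    rw [hp₁ x hx]; exact (D.h₁ ⟨x, hx⟩).2
  · intro y hy
    rw [hi y hy]; exact (D.h₁.symm ⟨y, hy⟩).2
  · intro x hx
    rw [hi (p x) (by rw [hp₁ x hx]; exact (D.h₁ ⟨x, hx⟩).2)]
    simp [hp₁ x hx]
  · intro y hy
    rw [hp₁ (i y) (by rw [hi y hy]; exact (D.h₁.symm ⟨y, hy⟩).2)]
    simp [hi y hy]
  · intro x hx
    exact ⟨g x, hg x, (hp₂ x hx).symm⟩
  · intro x hx
    rw [hp₁ x hx]
    exact D.inter₁ ⟨x, hx⟩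

end

lemma isOpenEmbedding_univBall {V : Type*} [NormedAddCommGroup V] [InnerProductSpace ℝ V] (c : V)
    (r : ℝ) : IsOpenEmbedding (OpenPartialHomeomorph.univBall c r) :=
  (OpenPartialHomeomorph.univBall c r).isOpenEmbedding (OpenPartialHomeomorph.univBall_source c r)

lemma range_univBall {V : Type*} [NormedAddCommGroup V] [InnerProductSpace ℝ V] (c : V)
    {r : ℝ} (hr : 0 < r) : Set.range (OpenPartialHomeomorph.univBall c r) = Metric.ball c r := by
  rw [← OpenPartialHomeomorph.univBall_target c hr,
    ← (OpenPartialHomeomorph.univBall c r).image_source_eq_target,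
    OpenPartialHomeomorph.univBall_source, Set.image_univ]

/-- A continuous injection on an open ball with open images of open subsets is a chart. -/
lemma exists_chart_of_ball {X : Type*} [TopologicalSpace X] {n : ℕ}
    (f : EuclideanSpace ℝ (Fin n) → X)
    {v : EuclideanSpace ℝ (Fin n)} {r : ℝ} (hr : 0 < r) (hc : ContinuousOn f (Metric.ball v r))
    (hi : Set.InjOn f (Metric.ball v r)) (ho : ∀ W ⊆ Metric.ball v r, IsOpen W → IsOpen (f '' W)) :
    ∃ φ : EuclideanSpace ℝ (Fin n) → X, IsOpenEmbedding φ ∧ f v ∈ Set.range φ ∧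
      Set.range φ = f '' Metric.ball v r := by
  set u := OpenPartialHomeomorph.univBall v r
  have hu : IsOpenEmbedding u := isOpenEmbedding_univBall v r
  have hur : Set.range u = Metric.ball v r := range_univBall v hr
  have hmem : ∀ x, u x ∈ Metric.ball v r := fun x => hur ▸ ⟨x, rfl⟩
  refine ⟨f ∘ u, IsOpenEmbedding.of_continuous_injective_isOpenMap
    (hc.comp_continuous hu.continuous hmem)
    (fun x y hxy => hu.injective (hi (hmem x) (hmem y) hxy)) (fun W hW => ?_), ?_, ?_⟩
  · rw [Set.image_comp]
    refine ho _ ?_ (hu.isOpenMap _ hW)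
    rintro _ ⟨x, _, rfl⟩; exact hmem x
  · exact ⟨0, congrArg f (OpenPartialHomeomorph.univBall_apply_zero v r)⟩
  · rw [Set.range_comp, hur]

lemma isOpen_image_of_compact {V X : Type*} [TopologicalSpace V] [TopologicalSpace X] [T2Space X]
    {f : V → X} {K A W : Set V} (hK : IsCompact K) (hf : ContinuousOn f K) (hi : Set.InjOn f K)
    (hAK : A ⊆ K) (hA : IsOpen (f '' A)) (hWA : W ⊆ A) (hW : IsOpen W) : IsOpen (f '' W) := by
  have : f '' W = f '' A \ f '' (K \ W) := by
    ext x
    constructor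
    · rintro ⟨w, hw, rfl⟩
      refine ⟨⟨w, hWA hw, rfl⟩, ?_⟩
      rintro ⟨w', ⟨h1, h2⟩, h3⟩
      exact h2 (hi h1 (hAK (hWA hw)) h3 ▸ hw)
    · rintro ⟨⟨a, ha, rfl⟩, h⟩
      by_contra hcon
      exact h ⟨a, ⟨hAK ha, fun h => hcon ⟨a, h, rfl⟩⟩, rfl⟩
  rw [this]
  exact hA.sdiff ((hK.diff hW).image_of_continuousOn (hf.mono Set.sdiff_subset)).isClosed

lemma notMem_image_ball {P V : Type*} [NormedAddCommGroup V] {φ : V → P} {y : P}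
    (hy : y ∉ φ '' Metric.closedBall 0 1) : y ∉ φ '' Metric.ball 0 1 := fun hy' =>
  hy (Set.image_mono Metric.ball_subset_closedBall hy')

namespace IsPinch

variable {N P M : Type*} [TopologicalSpace N] [TopologicalSpace P] [TopologicalSpace M]

section

variable {V : Type*} [NormedAddCommGroup V]
  {C C' : Set N} {φ : V → P} {p : N → P} {i : P → N}

lemma not_mem_ball (h : IsPinch C C' φ p i) {v : V} (hv : 1 ≤ ‖v‖) :
    φ v ∉ φ '' Metric.ball 0 1 := by
  rintro ⟨w, hw, e⟩
  rw [h.emb.injective e, mem_ball_zero_iff] at hw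
  linarith

lemma inv_mem_iff (h : IsPinch C C' φ p i) {y : P} (hy : y ∉ φ '' Metric.ball 0 1) :
    i y ∈ C' ↔ y ∈ φ '' Metric.sphere 0 1 := by
  rw [h.mem_iff _ (h.inv_mem y hy), h.pinch_inv y hy]

lemma mem_of_norm (h : IsPinch C C' φ p i) {v : V} (hv : 1 ≤ ‖v‖) : i (φ v) ∈ C :=
  h.inv_mem _ (h.not_mem_ball hv)

lemma mem_iff_norm (h : IsPinch C C' φ p i) {v : V} (hv : 1 ≤ ‖v‖) : i (φ v) ∈ C' ↔ ‖v‖ = 1 := by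
  rw [h.inv_mem_iff (h.not_mem_ball hv), h.emb.injective.mem_set_image, mem_sphere_zero_iff_norm]

lemma image_sphere (h : IsPinch C C' φ p i) : C ∩ C' = i '' (φ '' Metric.sphere 0 1) := by
  ext x
  constructor
  · rintro ⟨hx, hx'⟩
    exact ⟨p x, (h.mem_iff x hx).1 hx', h.inv_pinch x hx⟩
  · rintro ⟨_, ⟨v, hv, rfl⟩, rfl⟩
    have hv := mem_sphere_zero_iff_norm.1 hv
    exact ⟨h.mem_of_norm hv.ge, (h.mem_iff_norm hv.ge).2 hv⟩

/-- The interior of the piece `C` is open in the summand and in the connected sum. -/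
lemma isOpen_image_inv (h : IsPinch C C' φ p i) (hC' : IsClosed C') (hcov : C ∪ C' = Set.univ)
    {W : Set P} (hW : IsOpen W) (hW' : W ⊆ (φ '' Metric.closedBall 0 1)ᶜ) : IsOpen (i '' W) := by
  have : i '' W = C'ᶜ ∩ p ⁻¹' W := by
    ext x
    constructor
    · rintro ⟨y, hy, rfl⟩
      have hy' := notMem_image_ball (hW' hy)
      refine ⟨fun hC => hW' hy (Set.image_mono Metric.sphere_subset_closedBall
        ((h.inv_mem_iff hy').1 hC)), ?_⟩
      rwa [Set.mem_preimage, h.pinch_inv y hy']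
    · rintro ⟨hx, hxW⟩
      have hxC : x ∈ C := (hcov.ge (Set.mem_univ x)).resolve_right hx
      exact ⟨p x, hxW, h.inv_pinch x hxC⟩
  rw [this]
  exact hC'.isOpen_compl.inter (h.cont.isOpen_preimage _ hW)

lemma eq_empty_of_isClopen [NormedSpace ℝ V] [ProperSpace V] [T2Space P] [PreconnectedSpace P]
    (h : IsPinch C C' φ p i) {U : Set N} (hU : IsClopen U) (hS : U ∩ (C ∩ C') = ∅) :
    U ∩ C = ∅ := by
  have hB : IsClosed (φ '' Metric.closedBall 0 1) :=
    ((isCompact_closedBall _ _).image h.emb.continuous).isClosed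
  have hA : IsClosed (φ '' Metric.ball 0 1)ᶜ :=
    (h.emb.isOpenMap _ Metric.isOpen_ball).isClosed_compl
  set T : Set P := (φ '' Metric.ball 0 1)ᶜ ∩ i ⁻¹' U with hT
  have hT' : T = (φ '' Metric.closedBall 0 1)ᶜ ∩ i ⁻¹' U := by
    ext y
    constructor
    · rintro ⟨h1, h2⟩
      refine ⟨?_, h2⟩
      rintro ⟨v, hv, rfl⟩
      have hv1 : 1 ≤ ‖v‖ := by
        by_contra! hlt
        exact h1 ⟨v, mem_ball_zero_iff.2 hlt, rfl⟩
      have hv2 : ‖v‖ = 1 := le_antisymm (mem_closedBall_zero_iff.1 hv) hv1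
      exact Set.notMem_empty (i (φ v)) (hS ▸ ⟨h2, h.mem_of_norm hv1, (h.mem_iff_norm hv1).2 hv2⟩)
    · rintro ⟨h1, h2⟩
      exact ⟨notMem_image_ball h1, h2⟩
  have hclopen : IsClopen T := by
    refine ⟨h.cont_inv.preimage_isClosed_of_isClosed hA hU.1, ?_⟩
    rw [hT']
    exact (h.cont_inv.mono fun y hy => notMem_image_ball hy).isOpen_inter_preimage
      hB.isOpen_compl hU.2
  have hne : T ≠ Set.univ := fun hcon => (hcon.ge (Set.mem_univ (φ 0))).1 ⟨0, by simp, rfl⟩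
  rcases isClopen_iff.1 hclopen with h0 | h0
  · rw [Set.eq_empty_iff_forall_notMem]
    rintro x ⟨hxU, hxC⟩
    exact Set.notMem_empty (p x) (h0 ▸ ⟨h.not_mem x hxC, by
      rwa [Set.mem_preimage, h.inv_pinch x hxC]⟩)
  · exact absurd h0 hne

end

section Chart

variable {n : ℕ} {C C' : Set N} {φ : EuclideanSpace ℝ (Fin n) → P} {p : N → P} {i : P → N}

lemma exists_chart (h : IsPinch C C' φ p i) (hC' : IsClosed C') (hcov : C ∪ C' = Set.univ)
    (hP : IsMfd n P) {x : N} (hx : x ∉ C') :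
    ∃ ψ : EuclideanSpace ℝ (Fin n) → N, IsOpenEmbedding ψ ∧ x ∈ Set.range ψ := by
  have := hP.t2
  have hxC : x ∈ C := (hcov.ge (Set.mem_univ x)).resolve_right hx
  have hB : IsClosed (φ '' Metric.closedBall 0 1) :=
    ((isCompact_closedBall _ _).image h.emb.continuous).isClosed
  have hxB : p x ∉ φ '' Metric.closedBall 0 1 := by
    rintro ⟨v, hv, e⟩
    have hv1 : 1 ≤ ‖v‖ := by
      by_contra! hlt
      exact h.not_mem x hxC ⟨v, mem_ball_zero_iff.2 hlt, e⟩
    exact hx ((h.mem_iff x hxC).2 ⟨v, mem_sphere_zero_iff_norm.2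
      (le_antisymm (mem_closedBall_zero_iff.1 hv) hv1), e⟩)
  obtain ⟨ψ, hψ, v, hv⟩ := hP.chart (p x)
  have hO : IsOpen (ψ ⁻¹' (φ '' Metric.closedBall 0 1)ᶜ) := hB.isOpen_compl.preimage hψ.continuous
  obtain ⟨r, hr, hball⟩ := Metric.isOpen_iff.1 hO v (by rwa [Set.mem_preimage, hv])
  have hni : ∀ w ∈ Metric.ball v r, ψ w ∉ φ '' Metric.ball 0 1 := fun w hw =>
    notMem_image_ball (hball hw)
  obtain ⟨χ, hχ, hmem, -⟩ := exists_chart_of_ball (i ∘ ψ) (v := v) hr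
    (h.cont_inv.comp hψ.continuous.continuousOn hni)
    (fun a ha b hb e => hψ.injective (by
      rw [← h.pinch_inv _ (hni a ha), ← h.pinch_inv _ (hni b hb)]; exact congrArg p e))
    (fun W hW hWo => by
      rw [Set.image_comp]
      refine h.isOpen_image_inv hC' hcov (hψ.isOpenMap _ hWo) ?_
      rintro _ ⟨w, hw, rfl⟩; exact hball (hW hw))
  refine ⟨χ, hχ, ?_⟩
  rwa [Function.comp_apply, hv, h.inv_pinch x hxC] at hmem

end Chart

end IsPinch

namespace IsPinch

variable {N P M : Type*} [TopologicalSpace N] [TopologicalSpace P] [TopologicalSpace M]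
  {n : ℕ} {C₁ C₂ : Set N} {φ₁ : EuclideanSpace ℝ (Fin n) → P} {φ₂ : EuclideanSpace ℝ (Fin n) → M}
  {p₁ : N → P} {p₂ : N → M} {i₁ : P → N} {i₂ : M → N}

/-- Charts at points of the gluing sphere of a connected sum. -/
lemma exists_chart_sphere [T2Space N] (h₁ : IsPinch C₁ C₂ φ₁ p₁ i₁) (h₂ : IsPinch C₂ C₁ φ₂ p₂ i₂)
    (hcov : C₁ ∪ C₂ = Set.univ) {x : N} (hx : x ∈ C₁ ∩ C₂) :
    ∃ ψ : EuclideanSpace ℝ (Fin n) → N, IsOpenEmbedding ψ ∧ x ∈ Set.range ψ := by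
  classical
  let V := EuclideanSpace ℝ (Fin n)
  have inv : ∀ y, Function.invFun φ₂ (φ₂ y) = y := Function.leftInverse_invFun h₂.emb.injective
  let g : V → V := fun u => Function.invFun φ₂ (p₂ (i₁ (φ₁ u)))
  have hg : ∀ u : V, ‖u‖ = 1 → φ₂ (g u) = p₂ (i₁ (φ₁ u)) ∧ ‖g u‖ = 1 := fun u hu => by
    have h := (h₂.mem_iff _ ((h₁.mem_iff_norm hu.ge).2 hu)).1 (h₁.mem_of_norm hu.ge)
    obtain ⟨w, hw, e⟩ := h
    have : g u = w := by simp only [g]; rw [← e, inv]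
    rw [this]
    exact ⟨e, mem_sphere_zero_iff_norm.1 hw⟩
  have hg' : ∀ u : V, ‖u‖ = 1 → i₂ (φ₂ (g u)) = i₁ (φ₁ u) := fun u hu => by
    rw [(hg u hu).1, h₂.inv_pinch _ ((h₁.mem_iff_norm hu.ge).2 hu)]
  have i₁inj : ∀ v w : V, 1 ≤ ‖v‖ → 1 ≤ ‖w‖ → i₁ (φ₁ v) = i₁ (φ₁ w) → v = w :=
    fun v w hv hw e => h₁.emb.injective (by
      rw [← h₁.pinch_inv _ (h₁.not_mem_ball hv), ← h₁.pinch_inv _ (h₁.not_mem_ball hw), e])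
  have i₂inj : ∀ v w : V, 1 ≤ ‖v‖ → 1 ≤ ‖w‖ → i₂ (φ₂ v) = i₂ (φ₂ w) → v = w :=
    fun v w hv hw e => h₂.emb.injective (by
      rw [← h₂.pinch_inv _ (h₂.not_mem_ball hv), ← h₂.pinch_inv _ (h₂.not_mem_ball hw), e])
  have hunit : ∀ v : V, v ≠ 0 → ‖‖v‖⁻¹ • v‖ = 1 := fun v hv => by
    rw [norm_smul, norm_inv, norm_norm, inv_mul_cancel₀ (norm_ne_zero_iff.2 hv)]
  let s : V → V := fun v => ‖v‖⁻¹ • g (‖v‖⁻¹ • v)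
  have hs : ∀ v : V, v ≠ 0 → ‖s v‖ = ‖v‖⁻¹ := fun v hv => by
    simp only [s]; rw [norm_smul, (hg _ (hunit v hv)).2, norm_inv, norm_norm, mul_one]
  have hs1 : ∀ v : V, v ≠ 0 → ‖v‖ ≤ 1 → 1 ≤ ‖s v‖ := fun v hv h => by
    rw [hs v hv]; exact (one_le_inv₀ (norm_pos_iff.2 hv)).2 h
  let χ : V → N := fun v => if 1 ≤ ‖v‖ then i₁ (φ₁ v) else i₂ (φ₂ (s v))
  have χ₁ : ∀ v, 1 ≤ ‖v‖ → χ v = i₁ (φ₁ v) := fun v hv => if_pos hv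
  have χ₂ : ∀ v, v ≠ 0 → ‖v‖ ≤ 1 → χ v = i₂ (φ₂ (s v)) := fun v hv0 hv => by
    by_cases h : 1 ≤ ‖v‖
    · have h1 : ‖v‖ = 1 := le_antisymm hv h
      rw [χ₁ v h]
      simp only [s, h1, inv_one, one_smul]
      exact (hg' v h1).symm
    · exact if_neg h
  have sinj : ∀ v w : V, v ≠ 0 → w ≠ 0 → s v = s w → v = w := fun v w hv hw e => by
    have hn : ‖v‖⁻¹ = ‖w‖⁻¹ := by rw [← hs v hv, ← hs w hw, e]
    have hne : ‖w‖⁻¹ ≠ 0 := inv_ne_zero (norm_ne_zero_iff.2 hw)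
    simp only [s, hn] at e
    have e' := smul_right_injective V hne e
    have hu : ‖‖w‖⁻¹ • v‖ = 1 := hn ▸ hunit v hv
    refine smul_right_injective V hne (i₁inj _ _ hu.ge (hunit w hw).ge ?_)
    rw [← hg' _ hu, ← hg' _ (hunit w hw)]
    exact congrArg _ (congrArg _ e')
  let K : Set V := {v | 1 / 2 ≤ ‖v‖} ∩ Metric.closedBall 0 2
  let A : Set V := {v | 1 / 2 < ‖v‖} ∩ Metric.ball 0 2
  have hK0 : ∀ v ∈ K, v ≠ 0 := by
    rintro v ⟨hv, -⟩ rfl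
    norm_num at hv
  have hAK : A ⊆ K := fun v hv => ⟨le_of_lt (Set.mem_ofPred_eq ▸ hv.1),
    Metric.ball_subset_closedBall hv.2⟩
  have hKc : IsCompact K := (isCompact_closedBall _ _).inter_left
    (isClosed_le continuous_const continuous_norm)
  have hKcl := hKc.isClosed
  have hχc : ContinuousOn χ K := by
    have hcovK : K ⊆ (K ∩ {v | 1 ≤ ‖v‖}) ∪ (K ∩ {v | ‖v‖ ≤ 1}) := fun v hv =>
      (le_total 1 ‖v‖).imp (fun h => ⟨hv, h⟩) fun h => ⟨hv, h⟩
    refine ContinuousOn.mono (ContinuousOn.union_of_isClosed ?_ ?_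
      (hKcl.inter (isClosed_le continuous_const continuous_norm))
      (hKcl.inter (isClosed_le continuous_norm continuous_const))) hcovK
    · refine ContinuousOn.congr (f := i₁ ∘ φ₁) ?_ fun v hv => χ₁ v hv.2
      exact h₁.cont_inv.comp h₁.emb.continuous.continuousOn fun v hv => h₁.not_mem_ball hv.2
    · refine ContinuousOn.congr (f := i₂ ∘ φ₂ ∘ s) ?_ fun v hv => χ₂ v (hK0 v hv.1) hv.2
      refine h₂.cont_inv.comp (h₂.emb.continuous.comp_continuousOn ?_)
        fun v hv => h₂.not_mem_ball (hs1 v (hK0 v hv.1) hv.2)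
      have hinv : ContinuousOn (fun v : V => ‖v‖⁻¹) (K ∩ {v | ‖v‖ ≤ 1}) :=
        continuousOn_id.norm.inv₀ fun v hv => norm_ne_zero_iff.2 (hK0 v hv.1)
      have hgc : ContinuousOn g {u | ‖u‖ = 1} := by
        refine (continuousOn_invFun h₂.emb).comp (h₂.cont.comp_continuousOn
          (h₁.cont_inv.comp h₁.emb.continuous.continuousOn
            fun v hv => h₁.not_mem_ball (Set.mem_ofPred_eq ▸ hv).ge)) fun u hu => ?_
        rw [← (hg u hu).1]
        exact ⟨_, rfl⟩
      exact hinv.smul (hgc.comp (hinv.smul continuousOn_id) fun v hv => hunit v (hK0 v hv.1))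
  have hχi : Set.InjOn χ K := by
    have key : ∀ v ∈ K, ∀ w ∈ K, 1 < ‖v‖ → ‖w‖ ≤ 1 → χ v ≠ χ w := fun v hv w hw h h' e => by
      have : χ v ∈ C₂ := by
        rw [e, χ₂ w (hK0 w hw) h']; exact h₂.mem_of_norm (hs1 w (hK0 w hw) h')
      rw [χ₁ v h.le] at this
      exact h.ne' ((h₁.mem_iff_norm h.le).1 this)
    intro v hv w hw e
    rcases le_or_gt ‖v‖ 1 with h | h <;> rcases le_or_gt ‖w‖ 1 with h' | h'
    · rw [χ₂ v (hK0 v hv) h, χ₂ w (hK0 w hw) h'] at e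
      exact sinj v w (hK0 v hv) (hK0 w hw)
        (i₂inj _ _ (hs1 v (hK0 v hv) h) (hs1 w (hK0 w hw) h') e)
    · exact absurd e.symm (key w hw v hv h' h)
    · exact absurd e (key v hv w hw h h')
    · rw [χ₁ v h.le, χ₁ w h'.le] at e
      exact i₁inj v w h.le h'.le e
  have hχA : IsOpen (χ '' A) := by
    have hlt : ∀ v ∈ A, ‖s v‖ < 2 := fun v hv => by
      rw [hs v (hK0 v (hAK hv)), inv_lt_comm₀ (norm_pos_iff.2 (hK0 v (hAK hv))) two_pos]
      simpa using hv.1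
    have heq : χ '' A = (C₁ ∩ p₁ ⁻¹' (φ₁ '' Metric.ball 0 2)ᶜ)ᶜ ∩
        (C₂ ∩ p₂ ⁻¹' (φ₂ '' Metric.ball 0 2)ᶜ)ᶜ := by
      ext y
      constructor
      · rintro ⟨v, hv, rfl⟩
        have hv0 := hK0 v (hAK hv)
        have b₁ : ∀ w : V, 1 ≤ ‖w‖ → ‖w‖ < 2 → p₁ (i₁ (φ₁ w)) ∈ φ₁ '' Metric.ball 0 2 :=
          fun w hw hw' => by
            rw [h₁.pinch_inv _ (h₁.not_mem_ball hw)]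
            exact ⟨w, mem_ball_zero_iff.2 hw', rfl⟩
        have b₂ : ∀ w : V, 1 ≤ ‖w‖ → ‖w‖ < 2 → p₂ (i₂ (φ₂ w)) ∈ φ₂ '' Metric.ball 0 2 :=
          fun w hw hw' => by
            rw [h₂.pinch_inv _ (h₂.not_mem_ball hw)]
            exact ⟨w, mem_ball_zero_iff.2 hw', rfl⟩
        constructor
        · rintro ⟨hC, hn⟩
          rcases le_total 1 ‖v‖ with h | h
          · rw [Set.mem_preimage, χ₁ v h] at hn
            exact hn (b₁ v h (mem_ball_zero_iff.1 hv.2))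
          · rw [χ₂ v hv0 h, h₂.mem_iff_norm (hs1 v hv0 h), hs v hv0, inv_eq_one] at hC
            rw [Set.mem_preimage, χ₁ v hC.ge] at hn
            exact hn (b₁ v hC.ge (mem_ball_zero_iff.1 hv.2))
        · rintro ⟨hC, hn⟩
          rcases le_total ‖v‖ 1 with h | h
          · rw [Set.mem_preimage, χ₂ v hv0 h] at hn
            exact hn (b₂ _ (hs1 v hv0 h) (hlt v hv))
          · rw [χ₁ v h, h₁.mem_iff_norm h] at hC
            rw [Set.mem_preimage, χ₂ v hv0 hC.le] at hn
            exact hn (b₂ _ (hs1 v hv0 hC.le) (hlt v hv))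
      · rintro ⟨hy₁, hy₂⟩
        by_cases hyC : y ∈ C₁
        · have : p₁ y ∈ φ₁ '' Metric.ball 0 2 := by
            by_contra h; exact hy₁ ⟨hyC, h⟩
          obtain ⟨v, hv, e⟩ := this
          have hv1 : 1 ≤ ‖v‖ := by
            by_contra! hlt'
            exact h₁.not_mem y hyC ⟨v, mem_ball_zero_iff.2 hlt', e⟩
          refine ⟨v, ⟨?_, hv⟩, ?_⟩
          · rw [Set.mem_ofPred_eq]; linarith
          · rw [χ₁ v hv1, e, h₁.inv_pinch y hyC]
        · have hyC₂ : y ∈ C₂ := (hcov.ge (Set.mem_univ y)).resolve_left hyC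
          have : p₂ y ∈ φ₂ '' Metric.ball 0 2 := by
            by_contra h; exact hy₂ ⟨hyC₂, h⟩
          obtain ⟨w, hw, e⟩ := this
          have hw1 : 1 ≤ ‖w‖ := by
            by_contra! hlt'
            exact h₂.not_mem y hyC₂ ⟨w, mem_ball_zero_iff.2 hlt', e⟩
          have hw0 : w ≠ 0 := by rintro rfl; norm_num at hw1
          -- the unit vector `u` with `g u = w / ‖w‖`
          have hwu := hunit w hw0
          have hin : i₂ (φ₂ (‖w‖⁻¹ • w)) ∈ C₁ ∩ C₂ :=
            ⟨(h₂.mem_iff_norm hwu.ge).2 hwu, h₂.mem_of_norm hwu.ge⟩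
          rw [h₁.image_sphere] at hin
          obtain ⟨_, ⟨u, hu, rfl⟩, hu'⟩ := hin
          have hu1 := mem_sphere_zero_iff_norm.1 hu
          have hgu : g u = ‖w‖⁻¹ • w :=
            i₂inj _ _ (hg u hu1).2.ge hwu.ge (by rw [hg' u hu1, hu'])
          have hwn : ‖w‖ ≠ 0 := norm_ne_zero_iff.2 hw0
          have hvn : ‖‖w‖⁻¹ • u‖ = ‖w‖⁻¹ := by
            rw [norm_smul, hu1, norm_inv, norm_norm, mul_one]
          have hle : ‖w‖⁻¹ ≤ 1 := inv_le_one_of_one_le₀ hw1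
          have hne : ‖w‖⁻¹ • u ≠ 0 := by
            rw [← norm_ne_zero_iff, hvn]; exact inv_ne_zero hwn
          refine ⟨‖w‖⁻¹ • u, ⟨?_, ?_⟩, ?_⟩
          · rw [Set.mem_ofPred_eq, hvn, one_div, inv_lt_inv₀ two_pos (by linarith)]
            exact mem_ball_zero_iff.1 hw
          · rw [mem_ball_zero_iff, hvn]; linarith
          · rw [χ₂ _ hne (by rw [hvn]; exact hle)]
            simp only [s, hvn, inv_inv, smul_smul, mul_inv_cancel₀ hwn, one_smul, hgu]
            rw [e, h₂.inv_pinch y hyC₂]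
    rw [heq]
    have o₁ := (h₁.emb.isOpenMap _ (Metric.isOpen_ball (x := (0 : V)) (ε := 2))).isClosed_compl
    have o₂ := (h₂.emb.isOpenMap _ (Metric.isOpen_ball (x := (0 : V)) (ε := 2))).isClosed_compl
    exact (h₁.closed.inter (o₁.preimage h₁.cont)).isOpen_compl.inter
      (h₂.closed.inter (o₂.preimage h₂.cont)).isOpen_compl
  rw [h₁.image_sphere] at hx
  obtain ⟨_, ⟨v, hv, rfl⟩, rfl⟩ := hx
  have hv1 := mem_sphere_zero_iff_norm.1 hv
  have hball : Metric.ball v (1 / 2) ⊆ A := fun w hw => by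
    rw [mem_ball_iff_norm] at hw
    have e1 := norm_sub_norm_le v w
    have e2 := norm_sub_norm_le w v
    rw [norm_sub_rev] at e1
    refine ⟨?_, ?_⟩
    · rw [Set.mem_ofPred_eq]; linarith
    · rw [mem_ball_zero_iff]; linarith
  obtain ⟨ψ, hψ, hmem, -⟩ := exists_chart_of_ball χ (v := v) (r := 1 / 2) (by norm_num)
    (hχc.mono (hball.trans hAK)) (hχi.mono (hball.trans hAK))
    fun W hW hWo => isOpen_image_of_compact hKc hχc hχi hAK hχA (hW.trans hball) hWo
  refine ⟨ψ, hψ, ?_⟩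
  rwa [χ₁ v hv1.ge] at hmem

lemma connectedSpace [Nonempty N] (hn : 2 ≤ n) (hP : IsMfd n P) (hM : IsMfd n M)
    (h₁ : IsPinch C₁ C₂ φ₁ p₁ i₁) (h₂ : IsPinch C₂ C₁ φ₂ p₂ i₂)
    (hcov : C₁ ∪ C₂ = Set.univ) : ConnectedSpace N := by
  have := hP.t2
  have := hP.conn
  have := hM.t2
  have := hM.conn
  have hS : IsPreconnected (C₁ ∩ C₂) := by
    rw [h₁.image_sphere]
    have hr : 1 < Module.rank ℝ (EuclideanSpace ℝ (Fin n)) := by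
      rw [← Module.finrank_eq_rank, finrank_euclideanSpace_fin]
      exact_mod_cast hn
    have := (isPreconnected_sphere hr 0 1).image φ₁ h₁.emb.continuous.continuousOn
    refine this.image i₁ (h₁.cont_inv.mono ?_)
    rintro _ ⟨v, hv, rfl⟩
    exact h₁.not_mem_ball (mem_sphere_zero_iff_norm.1 hv).ge
  have key : ∀ U : Set N, IsClopen U → U ∩ (C₁ ∩ C₂) = ∅ → U = ∅ := fun U hU hUS => by
    have e1 := h₁.eq_empty_of_isClopen hU hUS
    have e2 := h₂.eq_empty_of_isClopen hU (by rwa [Set.inter_comm C₂ C₁])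
    rw [← Set.inter_univ U, ← hcov, Set.inter_union_distrib_left, e1, e2, Set.union_empty]
  have : PreconnectedSpace N := preconnectedSpace_iff_clopen.2 fun U hU => by
    by_cases hne : (U ∩ (C₁ ∩ C₂)).Nonempty
    · right
      have := hS.subset_isClopen hU (by rwa [Set.inter_comm])
      rw [← Set.compl_empty_iff]
      refine key _ hU.compl ?_
      rw [Set.eq_empty_iff_forall_notMem]
      exact fun x hx => hx.1 (this hx.2)
    · left
      exact key U hU (Set.not_nonempty_iff_eq_empty.1 hne)
  exact ⟨inferInstance⟩

lemma isMfd [CompactSpace N] [T2Space N] [Nonempty N] (hn : 2 ≤ n) (hP : IsMfd n P)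
    (hM : IsMfd n M) (h₁ : IsPinch C₁ C₂ φ₁ p₁ i₁) (h₂ : IsPinch C₂ C₁ φ₂ p₂ i₂)
    (hcov : C₁ ∪ C₂ = Set.univ) : IsMfd n N where
  compact := inferInstance
  t2 := inferInstance
  conn := connectedSpace hn hP hM h₁ h₂ hcov
  chart x := by
    by_cases hx₂ : x ∈ C₂
    · by_cases hx₁ : x ∈ C₁
      · exact h₁.exists_chart_sphere h₂ hcov ⟨hx₁, hx₂⟩
      · exact h₂.exists_chart h₁.closed (by rwa [Set.union_comm]) hM hx₁
    · exact h₁.exists_chart h₂.closed hcov hP hx₂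

end IsPinch

open Uniformity

lemma bdry_smul_add {X : Type*} (k : ℝ) (c d : Chain X) :
    bdry (k • c + d) = k • bdry c + bdry d := by rw [map_add, map_smul]

section OneSide

variable {N P : Type*} [UniformSpace N] [UniformSpace P]
  {n : ℕ} {C C' : Set N} {φ : EuclideanSpace ℝ (Fin n) → P} {p : N → P} {i : P → N}

namespace IsPinch

lemma inter_eq (h : IsPinch C C' φ p i) :
    (φ '' Metric.ball 0 1)ᶜ ∩ φ '' Metric.closedBall 0 1 = φ '' Metric.sphere 0 1 := by
  ext y
  constructor
  · rintro ⟨h1, v, hv, rfl⟩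
    refine ⟨v, mem_sphere_zero_iff_norm.2 (le_antisymm (mem_closedBall_zero_iff.1 hv) ?_), rfl⟩
    by_contra! hlt
    exact h1 ⟨v, mem_ball_zero_iff.2 hlt, rfl⟩
  · rintro ⟨v, hv, rfl⟩
    exact ⟨h.not_mem_ball (mem_sphere_zero_iff_norm.1 hv).ge,
      v, Metric.sphere_subset_closedBall hv, rfl⟩

lemma dep_inter (h : IsPinch C C' φ p i) : Dep (C ∩ C') n := by
  have hs : Metric.sphere (0 : EuclideanSpace ℝ (Fin n)) 1 ⊆ φ ⁻¹' (φ '' Metric.ball 0 1)ᶜ :=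
    fun v hv => h.not_mem_ball (mem_sphere_zero_iff_norm.1 hv).ge
  have e : C ∩ C' = (i ∘ φ) '' Metric.sphere 0 1 := by rw [h.image_sphere, Set.image_comp]
  have hp : ∀ v ∈ Metric.sphere (0 : EuclideanSpace ℝ (Fin n)) 1, p (i (φ v)) = φ v :=
    fun v hv => h.pinch_inv _ (hs hv)
  rw [e]
  refine (dep_sphere n).image (g := Function.invFun φ ∘ p) (isCompact_sphere _ _)
    (h.cont_inv.comp h.emb.continuous.continuousOn hs)
    ((continuousOn_invFun h.emb).comp h.cont.continuousOn ?_) ?_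
  · rintro _ ⟨v, hv, rfl⟩
    exact ⟨v, (hp v hv).symm⟩
  · intro v hv
    rw [Function.comp_apply, Function.comp_apply, hp v hv]
    exact Function.leftInverse_invFun h.emb.injective v

/-- The degree over a summand vanishes on small cycles in the corresponding piece. -/
lemma exists_deg_eq_zero [CompactSpace N] (h : IsPinch C C' φ p i) (hP : IsMfd n P)
    {fs : List (P → UnitAddCircle)} (hf : ∀ f ∈ fs, Continuous f) {x₀ : P}
    (hx₀ : ∀ x, (∀ f ∈ fs, f x = f x₀) → x = x₀) :
    ∃ D ∈ 𝓤 N, ∀ k, ∀ z ∈ Ch D C k, bdry z = 0 → deg (fs.map (· ∘ p)) z = 0 := by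
  obtain ⟨D, hD, hD'⟩ := hP.exists_deg_eq_zero hf hx₀
    (h.emb.isOpenMap _ (Metric.isOpen_ball (x := 0) (ε := 1))) ⟨φ 0, 0, by simp, rfl⟩
  obtain ⟨D₁, hD₁, h₁⟩ := exists_push_mem (B := (φ '' Metric.ball 0 1)ᶜ) h.closed.isCompact
    h.cont.continuousOn h.not_mem hD
  refine ⟨D₁, hD₁, fun k z hz hz0 => ?_⟩
  rw [← deg_push]
  exact hD' k _ (h₁ k z hz) (by rw [bdry_push, hz0, map_zero])

/-- The restriction of a small cycle in a summand to the corresponding piece of the connected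
sum, and the degrees of its completions to a cycle. -/
lemma exists_piece [CompactSpace N] (h : IsPinch C C' φ p i) (hC' : IsClosed C') (hP : IsMfd n P)
    {fs : List (P → UnitAddCircle)} (hne : fs ≠ []) (hf : ∀ f ∈ fs, Continuous f) {m : ℕ}
    (hz : ∀ E ∈ 𝓤 P, ∃ z ∈ Ch E Set.univ (m + 1), bdry z = 0 ∧ deg fs z ≠ 0) :
    ∃ D ∈ 𝓤 N, ∀ E ∈ 𝓤 N, ∃ c ∈ Ch E C (m + 1), bdry c ∈ Ch E (C ∩ C') m ∧ ∃ r : ℝ, r ≠ 0 ∧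
      ∀ k : ℝ, ∀ d ∈ Ch D C' (m + 1), bdry (k • c + d) = 0 →
        deg (fs.map (· ∘ p)) (k • c + d) = k * r := by
  have := hP.compact
  have := hP.t2
  set A := (φ '' Metric.ball 0 1)ᶜ
  set B := φ '' Metric.closedBall 0 1
  have hA : IsCompact A := (h.emb.isOpenMap _ Metric.isOpen_ball).isClosed_compl.isCompact
  have hB : IsCompact B := (isCompact_closedBall _ _).image h.emb.continuous
  have hAB : A ∪ B = Set.univ := by
    rw [Set.eq_univ_iff_forall]
    intro x
    by_cases hx : x ∈ φ '' Metric.ball 0 1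
    · exact Or.inr (Set.image_mono Metric.ball_subset_closedBall hx)
    · exact Or.inl hx
  have hi : ∀ y ∈ A ∩ B, i y ∈ C ∩ C' := fun y hy => by
    rw [h.image_sphere, ← h.inter_eq]; exact ⟨y, hy, rfl⟩
  -- fineness of chains in the ball
  obtain ⟨E₁, hE₁, h₁⟩ := exists_ev_cup_eq_zero hB (fs.map fun f => (f, Set.range φ))
    (by simp only [List.mem_map]; rintro _ ⟨f, h, rfl⟩; exact (hf f h).continuousOn)
    (by simp only [List.mem_map]; rintro _ ⟨f, _, rfl⟩; exact h.emb.isOpen_range)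
    (by simp only [List.mem_map]; rintro _ ⟨f, hf', rfl⟩; exact liftsOn_range (hf f hf') h.emb)
    (by
      rintro _ ⟨v, -, rfl⟩
      obtain ⟨f, hf'⟩ := List.exists_mem_of_ne_nil fs hne
      exact ⟨_, List.mem_map_of_mem hf', v, rfl⟩)
  simp only [List.map_map] at h₁
  obtain ⟨E₂, hE₂, h₂⟩ := exists_deg_bdry (A := Set.univ) isCompact_univ (fs := fs)
    fun f h => (hf f h).continuousOn
  obtain ⟨D, hD, hD'⟩ := exists_push_mem hC'.isCompact h.cont.continuousOn h.mem_closedBall hE₁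
  refine ⟨D, hD, fun E hE => ?_⟩
  obtain ⟨E₃, hE₃, h₃⟩ := exists_push_mem hA h.cont_inv h.inv_mem hE
  obtain ⟨E₄, hE₄, h₄⟩ := exists_push_mem (hA.inter_right hB.isClosed)
    (h.cont_inv.mono Set.inter_subset_left) hi hE
  obtain ⟨E₅, hE₅, h₅⟩ := exists_split hA hB
    (Filter.inter_mem hE₁ (Filter.inter_mem hE₂ (Filter.inter_mem hE₃ hE₄)))
  obtain ⟨z, hzE, hz0, hzd⟩ := hz E₅ hE₅
  obtain ⟨a, ha, b, hb, w, hw, hab⟩ := h₅ _ z (by rwa [hAB]) hz0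
  have hba : bdry a = - bdry b := by
    have := congrArg bdry hab
    rw [map_add, map_add, hz0, bdry_bdry, add_zero] at this
    exact eq_neg_of_add_eq_zero_left this
  have hda : bdry a ∈ Ch E₄ (A ∩ B) m := by
    have s4 : E₁ ∩ (E₂ ∩ (E₃ ∩ E₄)) ⊆ E₄ := fun x hx => hx.2.2.2
    refine mem_Ch_inter (bdry_mem (Ch_mono s4 subset_rfl ha)) ?_
    rw [hba]
    exact neg_mem (bdry_mem (Ch_mono s4 subset_rfl hb))
  have hpa : push p (push i a) = a := by
    rw [push_push, push_congr (f := p ∘ i) (g := id) (fun y hy => h.pinch_inv y hy) ha, push_id]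
  refine ⟨push i a, h₃ _ a (Ch_mono (fun x hx => hx.2.2.1) subset_rfl ha),
    by rw [bdry_push]; exact h₄ _ _ hda, deg fs z, hzd, fun k d hd hkd => ?_⟩
  have hpd := hD' _ d hd
  have e0 : deg fs (push p d - k • b) = 0 := by
    refine h₁ _ _ (sub_mem hpd (Submodule.smul_mem _ _
      (Ch_mono (fun x hx => hx.1) subset_rfl hb))) ?_
    have := congrArg (push p) hkd
    rw [← bdry_push, map_add, map_smul, hpa, bdry_smul_add, map_zero, hba] at this
    rw [map_sub, map_smul, ← this]
    simp [sub_eq_neg_add]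
  have e1 : deg fs (a + b) = deg fs z := by
    rw [hab, map_add, h₂ _ w (Ch_mono (fun x hx => hx.2.1) (Set.subset_univ _) hw), add_zero]
  rw [← deg_push, map_add, map_smul, hpa,
    show k • a + push p d = k • (a + b) + (push p d - k • b) by rw [smul_add]; abel,
    map_add, e0, map_smul, e1, smul_eq_mul, add_zero]

end IsPinch

end OneSide

/-- The fundamental cycle of a connected sum. -/
lemma IsPinch.exists_cycle {N P M : Type*} [UniformSpace N] [UniformSpace P] [UniformSpace M]
    [CompactSpace N] [T2Space N] {n : ℕ} {C₁ C₂ : Set N} {φ₁ : EuclideanSpace ℝ (Fin n) → P}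
    {φ₂ : EuclideanSpace ℝ (Fin n) → M} {p₁ : N → P} {p₂ : N → M} {i₁ : P → N} {i₂ : M → N}
    (h₁ : IsPinch C₁ C₂ φ₁ p₁ i₁) (h₂ : IsPinch C₂ C₁ φ₂ p₂ i₂)
    (hP : IsMfd n P) (hM : IsMfd n M)
    {fs : List (P → UnitAddCircle)} (hfne : fs ≠ []) (hf : ∀ f ∈ fs, Continuous f) {x₀ : P}
    (hx₀ : ∀ x, (∀ f ∈ fs, f x = f x₀) → x = x₀)
    (hfz : ∀ E ∈ 𝓤 P, ∃ z ∈ Ch E Set.univ (n + 1), bdry z = 0 ∧ deg fs z ≠ 0)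
    {gs : List (M → UnitAddCircle)} (hgne : gs ≠ []) (hg : ∀ f ∈ gs, Continuous f) {y₀ : M}
    (hy₀ : ∀ x, (∀ f ∈ gs, f x = f y₀) → x = y₀)
    (hgz : ∀ E ∈ 𝓤 M, ∃ z ∈ Ch E Set.univ (n + 1), bdry z = 0 ∧ deg gs z ≠ 0)
    {E : Set (N × N)} (hE : E ∈ 𝓤 N) :
    ∃ z₁ ∈ Ch E C₁ (n + 1), ∃ z₂ ∈ Ch E C₂ (n + 1), bdry (z₁ + z₂) = 0 ∧
      deg (fs.map (· ∘ p₁)) (z₁ + z₂) ≠ 0 ∧ deg (gs.map (· ∘ p₂)) (z₁ + z₂) ≠ 0 := by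
  obtain ⟨D₁, hD₁, hc₁⟩ := h₁.exists_piece h₂.closed hP hfne hf hfz
  obtain ⟨D₂, hD₂, hc₂⟩ := h₂.exists_piece h₁.closed hM hgne hg hgz
  obtain ⟨D₃, hD₃, hv₁⟩ := h₁.exists_deg_eq_zero hP hf hx₀
  obtain ⟨D₄, hD₄, hv₂⟩ := h₂.exists_deg_eq_zero hM hg hy₀
  set E' := E ∩ ((D₁ ∩ D₂) ∩ (D₃ ∩ D₄)) with hE'
  have hE'u : E' ∈ 𝓤 N := Filter.inter_mem hE (Filter.inter_mem (Filter.inter_mem hD₁ hD₂)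
    (Filter.inter_mem hD₃ hD₄))
  obtain ⟨S, hS, hdep⟩ := h₁.dep_inter E' hE'u
  obtain ⟨c₁, hc₁m, hb₁, r₁, hr₁, hk₁⟩ := hc₁ (E' ∩ S) (Filter.inter_mem hE'u hS)
  obtain ⟨c₂, hc₂m, hb₂, r₂, hr₂, hk₂⟩ := hc₂ (E' ∩ S) (Filter.inter_mem hE'u hS)
  obtain ⟨k₁, k₂, hk, w, hw, hbw⟩ := hdep (bdry c₁) (Ch_mono Set.inter_subset_right subset_rfl hb₁)
    (bdry c₂) (Ch_mono Set.inter_subset_right (Set.inter_comm C₂ C₁).le hb₂)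
    (bdry_bdry c₁) (bdry_bdry c₂)
  have m₁ := Ch_mono (Set.inter_subset_left : E' ∩ S ⊆ E') subset_rfl hc₁m
  have m₂ := Ch_mono (Set.inter_subset_left : E' ∩ S ⊆ E') subset_rfl hc₂m
  have w₁ := Ch_mono (subset_rfl : E' ⊆ E') (Set.inter_subset_left : C₁ ∩ C₂ ⊆ C₁) hw
  have w₂ := Ch_mono (subset_rfl : E' ⊆ E') (Set.inter_subset_right : C₁ ∩ C₂ ⊆ C₂) hw
  have z₁m : k₁ • c₁ - w ∈ Ch E' C₁ (n + 1) := sub_mem (Submodule.smul_mem _ _ m₁) w₁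
  have z₂m : k₂ • c₂ ∈ Ch E' C₂ (n + 1) := Submodule.smul_mem _ _ m₂
  have hcyc : bdry (k₁ • c₁ - w + k₂ • c₂) = 0 := by
    rw [map_add, map_sub, map_smul, map_smul, hbw]; abel
  have e₁ : k₁ • c₁ - w + k₂ • c₂ = k₁ • c₁ + (k₂ • c₂ - w) := by abel
  have e₂ : k₁ • c₁ - w + k₂ • c₂ = k₂ • c₂ + (k₁ • c₁ - w) := by abel
  have d₁ : deg (fs.map (· ∘ p₁)) (k₁ • c₁ - w + k₂ • c₂) = k₁ * r₁ := by
    rw [e₁]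
    exact hk₁ k₁ _ (Ch_mono (fun x hx => hx.2.1.1) subset_rfl (sub_mem z₂m w₂)) (e₁ ▸ hcyc)
  have d₂ : deg (gs.map (· ∘ p₂)) (k₁ • c₁ - w + k₂ • c₂) = k₂ * r₂ := by
    rw [e₂]
    exact hk₂ k₂ _ (Ch_mono (fun x hx => hx.2.1.2) subset_rfl z₁m) (e₂ ▸ hcyc)
  have hk₁0 : k₁ ≠ 0 := by
    rintro rfl
    have hk₂0 : k₂ ≠ 0 := by simpa using hk
    have := hv₂ _ (k₂ • c₂ - w) (Ch_mono (fun x hx => hx.2.2.2) subset_rfl (sub_mem z₂m w₂))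
      (by rwa [e₁, zero_smul, zero_add] at hcyc)
    rw [e₁, zero_smul, zero_add, this] at d₂
    exact mul_ne_zero hk₂0 hr₂ d₂.symm
  have hk₂0 : k₂ ≠ 0 := by
    rintro rfl
    have := hv₁ _ (k₁ • c₁ - w) (Ch_mono (fun x hx => hx.2.2.1) subset_rfl z₁m)
      (by simpa using hcyc)
    rw [zero_smul, add_zero, this] at d₁
    exact mul_ne_zero hk₁0 hr₁ d₁.symm
  refine ⟨_, Ch_mono Set.inter_subset_left subset_rfl z₁m, _,
    Ch_mono Set.inter_subset_left subset_rfl z₂m, hcyc, ?_, ?_⟩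
  · rw [d₁]; exact mul_ne_zero hk₁0 hr₁
  · rw [d₂]; exact mul_ne_zero hk₂0 hr₂

/-- The difference of the two pullbacks of a one-cochain to the square. -/
def dif {X : Type*} (a : X → X → ℝ) (u v : X × X) : ℝ := a u.2 v.2 - a u.1 v.1

section

variable {X : Type*} {S₁ S₂ : Set (List X)} {n : ℕ}

lemma mem_union_of_mem {z₁ z₂ : Chain X} (hz₁ : z₁ ∈ Finsupp.supported ℝ ℝ S₁)
    (hz₂ : z₂ ∈ Finsupp.supported ℝ ℝ S₂) : z₁ + z₂ ∈ Finsupp.supported ℝ ℝ (S₁ ∪ S₂) :=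
  add_mem (Finsupp.supported_mono Set.subset_union_left hz₁)
    (Finsupp.supported_mono Set.subset_union_right hz₂)

/-- If the shifted cochains vanish on one part, the cup product is computed on the other part. -/
lemma ev_cup_shift_part {as : List ((X → X → ℝ) × (X → ℝ))} (hne : as ≠ [])
    (hadd : ∀ l ∈ S₁ ∪ S₂, ∀ p ∈ as, AddOn p.1 l)
    (hv : ∀ l ∈ S₂, ∀ p ∈ as, ∀ x ∈ l, ∀ y ∈ l, shift p x y = 0) {z₁ z₂ : Chain X}
    (hz₁ : z₁ ∈ Finsupp.supported ℝ ℝ S₁) (hz₂ : z₂ ∈ Finsupp.supported ℝ ℝ S₂)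
    (hz : bdry (z₁ + z₂) = 0) :
    ev (cup (as.map shift)) z₁ = ev (cup (as.map Prod.fst)) (z₁ + z₂) := by
  rw [ev_cup_shift as _ hadd _ (mem_union_of_mem hz₁ hz₂) hz, map_add,
    ev_eq_zero_of_supported (S := S₂) (c := z₂) _ hz₂, add_zero]
  intro l hl
  obtain ⟨p, hp⟩ := List.exists_mem_of_ne_nil as hne
  exact cup_eq_zero ⟨shift p, List.mem_map_of_mem hp, hv l hl p hp⟩

lemma ev_cup_congr_crossList {Y ι : Type*} {cs : List ι} {F G : ι → X × Y → X × Y → ℝ} {l : List X}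
    {m : List Y} (h : ∀ c ∈ cs, ∀ u v : X × Y, u.1 ∈ l → u.2 ∈ m → v.1 ∈ l → v.2 ∈ m →
      F c u v = G c u v) :
    ev (cup (cs.map F)) (crossList l m) = ev (cup (cs.map G)) (crossList l m) := by
  rw [← sub_eq_zero, ← LinearMap.sub_apply]
  have : ev (cup (cs.map F)) - ev (cup (cs.map G))
      = ev fun s => cup (cs.map F) s - cup (cs.map G) s := chain_hom_ext fun s => by simp
  rw [this]
  refine ev_eq_zero_of_supported ?_ (crossList_mem_supported l m)
  rintro s ⟨-, hs⟩
  rw [sub_eq_zero]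
  exact cup_congr fun c hc u hu v hv =>
    h c hc u v (hs u hu).1 (hs u hu).2 (hs v hv).1 (hs v hv).2

/-- The product of differences of classes supported on complementary parts of a cycle, evaluated
on the square of the cycle. -/
lemma ev_cup_cross_self {as bs : List ((X → X → ℝ) × (X → ℝ))} (hn : Even n) (hn0 : n ≠ 0)
    (hal : as.length = n) (hbl : bs.length = n) (hlen : ∀ l ∈ S₁ ∪ S₂, l.length = n + 1)
    (hadd : ∀ l ∈ S₁ ∪ S₂, ∀ p ∈ as ++ bs, AddOn p.1 l)
    (hdiag : ∀ p ∈ as ++ bs, ∀ x, p.1 x x = 0)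
    (hav : ∀ l ∈ S₂, ∀ p ∈ as, ∀ x ∈ l, ∀ y ∈ l, shift p x y = 0)
    (hbv : ∀ l ∈ S₁, ∀ p ∈ bs, ∀ x ∈ l, ∀ y ∈ l, shift p x y = 0) {z₁ z₂ : Chain X}
    (hz₁ : z₁ ∈ Finsupp.supported ℝ ℝ S₁) (hz₂ : z₂ ∈ Finsupp.supported ℝ ℝ S₂)
    (hz : bdry (z₁ + z₂) = 0) :
    ev (cup ((as ++ bs).map fun p => dif p.1)) (cross (z₁ + z₂) (z₁ + z₂)) =
      2 * (ev (cup (as.map Prod.fst)) (z₁ + z₂) * ev (cup (bs.map Prod.fst)) (z₁ + z₂)) := by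
  have hane : as ≠ [] := by rintro rfl; exact hn0 hal.symm
  have hbne : bs ≠ [] := by rintro rfl; exact hn0 hbl.symm
  have hzS := mem_union_of_mem hz₁ hz₂
  have ea := ev_cup_shift_part hane (fun l hl p hp => hadd l hl p (by simp [hp])) hav hz₁ hz₂ hz
  have eb := ev_cup_shift_part hbne (fun l hl p hp => hadd l hl.symm p (by simp [hp])) hbv hz₂ hz₁
    (by rwa [add_comm])
  rw [add_comm z₂] at eb
  let R : Set (List (X × X)) :=
    {s | ∃ l ∈ S₁ ∪ S₂, ∃ m ∈ S₁ ∪ S₂, ∀ u ∈ s, u.1 ∈ l ∧ u.2 ∈ m}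
  have hR : cross (z₁ + z₂) (z₁ + z₂) ∈ Finsupp.supported ℝ ℝ R :=
    cross_mem_supported (fun l hl m hm => Finsupp.supported_mono
      (t := R) (fun s hs => ⟨l, hl, m, hm, hs.2⟩) (crossList_mem_supported l m)) hzS hzS
  have hsh := ev_cup_shift ((as ++ bs).map fun p => (dif p.1, fun u : X × X => p.2 u.2 - p.2 u.1)) R
    (by
      rintro s ⟨l, hl, m, hm, hs⟩ _ hp'
      obtain ⟨p, hp, rfl⟩ := List.mem_map.1 hp'
      intro u hu v hv w hw
      have h1 := hadd l hl p hp _ (hs u hu).1 _ (hs v hv).1 _ (hs w hw).1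
      have h2 := hadd m hm p hp _ (hs u hu).2 _ (hs v hv).2 _ (hs w hw).2
      simp only [dif]
      linarith)
    _ hR (bdry_cross hlen (by omega) hzS hz hz)
  rw [List.map_map, List.map_map] at hsh
  have e1 : (as ++ bs).map (fun p => dif p.1) = (as ++ bs).map
    (Prod.fst ∘ fun p => (dif p.1, fun u : X × X => p.2 u.2 - p.2 u.1)) := rfl
  have e2 : (as ++ bs).map (shift ∘ fun p => (dif p.1, fun u : X × X => p.2 u.2 - p.2 u.1))
      = (as ++ bs).map fun p => dif (shift p) := by
    refine List.map_congr_left fun p _ => ?_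
    ext u v
    simp only [shift, dif, Function.comp]
    ring
  rw [e1, hsh, e2]
  set Φ := ev (cup ((as ++ bs).map fun p => dif (shift p))) with hΦ
  have hsd : ∀ p ∈ as ++ bs, ∀ x, shift p x x = 0 := fun p hp x => by
    simp [shift, hdiag p hp x]
  have h22 : Φ (cross z₂ z₂) = 0 := by
    rw [hΦ, ev_cross_eq (φ := fun _ => 0) (ψ := fun _ => 0) (r := 0) _ hz₂ hz₂, zero_mul]
    intro l hl m hm
    rw [zero_mul]
    refine ev_eq_zero_of_supported ?_ (crossList_mem_supported l m)
    rintro s ⟨-, hs⟩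
    obtain ⟨p, hp⟩ := List.exists_mem_of_ne_nil as hane
    refine cup_eq_zero ⟨dif (shift p), List.mem_map.2 ⟨p, by simp [hp], rfl⟩, fun u hu v hv => ?_⟩
    rw [dif, hav m hm p hp _ (hs u hu).2 _ (hs v hv).2,
      hav l hl p hp _ (hs u hu).1 _ (hs v hv).1, sub_zero]
  have h11 : Φ (cross z₁ z₁) = 0 := by
    rw [hΦ, ev_cross_eq (φ := fun _ => 0) (ψ := fun _ => 0) (r := 0) _ hz₁ hz₁, zero_mul]
    intro l hl m hm
    rw [zero_mul]
    refine ev_eq_zero_of_supported ?_ (crossList_mem_supported l m)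
    rintro s ⟨-, hs⟩
    obtain ⟨p, hp⟩ := List.exists_mem_of_ne_nil bs hbne
    refine cup_eq_zero ⟨dif (shift p), List.mem_map.2 ⟨p, by simp [hp], rfl⟩, fun u hu v hv => ?_⟩
    rw [dif, hbv m hm p hp _ (hs u hu).2 _ (hs v hv).2,
      hbv l hl p hp _ (hs u hu).1 _ (hs v hv).1, sub_zero]
  have hsplit : (as ++ bs).map (fun p => dif (shift p)) =
      (as.map Sum.inl ++ bs.map Sum.inr).map
        (Sum.elim (fun p => dif (shift p)) fun p => dif (shift p)) := by
    simp only [List.map_append, List.map_map]; rfl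
  have h12 : Φ (cross z₁ z₂) =
      ev (cup (as.map shift)) z₁ * ev (cup (bs.map shift)) z₂ := by
    rw [hΦ, ev_cross_eq (φ := cup (as.map shift)) (ψ := cup (bs.map shift)) (r := 1) _ hz₁ hz₂,
      one_mul]
    intro l hl m hm
    rw [hsplit, ev_cup_congr_crossList (G := Sum.elim (fun p u v => - shift p u.1 v.1)
      (fun p u v => shift p u.2 v.2))]
    · have h := ev_cup_crossList (as.map fun p x y => - shift p x y) (bs.map shift)
        (by
          intro a ha x
          obtain ⟨p, hp, rfl⟩ := List.mem_map.1 ha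
          simp [hsd p (by simp [hp]) x]) l m
        (by simp [hlen l (Or.inl hl), hal]) (by simp [hlen m (Or.inr hm), hbl])
      rw [cup_neg, hal, hn.neg_one_pow, one_mul, List.map_map, List.map_map] at h
      rw [one_mul, ← h, List.map_append, List.map_map, List.map_map]
      rfl
    · rintro (p | p) hc u v hu1 hu2 hv1 hv2
      · have hp : p ∈ as := by simpa using hc
        simp only [Sum.elim_inl, dif]
        rw [hav m hm p hp _ hu2 _ hv2, zero_sub]
      · have hp : p ∈ bs := by simpa using hc
        simp only [Sum.elim_inr, dif]
        rw [hbv l hl p hp _ hu1 _ hv1, sub_zero]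
  have h21 : Φ (cross z₂ z₁) =
      ev (cup (bs.map shift)) z₂ * ev (cup (as.map shift)) z₁ := by
    rw [hΦ, ev_cross_eq (φ := cup (bs.map shift)) (ψ := cup (as.map shift)) (r := 1) _ hz₂ hz₁,
      one_mul]
    intro l hl m hm
    rw [hsplit, ev_cup_congr_crossList (G := Sum.elim (fun p u v => shift p u.2 v.2)
      (fun p u v => - shift p u.1 v.1))]
    · have h := ev_cup_crossList_swap (bs.map fun p x y => - shift p x y) (as.map shift)
        (by
          intro a ha x
          obtain ⟨p, hp, rfl⟩ := List.mem_map.1 ha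
          simp [hsd p (by simp [hp]) x]) l m
        (by simp [hlen l (Or.inr hl), hbl]) (by simp [hlen m (Or.inl hm), hal])
      rw [cup_neg, List.length_map, List.length_map, hal, hbl, (hn.mul_left n).neg_one_pow,
        hn.neg_one_pow, one_mul, one_mul, List.map_map, List.map_map] at h
      rw [one_mul, ← h, List.map_append, List.map_map, List.map_map]
      rfl
    · rintro (p | p) hc u v hu1 hu2 hv1 hv2
      · have hp : p ∈ as := by simpa using hc
        simp only [Sum.elim_inl, dif]
        rw [hav l hl p hp _ hu1 _ hv1, sub_zero]
      · have hp : p ∈ bs := by simpa using hc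
        simp only [Sum.elim_inr, dif]
        rw [hbv m hm p hp _ hu2 _ hv2, zero_sub]
  rw [← ea, ← eb]
  simp only [map_add, LinearMap.add_apply, h11, h12, h21, h22]
  ring

end

open Uniformity

lemma ev_congr_of_supported {X : Type*} {φ ψ : List X → ℝ} {S : Set (List X)}
    (h : ∀ l ∈ S, φ l = ψ l) {c : Chain X} (hc : c ∈ Finsupp.supported ℝ ℝ S) :
    ev φ c = ev ψ c := by
  rw [← sub_eq_zero, ← LinearMap.sub_apply]
  have : ev φ - ev ψ = ev fun s => φ s - ψ s := chain_hom_ext fun s => by simp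
  rw [this]
  exact ev_eq_zero_of_supported (fun l hl => sub_eq_zero.2 (h l hl)) hc

lemma shortRep_sub {a b : UnitAddCircle} (ha : ‖a‖ < 1 / 4) (hb : ‖b‖ < 1 / 4) :
    shortRep (a - b) = shortRep a - shortRep b := by
  have h := shortRep_add hb (b := -b) (by rwa [norm_neg])
  rw [add_neg_cancel, shortRep_zero] at h
  rw [sub_eq_add_neg, shortRep_add ha (by rwa [norm_neg])]
  linarith

lemma coch_dif {X : Type*} {f : X → UnitAddCircle} {u v : X × X} (h₁ : ‖f v.1 - f u.1‖ < 1 / 4)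
    (h₂ : ‖f v.2 - f u.2‖ < 1 / 4) :
    coch (fun w : X × X => f w.2 - f w.1) u v = dif (coch f) u v := by
  rw [dif, coch, coch, coch, ← shortRep_sub h₂ h₁, sub_sub_sub_comm]

lemma exists_entourage_prod {X Y : Type*} [UniformSpace X] [UniformSpace Y]
    {E : Set ((X × Y) × (X × Y))} (hE : E ∈ 𝓤 (X × Y)) : ∃ s ∈ 𝓤 X, ∃ t ∈ 𝓤 Y,
      ∀ u v : X × Y, (u.1, v.1) ∈ s → (u.2, v.2) ∈ t → (u, v) ∈ E := by
  rw [uniformity_prod_eq_comap_prod, Filter.mem_comap] at hE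
  obtain ⟨r, hr, hrE⟩ := hE
  obtain ⟨s, hs, t, ht, hst⟩ := Filter.mem_prod_iff.1 hr
  exact ⟨s, hs, t, ht, fun u v h1 h2 => hrE (hst ⟨h1, h2⟩)⟩

/-- The zero-divisor cup-length obstruction to lifting differences of circle-valued maps. -/
lemma false_of_cover {N : Type*} [UniformSpace N] [CompactSpace N] {n : ℕ} (hn : Even n)
    (hn0 : n ≠ 0) {C₁ C₂ : Set N} (hC₁ : IsCompact C₁) (hC₂ : IsCompact C₂)
    {αs βs : List (N → UnitAddCircle)} (hαl : αs.length = n) (hβl : βs.length = n)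
    (hαc : ∀ f ∈ αs, Continuous f) (hβc : ∀ f ∈ βs, Continuous f)
    (hα : ∀ f ∈ αs, LiftsOn f C₂) (hβ : ∀ f ∈ βs, LiftsOn f C₁)
    (hz : ∀ E ∈ 𝓤 N, ∃ z₁ ∈ Ch E C₁ (n + 1), ∃ z₂ ∈ Ch E C₂ (n + 1), bdry (z₁ + z₂) = 0 ∧
      deg αs (z₁ + z₂) ≠ 0 ∧ deg βs (z₁ + z₂) ≠ 0)
    {U : ℕ → Set (N × N)} (hU : ∀ j, IsOpen (U j)) (hcov : ∀ u, ∃ j < 2 * n, u ∈ U j)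
    (hlift : ∀ j, ∀ f : N → UnitAddCircle, Continuous f →
      LiftsOn (fun u : N × N => f u.2 - f u.1) (U j)) : False := by
  have hcc : ∀ f ∈ αs ++ βs, Continuous f := fun f hf =>
    (List.mem_append.1 hf).elim (hαc f) (hβc f)
  obtain ⟨E₀, hE₀, h₀⟩ := exists_ev_cup_eq_zero (X := N × N) isCompact_univ
    ((αs ++ βs).zipIdx.map fun q => ((fun u : N × N => q.1 u.2 - q.1 u.1), U q.2))
    (by
      intro p hp
      obtain ⟨q, hq, rfl⟩ := List.mem_map.1 hp
      have := hcc _ (List.fst_mem_of_mem_zipIdx hq)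
      fun_prop)
    (by
      intro p hp
      obtain ⟨q, hq, rfl⟩ := List.mem_map.1 hp
      exact hU _)
    (by
      intro p hp
      obtain ⟨q, hq, rfl⟩ := List.mem_map.1 hp
      exact hlift _ _ (hcc _ (List.fst_mem_of_mem_zipIdx hq)))
    (by
      intro u _
      obtain ⟨j, hj, hu⟩ := hcov u
      have hj' : j < (αs ++ βs).length := by simp [hαl, hβl]; omega
      refine ⟨_, List.mem_map.2 ⟨((αs ++ βs)[j], j), ?_, rfl⟩, hu⟩
      exact List.mk_mem_zipIdx_iff_getElem?.2 (List.getElem?_eq_getElem hj'))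
  have hmap : ((αs ++ βs).zipIdx.map fun q => ((fun u : N × N => q.1 u.2 - q.1 u.1), U q.2)).map
      (fun p => coch p.1) = (αs ++ βs).map fun f => coch fun u : N × N => f u.2 - f u.1 := by
    conv_rhs => rw [← List.zipIdx_map_fst 0 (αs ++ βs)]
    rw [List.map_map, List.map_map]
    rfl
  rw [hmap] at h₀
  obtain ⟨E₁, hE₁, h₁⟩ : ∃ E₁ ∈ 𝓤 N, ∀ u v : N × N, (u.1, v.1) ∈ E₁ → (u.2, v.2) ∈ E₁ →
      (u, v) ∈ E₀ := by
    obtain ⟨s, hs, t, ht, h⟩ := exists_entourage_prod hE₀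
    exact ⟨s ∩ t, Filter.inter_mem hs ht, fun u v h1 h2 => h u v h1.1 h2.2⟩
  obtain ⟨E₂, hE₂, h₂⟩ := exists_forall_list (F := 𝓤 N) (αs ++ βs)
    (P := fun f E => ∀ x ∈ (Set.univ : Set N), ∀ y ∈ (Set.univ : Set N), (x, y) ∈ E →
      ‖f y - f x‖ < 1 / 4)
    (fun f s t hst h x hx y hy hxy => h x hx y hy (hst hxy))
    (fun f hf => exists_norm_lt isCompact_univ (hcc f hf).continuousOn)
  choose! ga hga ca hca using hα
  choose! gb hgb cb hcb using hβ
  obtain ⟨E₃, hE₃, h₃⟩ := exists_forall_list (F := 𝓤 N) αs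
    (P := fun f E => ∀ x ∈ C₂, ∀ y ∈ C₂, (x, y) ∈ E → coch f x y = ga f y - ga f x)
    (fun f s t hst h x hx y hy hxy => h x hx y hy (hst hxy))
    (fun f hf => exists_coch_eq hC₂ (hga f hf) (hca f hf))
  obtain ⟨E₄, hE₄, h₄⟩ := exists_forall_list (F := 𝓤 N) βs
    (P := fun f E => ∀ x ∈ C₁, ∀ y ∈ C₁, (x, y) ∈ E → coch f x y = gb f y - gb f x)
    (fun f s t hst h x hx y hy hxy => h x hx y hy (hst hxy))
    (fun f hf => exists_coch_eq hC₁ (hgb f hf) (hcb f hf))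
  obtain ⟨z₁, hz₁, z₂, hz₂, hb, hd₁, hd₂⟩ := hz ((E₁ ∩ E₂) ∩ (E₃ ∩ E₄))
    (Filter.inter_mem (Filter.inter_mem hE₁ hE₂) (Filter.inter_mem hE₃ hE₄))
  set E := (E₁ ∩ E₂) ∩ (E₃ ∩ E₄)
  have hu : smallSimp E C₁ (n + 1) ∪ smallSimp E C₂ (n + 1) ⊆ smallSimp E Set.univ (n + 1) :=
    Set.union_subset (smallSimp_mono subset_rfl (Set.subset_univ _))
      (smallSimp_mono subset_rfl (Set.subset_univ _))
  have key := ev_cup_cross_self (as := αs.map fun f => (coch f, ga f))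
    (bs := βs.map fun f => (coch f, gb f)) (S₁ := smallSimp E C₁ (n + 1))
    (S₂ := smallSimp E C₂ (n + 1)) hn hn0 (by simpa) (by simpa) (fun l hl => (hu hl).1)
    (by
      intro l hl p hp
      obtain ⟨f, hf, hfp⟩ : ∃ f ∈ αs ++ βs, coch f = p.1 := by
        simp only [List.mem_append, List.mem_map] at hp ⊢
        rcases hp with ⟨f, hf, rfl⟩ | ⟨f, hf, rfl⟩
        exacts [⟨f, Or.inl hf, rfl⟩, ⟨f, Or.inr hf, rfl⟩]
      rw [← hfp]
      exact addOn_coch fun x hx y hy => h₂ f hf x trivial y trivial ((hu hl).2.2 x hx y hy).1.2)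
    (by
      intro p hp x
      simp only [List.mem_append, List.mem_map] at hp
      rcases hp with ⟨f, hf, rfl⟩ | ⟨f, hf, rfl⟩ <;> simp)
    (by
      intro l hl p hp x hx y hy
      obtain ⟨f, hf, rfl⟩ := List.mem_map.1 hp
      simp only [shift]
      rw [h₃ f hf x (hl.2.1 x hx) y (hl.2.1 y hy) (hl.2.2 x hx y hy).2.1, sub_self])
    (by
      intro l hl p hp x hx y hy
      obtain ⟨f, hf, rfl⟩ := List.mem_map.1 hp
      simp only [shift]
      rw [h₄ f hf x (hl.2.1 x hx) y (hl.2.1 y hy) (hl.2.2 x hx y hy).2.2, sub_self])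
    hz₁ hz₂ hb
  have ed₁ : ev (cup ((αs.map fun f => (coch f, ga f)).map Prod.fst)) = deg αs := by
    rw [List.map_map]; rfl
  have ed₂ : ev (cup ((βs.map fun f => (coch f, gb f)).map Prod.fst)) = deg βs := by
    rw [List.map_map]; rfl
  have ed : (((αs.map fun f => (coch f, ga f)) ++ βs.map fun f => (coch f, gb f)).map
      fun p => dif p.1) = (αs ++ βs).map fun f => dif (coch f) := by
    simp only [List.map_append, List.map_map]; rfl
  rw [ed₁, ed₂, ed] at key
  have hzS := Finsupp.supported_mono hu (mem_union_of_mem hz₁ hz₂)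
  let R : Set (List (N × N)) :=
    {s | s.length + 1 = (n + 1) + (n + 1) ∧ ∃ l ∈ smallSimp E Set.univ (n + 1),
      ∃ m ∈ smallSimp E Set.univ (n + 1), ∀ u ∈ s, u.1 ∈ l ∧ u.2 ∈ m}
  have hR : cross (z₁ + z₂) (z₁ + z₂) ∈ Finsupp.supported ℝ ℝ R :=
    cross_mem_supported (fun l hl m hm => Finsupp.supported_mono (t := R)
      (fun s hs => ⟨by have := hs.1; rwa [hl.1, hm.1] at this, l, hl, m, hm, hs.2⟩)
      (crossList_mem_supported l m)) hzS hzS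
  have hzero : ev (cup ((αs ++ βs).map fun f => dif (coch f)))
      (cross (z₁ + z₂) (z₁ + z₂)) = 0 := by
    rw [← h₀ (n + 1 + n) (cross (z₁ + z₂) (z₁ + z₂)) (Finsupp.supported_mono ?_ hR)
      (bdry_cross (fun l hl => hl.1) (by omega) hzS hb hb)]
    · refine ev_congr_of_supported ?_ hR
      rintro s ⟨-, l, hl, m, hm, hs⟩
      exact cup_congr fun f hf u hu v hv => (coch_dif
        (h₂ f hf _ trivial _ trivial (hl.2.2 _ (hs u hu).1 _ (hs v hv).1).1.2)
        (h₂ f hf _ trivial _ trivial (hm.2.2 _ (hs u hu).2 _ (hs v hv).2).1.2)).symm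
    · rintro s ⟨hlen, l, hl, m, hm, hs⟩
      exact ⟨by omega, fun _ _ => trivial, fun u hu v hv => h₁ u v
        (hl.2.2 _ (hs u hu).1 _ (hs v hv).1).1.1 (hm.2.2 _ (hs u hu).2 _ (hs v hv).2).1.1⟩
  rw [hzero] at key
  exact mul_ne_zero two_ne_zero (mul_ne_zero hd₁ hd₂) key.symm

open Uniformity

lemma LiftsOn.comp {X Y : Type*} [TopologicalSpace X] [TopologicalSpace Y] {f : Y → UnitAddCircle}
    {V : Set Y} (h : LiftsOn f V) {p : X → Y} (hp : Continuous p) {C : Set X}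
    (hC : Set.MapsTo p C V) : LiftsOn (f ∘ p) C := by
  obtain ⟨g, hg, c, hgc⟩ := h
  exact ⟨g ∘ p, hg.comp hp.continuousOn hC, c, fun x hx => hgc _ (hC hx)⟩

lemma liftsOn_of_planner {X : Type*} [TopologicalSpace X] {U : Set (X × X)} (s : C(U, C(I, X)))
    (hs : ∀ p : U, s p 0 = (p : X × X).1 ∧ s p 1 = (p : X × X).2) {f : X → UnitAddCircle}
    (hf : Continuous f) : LiftsOn (fun u : X × X => f u.2 - f u.1) U := by
  classical
  obtain ⟨g, hg⟩ := exists_lift_of_homotopy (X := U) (c := 0)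
    ⟨fun q : I × U => f (s q.2 q.1) - f (q.2 : X × X).1, by fun_prop⟩ (fun u => by simp [hs u])
  refine ⟨fun u => if h : u ∈ U then g ⟨u, h⟩ else 0, ?_, 0, fun u hu => ?_⟩
  · rw [continuousOn_iff_continuous_domRestrict]
    refine g.continuous.congr fun u => ?_
    simp
  · have := hg ⟨u, hu⟩
    simp only [ContinuousMap.coe_mk, (hs ⟨u, hu⟩).2] at this
    simp [hu, this]

/-- The space `P` carries `n` circle-valued maps, whose common fibre over some point is a single
point, and arbitrarily fine cycles on which the product of their classes does not vanish. -/
def HasDeg (n : ℕ) (P : Type*) [TopologicalSpace P] : Prop :=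
  ∃ fs : List (P → UnitAddCircle), fs.length = n ∧ (∀ f ∈ fs, Continuous f) ∧
    (∃ x₀, ∀ x, (∀ f ∈ fs, f x = f x₀) → x = x₀) ∧
    ∀ E ∈ 𝓝ˢ (Set.diagonal P), ∃ z ∈ Ch E Set.univ (n + 1), bdry z = 0 ∧ deg fs z ≠ 0

section

variable {n : ℕ} {N P M : Type} [TopologicalSpace N] [TopologicalSpace P] [TopologicalSpace M]

lemma exists_norm_eq_two (hn : n ≠ 0) : ∃ v : EuclideanSpace ℝ (Fin n), ‖v‖ = 2 :=
  ⟨EuclideanSpace.single ⟨0, Nat.pos_of_ne_zero hn⟩ 2, by simp⟩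

lemma sum_nonempty (D : ConnectedSumData n N P M) (hn : n ≠ 0) : Nonempty N := by
  obtain ⟨v, hv⟩ := exists_norm_eq_two hn
  refine ⟨D.h₁.symm ⟨D.φ₁ v, ?_⟩⟩
  rintro ⟨w, hw, hwv⟩
  rw [D.emb₁.injective hwv, mem_ball_zero_iff] at hw
  linarith

lemma sum_isMfd (D : ConnectedSumData n N P M) (hn : 2 ≤ n) (hP : IsMfd n P) (hM : IsMfd n M) :
    IsMfd n N := by
  have := hP.compact
  have := hP.t2
  have := hM.compact
  have := hM.t2
  have := sum_t2 D
  have := sum_compact D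
  have := sum_nonempty D (by omega)
  obtain ⟨p₁, i₁, h₁⟩ := exists_pinch D
  obtain ⟨p₂, i₂, h₂⟩ := exists_pinch (sumSwap D)
  exact IsPinch.isMfd hn hP hM h₁ h₂ D.cover

/-- The fundamental cycles of a connected sum, together with the pinch maps. -/
lemma exists_sum_cycle (D : ConnectedSumData n N P M) (hn : 2 ≤ n) (hP : IsMfd n P)
    (hM : IsMfd n M) {fs : List (P → UnitAddCircle)} (hfl : fs.length = n)
    (hf : ∀ f ∈ fs, Continuous f)
    (hx : ∃ x₀, ∀ x, (∀ f ∈ fs, f x = f x₀) → x = x₀)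
    (hfz : ∀ E ∈ 𝓝ˢ (Set.diagonal P), ∃ z ∈ Ch E Set.univ (n + 1), bdry z = 0 ∧ deg fs z ≠ 0)
    {gs : List (M → UnitAddCircle)} (hgl : gs.length = n) (hg : ∀ f ∈ gs, Continuous f)
    (hy : ∃ y₀, ∀ x, (∀ f ∈ gs, f x = f y₀) → x = y₀)
    (hgz : ∀ E ∈ 𝓝ˢ (Set.diagonal M), ∃ z ∈ Ch E Set.univ (n + 1), bdry z = 0 ∧ deg gs z ≠ 0) :
    ∃ p₁ i₁ p₂ i₂, IsPinch D.C₁ D.C₂ D.φ₁ p₁ i₁ ∧ IsPinch D.C₂ D.C₁ D.φ₂ p₂ i₂ ∧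
      ∀ E ∈ 𝓝ˢ (Set.diagonal N), ∃ z₁ ∈ Ch E D.C₁ (n + 1), ∃ z₂ ∈ Ch E D.C₂ (n + 1),
        bdry (z₁ + z₂) = 0 ∧ deg (fs.map (· ∘ p₁)) (z₁ + z₂) ≠ 0 ∧
          deg (gs.map (· ∘ p₂)) (z₁ + z₂) ≠ 0 := by
  have := hP.compact
  have := hP.t2
  have := hM.compact
  have := hM.t2
  have := sum_t2 D
  have := sum_compact D
  have := sum_nonempty D (by omega)
  obtain ⟨p₁, i₁, h₁⟩ := exists_pinch D
  obtain ⟨p₂, i₂, h₂⟩ := exists_pinch (sumSwap D)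
  obtain ⟨x₀, hx₀⟩ := hx
  obtain ⟨y₀, hy₀⟩ := hy
  refine ⟨p₁, i₁, p₂, i₂, h₁, h₂, fun E hE => ?_⟩
  let _ : UniformSpace N := uniformSpaceOfCompactR1
  let _ : UniformSpace P := uniformSpaceOfCompactR1
  let _ : UniformSpace M := uniformSpaceOfCompactR1
  have hne : ∀ {X : Type} {l : List X}, l.length = n → l ≠ [] := by
    rintro X l hl rfl
    simp at hl
    omega
  exact IsPinch.exists_cycle h₁ h₂ hP hM (hne hfl) hf hx₀ hfz (hne hgl) hg hy₀ hgz hE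

lemma sum_hasDeg (D : ConnectedSumData n N P M) (hn : 2 ≤ n) (hP : IsMfd n P) (hM : IsMfd n M)
    (hPd : HasDeg n P) {gs : List (M → UnitAddCircle)} (hgl : gs.length = n)
    (hg : ∀ f ∈ gs, Continuous f) (hinj : ∀ x y, (∀ f ∈ gs, f x = f y) → x = y)
    (hgz : ∀ E ∈ 𝓝ˢ (Set.diagonal M), ∃ z ∈ Ch E Set.univ (n + 1), bdry z = 0 ∧ deg gs z ≠ 0) :
    HasDeg n N := by
  obtain ⟨fs, hfl, hf, hx, hfz⟩ := hPd
  obtain ⟨v, hv⟩ := exists_norm_eq_two (show n ≠ 0 by omega)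
  obtain ⟨p₁, i₁, p₂, i₂, h₁, h₂, hz⟩ := exists_sum_cycle D hn hP hM hfl hf hx hfz hgl hg
    ⟨D.φ₂ v, fun x hx => hinj _ _ hx⟩ hgz
  have hv' : D.φ₂ v ∉ D.φ₂ '' Metric.closedBall 0 1 := by
    rintro ⟨w, hw, hwv⟩
    rw [D.emb₂.injective hwv, mem_closedBall_zero_iff] at hw
    linarith
  refine ⟨gs.map (· ∘ p₂), by simpa, ?_, ⟨i₂ (D.φ₂ v), fun x hx => ?_⟩, fun E hE => ?_⟩
  · intro f hf
    obtain ⟨g, hg', rfl⟩ := List.mem_map.1 hf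
    exact (hg g hg').comp h₂.cont
  · have e : p₂ x = D.φ₂ v := by
      rw [← h₂.pinch_inv (D.φ₂ v) fun h => hv' (Set.image_mono Metric.ball_subset_closedBall h)]
      exact hinj _ _ fun g hg' => hx _ (List.mem_map_of_mem hg')
    have hxC : x ∈ D.C₂ := by
      have : x ∈ D.C₁ ∪ D.C₂ := D.cover ▸ trivial
      exact this.resolve_left fun h => hv' (e ▸ h₂.mem_closedBall x h)
    rw [← e, h₂.inv_pinch x hxC]
  · obtain ⟨z₁, hz₁, z₂, hz₂, hb, -, hd⟩ := hz E hE
    exact ⟨z₁ + z₂, add_mem (Ch_mono subset_rfl (Set.subset_univ _) hz₁)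
      (Ch_mono subset_rfl (Set.subset_univ _) hz₂), hb, hd⟩

lemma not_tcCoverable (D : ConnectedSumData n N P M) (hn : 2 ≤ n) (he : Even n) (hP : IsMfd n P)
    (hM : IsMfd n M) (hPd : HasDeg n P) (hMd : HasDeg n M) {k : ℕ} (hk : k ≤ 2 * n) :
    ¬ TCCoverable N k := by
  rintro ⟨U, hU, hcov, hs⟩
  obtain ⟨fs, hfl, hf, hx, hfz⟩ := hPd
  obtain ⟨gs, hgl, hg, hy, hgz⟩ := hMd
  obtain ⟨p₁, i₁, p₂, i₂, h₁, h₂, hz⟩ := exists_sum_cycle D hn hP hM hfl hf hx hfz hgl hg hy hgz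
  have := hP.compact
  have := hP.t2
  have := hM.compact
  have := hM.t2
  have := sum_t2 D
  have := sum_compact D
  let _ : UniformSpace N := uniformSpaceOfCompactR1
  refine false_of_cover he (by omega) D.closed₁.isCompact D.closed₂.isCompact
    (αs := fs.map (· ∘ p₁)) (βs := gs.map (· ∘ p₂)) (by simpa) (by simpa) ?_ ?_ ?_ ?_ hz
    (U := fun j => if h : j < k then U ⟨j, h⟩ else ∅) (fun j => ?_) (fun u => ?_)
    (fun j f hf => ?_)
  · intro a ha
    obtain ⟨f, hf', rfl⟩ := List.mem_map.1 ha
    exact (hf f hf').comp h₁.cont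
  · intro a ha
    obtain ⟨f, hf', rfl⟩ := List.mem_map.1 ha
    exact (hg f hf').comp h₂.cont
  · intro a ha
    obtain ⟨f, hf', rfl⟩ := List.mem_map.1 ha
    exact (liftsOn_range (hf f hf') h₁.emb).comp h₁.cont fun x hx =>
      Set.image_subset_range _ _ (h₁.mem_closedBall x hx)
  · intro a ha
    obtain ⟨f, hf', rfl⟩ := List.mem_map.1 ha
    exact (liftsOn_range (hg f hf') h₂.emb).comp h₂.cont fun x hx =>
      Set.image_subset_range _ _ (h₂.mem_closedBall x hx)
  · split_ifs
    exacts [hU _, isOpen_empty]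
  · obtain ⟨j, hj⟩ := Set.mem_iUnion.1 (hcov ▸ Set.mem_univ u)
    exact ⟨j, j.2.trans_le hk, by simpa using hj⟩
  · split_ifs with h
    · obtain ⟨s, hs'⟩ := hs ⟨j, h⟩
      exact liftsOn_of_planner s hs' hf
    · exact ⟨0, continuousOn_empty _, 0, by simp⟩

end

open Uniformity

/-! ### Tori -/

lemma IsMfd.prod {n m : ℕ} {P Q : Type*} [TopologicalSpace P] [TopologicalSpace Q]
    (hP : IsMfd n P) (hQ : IsMfd m Q) : IsMfd (n + m) (P × Q) where
  compact := have := hP.compact; have := hQ.compact; inferInstance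
  t2 := have := hP.t2; have := hQ.t2; inferInstance
  conn := have := hP.conn; have := hQ.conn; inferInstance
  chart x := by
    obtain ⟨φ, hφ, hx₁⟩ := hP.chart x.1
    obtain ⟨ψ, hψ, hx₂⟩ := hQ.chart x.2
    let e : EuclideanSpace ℝ (Fin (n + m)) ≃L[ℝ]
        EuclideanSpace ℝ (Fin n) × EuclideanSpace ℝ (Fin m) :=
      ContinuousLinearEquiv.ofFinrankEq (by simp)
    refine ⟨Prod.map φ ψ ∘ e, (hφ.prodMap hψ).comp e.toHomeomorph.isOpenEmbedding, ?_⟩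
    rw [e.surjective.range_comp, Set.range_prodMap]
    exact ⟨hx₁, hx₂⟩

lemma isMfd_circle : IsMfd 1 (unitSphere 1) where
  compact := inferInstance
  t2 := inferInstance
  conn := Subtype.connectedSpace (isConnected_sphere (by simp [← Module.finrank_eq_rank]) 0
    zero_le_one)
  chart x := by
    have : Fact (Module.finrank ℝ (EuclideanSpace ℝ (Fin (1 + 1))) = 1 + 1) := ⟨by simp⟩
    refine ⟨(stereographic' 1 (-x)).symm,
      (stereographic' 1 (-x)).symm.isOpenEmbedding (by simp), ?_⟩
    exact ⟨stereographic' 1 (-x) x, (stereographic' 1 (-x)).left_inv (by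
      rw [stereographic'_source]; exact ne_neg_of_mem_unit_sphere ℝ x)⟩

/-- The circle as a sphere is the additive circle. -/
lemma nonempty_homeomorph_circle : Nonempty (UnitAddCircle ≃ₜ unitSphere 1) :=
  ⟨(AddCircle.homeomorphCircle one_ne_zero).trans
    (Homeomorph.subtype Complex.orthonormalBasisOneI.repr.toHomeomorph fun z => by
      simp [Submonoid.unitSphere])⟩

section

variable {X Y : Type*} [UniformSpace X] [UniformSpace Y]

/-- There are arbitrarily fine cycles on which the product of the classes of `fs` does not
vanish. -/
def HasCyc (fs : List (X → UnitAddCircle)) : Prop :=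
  ∀ E ∈ 𝓤 X, ∃ z ∈ Ch E Set.univ (fs.length + 1), bdry z = 0 ∧ deg fs z ≠ 0

lemma HasCyc.prod {fs : List (X → UnitAddCircle)} {gs : List (Y → UnitAddCircle)}
    (hf : HasCyc fs) (hg : HasCyc gs) (hne : fs ≠ []) :
    HasCyc (fs.map (· ∘ Prod.fst) ++ gs.map (· ∘ Prod.snd) : List (X × Y → UnitAddCircle)) := by
  intro E hE
  obtain ⟨s, hs, t, ht, hst⟩ := exists_entourage_prod hE
  obtain ⟨z, hz, hz0, hzd⟩ := hf s hs
  obtain ⟨w, hw, hw0, hwd⟩ := hg t ht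
  refine ⟨cross z w, ?_, bdry_cross (fun l hl => hl.1) ?_ hz hz0 hw0, ?_⟩
  · refine cross_mem_supported (fun l hl m hm => Finsupp.supported_mono ?_
      (crossList_mem_supported l m)) hz hw
    rintro c ⟨hc, h⟩
    refine ⟨?_, fun _ _ => trivial, fun u hu v hv => hst u v
      (hl.2.2 _ (h u hu).1 _ (h v hv).1) (hm.2.2 _ (h u hu).2 _ (h v hv).2)⟩
    rw [hl.1, hm.1] at hc
    simp only [List.length_append, List.length_map]
    omega
  · have := List.length_pos_iff.2 hne
    omega
  · have : deg (fs.map (· ∘ Prod.fst) ++ gs.map (· ∘ Prod.snd)) (cross z w)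
        = 1 * (deg fs z * deg gs w) := by
      refine ev_cross_eq (fun l hl m hm => ?_) hz hw
      rw [one_mul, ← ev_cup_crossList (fs.map coch) (gs.map coch) ?_ l m
        (by simpa using hl.1) (by simpa using hm.1)]
      · simp only [List.map_append, List.map_map]
        rfl
      · intro a ha x
        obtain ⟨f, -, rfl⟩ := List.mem_map.1 ha
        simp
    rw [this, one_mul]
    exact mul_ne_zero hzd hwd

lemma HasCyc.homeomorph [CompactSpace X] {f : X → UnitAddCircle} (hf : HasCyc [f]) (e : X ≃ₜ Y) :
    HasCyc [f ∘ e.symm] := by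
  intro E hE
  obtain ⟨D, hD, h⟩ := exists_push_mem (f := e) (B := Set.univ) isCompact_univ
    e.continuous.continuousOn (fun _ _ => trivial) hE
  obtain ⟨z, hz, hz0, hzd⟩ := hf D hD
  refine ⟨push e z, h _ _ hz, by rw [bdry_push, hz0, map_zero], ?_⟩
  rw [deg_push]
  simpa [Function.comp_assoc] using hzd

lemma hasCyc_circle : HasCyc [(id : UnitAddCircle → UnitAddCircle)] := by
  intro E hE
  obtain ⟨ε, hε, hεE⟩ := Metric.mem_uniformity_dist.1 hE
  obtain ⟨k, hk⟩ := exists_nat_one_div_lt (lt_min hε (show (0 : ℝ) < 1 / 2 by norm_num))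
  set δ : ℝ := 1 / (k + 1) with hδ
  have hδ0 : 0 < δ := by positivity
  have hd : ∀ j : ℕ, (((j + 1 : ℕ) * δ : ℝ) : UnitAddCircle) - ((j * δ : ℝ) : UnitAddCircle)
      = ((δ : ℝ) : UnitAddCircle) := fun j => by
    rw [← AddCircle.coe_sub]; congr 1; push_cast; ring
  have hn : ‖((δ : ℝ) : UnitAddCircle)‖ < ε := by
    rw [(AddCircle.norm_coe_eq_abs_iff 1 one_ne_zero).2, abs_of_pos hδ0]
    · exact hk.trans_le (min_le_left _ _)
    · rw [abs_of_pos hδ0, abs_one]; exact (hk.trans_le (min_le_right _ _)).le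
  refine ⟨∑ j ∈ Finset.range (k + 1), smp [((j * δ : ℝ) : UnitAddCircle),
    (((j + 1 : ℕ) * δ : ℝ) : UnitAddCircle)], sum_mem fun j _ => ?_, ?_, ?_⟩
  · refine smp_mem_Ch ⟨rfl, fun _ _ => trivial, ?_⟩
    have h := hd j
    intro x hx y hy
    apply hεE
    simp only [List.mem_cons, List.not_mem_nil, or_false] at hx hy
    rcases hx with rfl | rfl <;> rcases hy with rfl | rfl
    · simpa
    · rwa [dist_comm, dist_eq_norm, h]
    · rwa [dist_eq_norm, h]
    · simpa
  · rw [map_sum]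
    have : ∀ j ∈ Finset.range (k + 1), bdry (smp [((j * δ : ℝ) : UnitAddCircle),
        (((j + 1 : ℕ) * δ : ℝ) : UnitAddCircle)]) =
        (fun j : ℕ => smp [((j * δ : ℝ) : UnitAddCircle)]) (j + 1)
          - (fun j : ℕ => smp [((j * δ : ℝ) : UnitAddCircle)]) j := fun j _ => by
      simp [bdry_smp_cons, bdry_smp_nil]
    rw [Finset.sum_congr rfl this]
    refine (Finset.sum_range_sub (G := Chain UnitAddCircle) _ _).trans ?_
    have h1 : ((k + 1 : ℕ) * δ : ℝ) = 1 := by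
      rw [hδ]; push_cast; field_simp
    simp only [h1, Nat.cast_zero, zero_mul, AddCircle.coe_period, AddCircle.coe_zero, sub_self]
  · have : ∀ j ∈ Finset.range (k + 1), deg [id] (smp [((j * δ : ℝ) : UnitAddCircle),
        (((j + 1 : ℕ) * δ : ℝ) : UnitAddCircle)]) = δ := fun j _ => by
      simp only [deg, ev_smp, List.map_cons, List.map_nil, cup, cupCons, coch, id_eq]
      rw [hd, shortRep_coe ⟨by linarith, (hk.trans_le (min_le_right _ _)).le⟩]
      simp
    rw [map_sum, Finset.sum_congr rfl this]
    simp only [Finset.sum_const, Finset.card_range, nsmul_eq_mul]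
    positivity

end

/-- The circle-valued maps and the cycles of the four-torus. -/
lemma exists_torus_maps :
    ∃ gs : List (unitSphere 1 × unitSphere 1 × unitSphere 1 × unitSphere 1 → UnitAddCircle),
      gs.length = 4 ∧ (∀ f ∈ gs, Continuous f) ∧ (∀ x y, (∀ f ∈ gs, f x = f y) → x = y) ∧
      HasCyc gs := by
  obtain ⟨e⟩ := nonempty_homeomorph_circle
  have h := hasCyc_circle.homeomorph e
  refine ⟨_, ?_, ?_, ?_, h.prod (h.prod (h.prod h (by simp)) (by simp)) (by simp)⟩
  · simp
  · simp only [List.map_cons, List.map_nil, List.cons_append, List.nil_append, List.mem_cons,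
      List.not_mem_nil, or_false]
    rintro f (rfl | rfl | rfl | rfl) <;> fun_prop
  · intro x y h
    simp at h
    ext1
    · exact h.1
    · exact Prod.ext h.2.1 (Prod.ext h.2.2.1 h.2.2.2)

open Uniformity

lemma IsMfd.homeomorph {n : ℕ} {P Q : Type*} [TopologicalSpace P] [TopologicalSpace Q]
    (hP : IsMfd n P) (e : P ≃ₜ Q) : IsMfd n Q where
  compact := have := hP.compact; e.compactSpace
  t2 := have := hP.t2; e.t2Space
  conn := have := hP.conn; e.surjective.connectedSpace e.continuous
  chart x := by
    obtain ⟨φ, hφ, v, hv⟩ := hP.chart (e.symm x)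
    exact ⟨e ∘ φ, e.isOpenEmbedding.comp hφ, v, by simp [hv]⟩

lemma HasDeg.homeomorph {n : ℕ} {P Q : Type*} [TopologicalSpace P] [TopologicalSpace Q]
    [CompactSpace P] [T2Space P] (hP : HasDeg n P) (e : P ≃ₜ Q) : HasDeg n Q := by
  have := e.compactSpace
  have := e.t2Space
  obtain ⟨fs, hl, hf, ⟨x₀, hx₀⟩, hz⟩ := hP
  refine ⟨fs.map (· ∘ e.symm), by simpa, ?_, ⟨e x₀, fun x hx => ?_⟩, fun E hE => ?_⟩
  · intro g hg
    obtain ⟨f, hf', rfl⟩ := List.mem_map.1 hg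
    exact (hf f hf').comp e.symm.continuous
  · rw [← hx₀ (e.symm x) fun f hf' => by simpa using hx _ (List.mem_map_of_mem hf')]
    simp
  · let _ : UniformSpace P := uniformSpaceOfCompactR1
    let _ : UniformSpace Q := uniformSpaceOfCompactR1
    obtain ⟨D, hD, h⟩ := exists_push_mem (f := e) (B := Set.univ) isCompact_univ
      e.continuous.continuousOn (fun _ _ => trivial) hE
    obtain ⟨z, hz, hz0, hzd⟩ := hz D hD
    refine ⟨push e z, h _ _ hz, by rw [bdry_push, hz0, map_zero], ?_⟩
    rw [deg_push, List.map_map]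
    simpa [Function.comp_def] using hzd

lemma isMfd_torus : IsMfd 4 (unitSphere 1 × unitSphere 1 × unitSphere 1 × unitSphere 1) :=
  isMfd_circle.prod (isMfd_circle.prod (isMfd_circle.prod isMfd_circle))

lemma hasDeg_torus : HasDeg 4 (unitSphere 1 × unitSphere 1 × unitSphere 1 × unitSphere 1) := by
  obtain ⟨gs, hl, hc, hinj, hz⟩ := exists_torus_maps
  obtain ⟨x⟩ := isMfd_torus.conn.toNonempty
  rw [HasCyc, hl] at hz
  exact ⟨gs, hl, hc, ⟨x, fun y hy => hinj y x hy⟩, by rwa [nhdsSet_diagonal_eq_uniformity]⟩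

lemma isMfd_and_hasDeg_of_iterated (m : ℕ) (N : Type) [TopologicalSpace N]
    (hN : IsIteratedConnectedSum 4 N (m + 1)
      (fun _ => TopCat.of (unitSphere 1 × unitSphere 1 × unitSphere 1 × unitSphere 1))) :
    IsMfd 4 N ∧ HasDeg 4 N := by
  induction m generalizing N with
  | zero =>
    obtain ⟨e⟩ := hN
    exact ⟨isMfd_torus.homeomorph e.symm, hasDeg_torus.homeomorph e.symm⟩
  | succ m ih =>
    obtain ⟨P, hP, ⟨D⟩⟩ := hN
    obtain ⟨h1, h2⟩ := ih P hP
    refine ⟨sum_isMfd D (by norm_num) h1 isMfd_torus, ?_⟩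
    obtain ⟨gs, hl, hc, hinj, hz⟩ := exists_torus_maps
    rw [HasCyc, hl, ← nhdsSet_diagonal_eq_uniformity] at hz
    exact sum_hasDeg D (by norm_num) h1 isMfd_torus h2 hl hc hinj hz

/-- The lower bound for the topological complexity. -/
lemma not_tcCoverable_of_iterated {m : ℕ} (hm : 2 ≤ m) (N : Type) [TopologicalSpace N]
    (hN : IsIteratedConnectedSum 4 N m
      (fun _ => TopCat.of (unitSphere 1 × unitSphere 1 × unitSphere 1 × unitSphere 1)))
    {k : ℕ} (hk : k ≤ 8) : ¬ TCCoverable N k := by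
  obtain ⟨m, rfl⟩ := Nat.exists_eq_add_of_le' hm
  obtain ⟨P, hP, ⟨D⟩⟩ := hN
  obtain ⟨h1, h2⟩ := isMfd_and_hasDeg_of_iterated m P hP
  exact not_tcCoverable D (by norm_num) (by decide) h1 isMfd_torus h2 hasDeg_torus hk

/-! ### Covers of small order -/

section Bricks

variable {J : Type*} [Fintype J]

/-- The `k`-th system of bricks of side `δ`. -/
def brick (δ : ℝ) (k : Fin (Fintype.card J + 1)) (z : J → ℤ) : Set (J → ℝ) :=
  {y | ∀ j, (z j : ℝ) < y j / δ - k / (Fintype.card J + 1) ∧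
    y j / δ - k / (Fintype.card J + 1) < z j + 1}

lemma isOpen_brick (δ : ℝ) (k : Fin (Fintype.card J + 1)) (z : J → ℤ) : IsOpen (brick δ k z) := by
  simp only [brick, Set.ofPred_forall, Set.ofPred_and]
  exact isOpen_iInter_of_finite fun j => (isOpen_lt (by fun_prop) (by fun_prop)).inter
    (isOpen_lt (by fun_prop) (by fun_prop))

lemma eq_of_mem_brick {δ : ℝ} {k : Fin (Fintype.card J + 1)} {z z' : J → ℤ} {y : J → ℝ}
    (h : y ∈ brick δ k z) (h' : y ∈ brick δ k z') : z = z' := by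
  funext j
  have e : ∀ w : J → ℤ, y ∈ brick δ k w → ⌊y j / δ - k / (Fintype.card J + 1)⌋ = w j :=
    fun w hw => Int.floor_eq_iff.2 ⟨(hw j).1.le, (hw j).2⟩
  rw [← e z h, e z' h']

lemma dist_lt_of_mem_brick {δ : ℝ} (hδ : 0 < δ) {k : Fin (Fintype.card J + 1)} {z : J → ℤ}
    {x y : J → ℝ} (hx : x ∈ brick δ k z) (hy : y ∈ brick δ k z) : dist x y < δ := by
  rw [dist_pi_lt_iff hδ]
  intro j
  rw [Real.dist_eq]
  have h1 := hx j
  have h2 := hy j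
  have : |x j / δ - y j / δ| < 1 := by
    rw [abs_lt]
    constructor <;> linarith [h1.1, h1.2, h2.1, h2.2]
  rwa [← sub_div, abs_div, abs_of_pos hδ, div_lt_one hδ] at this

lemma exists_mem_brick (δ : ℝ) (y : J → ℝ) : ∃ k z, y ∈ brick (J := J) δ k z := by
  classical
  have hc : (0 : ℝ) < Fintype.card J + 1 := by positivity
  by_contra! h
  have bad : ∀ k : Fin (Fintype.card J + 1), ∃ j, ∃ m : ℤ,
      y j / δ - k / (Fintype.card J + 1) = m := by
    intro k
    by_contra! hk
    refine h k (fun j => ⌊y j / δ - k / (Fintype.card J + 1)⌋) fun j => ⟨?_, Int.lt_floor_add_one _⟩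
    exact lt_of_le_of_ne (Int.floor_le _) fun e => hk j _ e.symm
  choose j m hm using bad
  obtain ⟨k, k', hne, hkk⟩ := Fintype.exists_ne_map_eq_of_card_lt j (by simp)
  have h1 := hm k
  have h2 := hm k'
  rw [← hkk] at h2
  have e : ((k' : ℕ) : ℝ) - (k : ℕ) = (m k - m k') * (Fintype.card J + 1) := by
    rw [← h1, ← h2]; field_simp; ring
  have e' : ((k' : ℕ) : ℤ) - (k : ℕ) = (m k - m k') * (Fintype.card J + 1) := by exact_mod_cast e
  have hk := k.2
  have hk' := k'.2
  have : m k - m k' = 0 := by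
    by_contra h0
    rcases lt_or_gt_of_ne h0 with h0 | h0 <;> nlinarith
  rw [this, zero_mul] at e'
  exact hne (Fin.ext (by omega))

end Bricks

section Order

variable {X ι : Type*} [TopologicalSpace X]

/-- A compact set that embeds in `ℝⁿ` meets a suitable shrinking of a given open cover with
order at most `n + 1`. -/
lemma exists_shrinking_of_embeds {J : Type*} [Fintype J] {A : Set X} (hA : IsCompact A)
    (hA' : IsClosed A) {f : X → J → ℝ} (hf : ContinuousOn f A) (hinj : Set.InjOn f A)
    {U : ι → Set X} (hU : ∀ i, IsOpen (U i)) (hcov : ⋃ i, U i = Set.univ) :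
    ∃ V : ι → Set X, (∀ i, IsOpen (V i)) ∧ (∀ i, V i ⊆ U i) ∧ ⋃ i, V i = Set.univ ∧
      ∀ x ∈ A, ∃ κ : ι → Fin (Fintype.card J + 1), Set.InjOn κ {i | x ∈ V i} := by
  classical
  obtain ⟨δ, hδ, hleb⟩ := lebesgue_number_lemma_of_metric (hA.image_of_continuousOn hf)
    (c := fun i => (f '' (A \ U i))ᶜ)
    (fun i => ((hA.diff (hU i)).image_of_continuousOn
      (hf.mono Set.sdiff_subset)).isClosed.isOpen_compl)
    (by
      rintro _ ⟨x, hx, rfl⟩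
      obtain ⟨i, hi⟩ := Set.mem_iUnion.1 (hcov ▸ Set.mem_univ x)
      refine Set.mem_iUnion.2 ⟨i, ?_⟩
      rintro ⟨x', ⟨hx', hi'⟩, e⟩
      exact hi' (hinj hx' hx e ▸ hi))
  have hc : ∀ q : Fin (Fintype.card J + 1) × (J → ℤ), (∃ x ∈ A, f x ∈ brick δ q.1 q.2) →
      ∃ i, ∀ x ∈ A, f x ∈ brick δ q.1 q.2 → x ∈ U i := by
    rintro q ⟨x, hx, hxq⟩
    obtain ⟨i, hi⟩ := hleb (f x) ⟨x, hx, rfl⟩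
    refine ⟨i, fun y hy hyq => ?_⟩
    by_contra hyU
    exact hi (Metric.mem_ball.2 (dist_lt_of_mem_brick hδ hyq hxq)) ⟨y, ⟨hy, hyU⟩, rfl⟩
  have hA₀ : ∀ q : Fin (Fintype.card J + 1) × (J → ℤ), ∃ O : Set X, IsOpen O ∧
      f ⁻¹' brick δ q.1 q.2 ∩ A = O ∩ A := fun q =>
    (continuousOn_iff'.1 hf) _ (isOpen_brick δ q.1 q.2)
  choose O hO hOA using hA₀
  have hOA' : ∀ q, ∀ x ∈ A, x ∈ O q ↔ f x ∈ brick δ q.1 q.2 := fun q x hx => by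
    have := Set.ext_iff.1 (hOA q) x
    simp only [Set.mem_inter_iff, hx, and_true, Set.mem_preimage] at this
    exact this.symm
  let c : Fin (Fintype.card J + 1) × (J → ℤ) → ι → Prop := fun q i =>
    ∃ h : ∃ x ∈ A, f x ∈ brick δ q.1 q.2, i = (hc q h).choose
  refine ⟨fun i => U i ∩ ((⋃ q ∈ {q | c q i}, O q) ∪ Aᶜ), fun i => ?_,
    fun i => Set.inter_subset_left, ?_, fun x hx => ?_⟩
  · exact (hU i).inter ((isOpen_biUnion fun q _ => hO q).union hA'.isOpen_compl)
  · rw [Set.eq_univ_iff_forall]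
    intro x
    by_cases hx : x ∈ A
    · obtain ⟨k, z, hkz⟩ := exists_mem_brick δ (f x)
      have h : ∃ x ∈ A, f x ∈ brick δ (k, z).1 (k, z).2 := ⟨x, hx, hkz⟩
      exact Set.mem_iUnion.2 ⟨(hc _ h).choose, (hc _ h).choose_spec x hx hkz, Or.inl
        (Set.mem_biUnion (x := (k, z)) ⟨h, rfl⟩ ((hOA' _ x hx).2 hkz))⟩
    · obtain ⟨i, hi⟩ := Set.mem_iUnion.1 (hcov ▸ Set.mem_univ x)
      exact Set.mem_iUnion.2 ⟨i, hi, Or.inr hx⟩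
  · have key : ∀ i, x ∈ U i ∩ ((⋃ q ∈ {q | c q i}, O q) ∪ Aᶜ) →
        ∃ q, c q i ∧ f x ∈ brick δ q.1 q.2 := by
      rintro i ⟨-, h | h⟩
      · obtain ⟨q, hq, hxq⟩ := Set.mem_iUnion₂.1 h
        exact ⟨q, hq, (hOA' q x hx).1 hxq⟩
      · exact absurd hx h
    choose! q hq hxq using key
    refine ⟨fun i => (q i).1, fun i hi i' hi' e => ?_⟩
    have e2 : (q i).2 = (q i').2 := by
      have := hxq i hi
      rw [show (q i).1 = (q i').1 from e] at this
      exact eq_of_mem_brick this (hxq i' hi')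
    have e3 : q i = q i' := Prod.ext e e2
    obtain ⟨h, hi1⟩ := hq i hi
    obtain ⟨h', hi2⟩ := hq i' hi'
    have gen : ∀ q₁ q₂ h₁ h₂, q₁ = q₂ → (hc q₁ h₁).choose = (hc q₂ h₂).choose := by
      rintro q₁ _ h₁ h₂ rfl
      rfl
    exact hi1.trans ((gen _ _ h h' e3).trans hi2.symm)

/-- A space covered by finitely many compact sets that embed in `ℝⁿ` has covering dimension at
most `n`. -/
lemma exists_shrinking {J τ : Type*} [Fintype J] (t : Finset τ) {A : τ → Set X}
    (hA : ∀ a ∈ t, IsCompact (A a)) (hA' : ∀ a ∈ t, IsClosed (A a)) {f : τ → X → J → ℝ}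
    (hf : ∀ a ∈ t, ContinuousOn (f a) (A a)) (hinj : ∀ a ∈ t, Set.InjOn (f a) (A a))
    {U : ι → Set X} (hU : ∀ i, IsOpen (U i)) (hcov : ⋃ i, U i = Set.univ) :
    ∃ V : ι → Set X, (∀ i, IsOpen (V i)) ∧ (∀ i, V i ⊆ U i) ∧ ⋃ i, V i = Set.univ ∧
      ∀ a ∈ t, ∀ x ∈ A a, ∃ κ : ι → Fin (Fintype.card J + 1), Set.InjOn κ {i | x ∈ V i} := by
  classical
  induction t using Finset.induction_on with
  | empty => exact ⟨U, hU, fun _ => subset_rfl, hcov, by simp⟩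
  | insert a t _ ih =>
    obtain ⟨V, hV, hVU, hVc, hVt⟩ := ih (fun b hb => hA b (Finset.mem_insert_of_mem hb))
      (fun b hb => hA' b (Finset.mem_insert_of_mem hb))
      (fun b hb => hf b (Finset.mem_insert_of_mem hb))
      (fun b hb => hinj b (Finset.mem_insert_of_mem hb))
    obtain ⟨W, hW, hWV, hWc, hWa⟩ := exists_shrinking_of_embeds (hA a (Finset.mem_insert_self a t))
      (hA' a (Finset.mem_insert_self a t)) (hf a (Finset.mem_insert_self a t))
      (hinj a (Finset.mem_insert_self a t)) hV hVc
    refine ⟨W, hW, fun i => (hWV i).trans (hVU i), hWc, fun b hb x hx => ?_⟩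
    rcases Finset.mem_insert.1 hb with rfl | hb
    · exact hWa x hx
    · obtain ⟨κ, hκ⟩ := hVt b hb x hx
      exact ⟨κ, hκ.mono fun i hi => hWV i hi⟩

end Order

/-! ### Motion planners on closed manifolds -/

section Planner

variable {X : Type*} [TopologicalSpace X]

/-- A continuous motion planner over a subset of `X × X`. -/
def HasPlanner (U : Set (X × X)) : Prop :=
  ∃ s : X × X → C(I, X), ContinuousOn s U ∧ ∀ p ∈ U, s p 0 = p.1 ∧ s p 1 = p.2

lemma HasPlanner.mono {U V : Set (X × X)} (h : HasPlanner V) (hUV : U ⊆ V) : HasPlanner U := by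
  obtain ⟨s, hs, hs'⟩ := h
  exact ⟨s, hs.mono hUV, fun p hp => hs' p (hUV hp)⟩

lemma HasPlanner.exists_section {U : Set (X × X)} (h : HasPlanner U) :
    ∃ s : C(U, C(I, X)), ∀ p : U, (s p) 0 = (p : X × X).1 ∧ (s p) 1 = (p : X × X).2 := by
  obtain ⟨s, hs, hs'⟩ := h
  exact ⟨⟨U.domRestrict s, continuousOn_iff_continuous_domRestrict.1 hs⟩, fun p => hs' p p.2⟩

/-- Planners over pairwise disjoint open sets glue. -/
lemma HasPlanner.iUnion {θ : Type*} {W : θ → Set (X × X)} (hW : ∀ a, IsOpen (W a))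
    (hdis : ∀ a b p, p ∈ W a → p ∈ W b → a = b) (h : ∀ a, HasPlanner (W a)) :
    HasPlanner (⋃ a, W a) := by
  classical
  choose s hs hs' using h
  by_cases hne : Nonempty θ
  · have hc : ∀ p, ∃ a, p ∈ (⋃ a, W a) → p ∈ W a := by
      intro p
      by_cases hp : p ∈ ⋃ a, W a
      · obtain ⟨a, ha⟩ := Set.mem_iUnion.1 hp
        exact ⟨a, fun _ => ha⟩
      · exact ⟨hne.some, fun h => absurd h hp⟩
    choose c hc using hc
    have key : ∀ a, ∀ p ∈ W a, c p = a := fun a p hp =>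
      hdis _ _ p (hc p (Set.mem_iUnion.2 ⟨a, hp⟩)) hp
    refine ⟨fun p => s (c p) p, fun p hp => ?_, fun p hp => hs' _ p (hc p hp)⟩
    obtain ⟨a, ha⟩ := Set.mem_iUnion.1 hp
    have h1 : ContinuousAt (s a) p := (hs a).continuousAt ((hW a).mem_nhds ha)
    refine (h1.congr ?_).continuousWithinAt
    filter_upwards [(hW a).mem_nhds ha] with q hq
    rw [key a q hq]
  · rw [not_nonempty_iff] at hne
    rw [Set.iUnion_of_empty]
    exact ⟨fun p => ContinuousMap.const I p.1, continuousOn_empty _, by simp⟩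

/-- A finite cover of order at most `K` whose members carry planners yields a cover by `K` open
sets that carry planners. -/
lemma tcCoverable_of_order_le {X ι : Type} [TopologicalSpace X] [Fintype ι] [T2Space X]
    [CompactSpace X] {K : ℕ}
    {V : ι → Set (X × X)} (hV : ∀ i, IsOpen (V i)) (hcov : ⋃ i, V i = Set.univ)
    (hord : ∀ p, ∃ κ : ι → Fin K, Set.InjOn κ {i | p ∈ V i}) (hpl : ∀ i, HasPlanner (V i)) :
    TCCoverable X K := by
  classical
  obtain ⟨ψ, hψ⟩ := PartitionOfUnity.exists_isSubordinate (s := (Set.univ : Set (X × X)))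
    isClosed_univ V hV hcov.ge
  have hsub : ∀ i p, 0 < ψ i p → p ∈ V i := fun i p hp =>
    hψ i (subset_tsupport _ (Function.mem_support.2 hp.ne'))
  let W : Finset ι → Set (X × X) := fun S => {p | ∀ i ∈ S, 0 < ψ i p ∧ ∀ j ∉ S, ψ j p < ψ i p}
  have hWo : ∀ S, IsOpen (W S) := fun S => by
    have : W S = ⋂ i ∈ S, ({p | 0 < ψ i p} ∩ ⋂ j ∈ Sᶜ, {p | ψ j p < ψ i p}) := by
      ext p
      simp [W]
    rw [this]
    exact isOpen_biInter_finset fun i _ =>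
      (isOpen_lt continuous_const (ψ i).continuous).inter (isOpen_biInter_finset fun j _ =>
        isOpen_lt (ψ j).continuous (ψ i).continuous)
  have hWd : ∀ S S' : Finset ι, S.card = S'.card → ∀ p, p ∈ W S → p ∈ W S' → S = S' := by
    intro S S' hc p hp hp'
    by_contra hne
    obtain ⟨i, hi, hi'⟩ : ∃ i ∈ S, i ∉ S' := by
      by_contra! h
      exact hne (Finset.eq_of_subset_of_card_le h hc.ge)
    obtain ⟨j, hj, hj'⟩ : ∃ j ∈ S', j ∉ S := by
      by_contra! h
      exact hne (Finset.eq_of_subset_of_card_le h hc.le).symm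
    exact lt_asymm ((hp i hi).2 j hj') ((hp' j hj).2 i hi')
  have hWp : ∀ S : Finset ι, S.Nonempty → HasPlanner (W S) := fun S ⟨i, hi⟩ =>
    (hpl i).mono fun p hp => hsub i p (hp i hi).1
  refine ⟨fun k => ⋃ S : {S : Finset ι // S.card = k + 1}, W S,
    fun k => isOpen_iUnion fun S => hWo S, ?_,
    fun k => HasPlanner.exists_section (HasPlanner.iUnion (fun S => hWo S) ?_ ?_)⟩
  · rw [Set.eq_univ_iff_forall]
    intro p
    let S : Finset ι := Finset.univ.filter fun i => 0 < ψ i p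
    have hS : ∀ i, i ∈ S ↔ 0 < ψ i p := fun i => by simp [S]
    have hne : S.Nonempty := by
      obtain ⟨i, hi⟩ := ψ.exists_pos (Set.mem_univ p)
      exact ⟨i, (hS i).2 hi⟩
    obtain ⟨κ, hκ⟩ := hord p
    have hcard : S.card ≤ K := by
      have := Finset.card_le_card_of_injOn κ (s := S) (t := Finset.univ) (by simp)
        (hκ.mono fun i hi => hsub i p ((hS i).1 hi))
      simpa using this
    have hpos := hne.card_pos
    refine Set.mem_iUnion.2 ⟨⟨S.card - 1, by omega⟩, Set.mem_iUnion.2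
      ⟨⟨S, by simp only; omega⟩, fun i hi => ⟨(hS i).1 hi, fun j hj => ?_⟩⟩⟩
    exact (not_lt.1 fun h => hj ((hS j).2 h)).trans_lt ((hS i).1 hi)
  · rintro ⟨S, hS⟩ ⟨S', hS'⟩ p hp hp'
    exact Subtype.ext (hWd S S' (hS.trans hS'.symm) p hp hp')
  · rintro ⟨S, hS⟩
    exact hWp S (Finset.card_pos.1 (by omega))

end Planner

section Charts

variable {n : ℕ} {P : Type} [TopologicalSpace P]

lemma IsMfd.joined (h : IsMfd n P) (x y : P) : Joined x y := by
  have := h.conn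
  have : Std.Symm (Joined (X := P)) := ⟨fun _ _ => Joined.symm⟩
  refine PreconnectedSpace.induction₂ Joined (fun x => ?_) ⟨fun _ _ _ => Joined.trans⟩ x y
  obtain ⟨φ, hφ, v, rfl⟩ := h.chart x
  filter_upwards [hφ.isOpen_range.mem_nhds (Set.mem_range_self v)]
  rintro _ ⟨w, rfl⟩
  exact (PathConnectedSpace.joined v w).map hφ.continuous

/-- The projection to a chart domain is null-homotopic. -/
lemma homotopic_const_of_mapsTo {Y : Type*} [TopologicalSpace Y]
    {φ : EuclideanSpace ℝ (Fin n) → P} (hφ : IsOpenEmbedding φ) (g : C(Y, P))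
    (hg : ∀ y, g y ∈ Set.range φ) : g.Homotopic (ContinuousMap.const Y (φ 0)) := by
  have hc : Continuous fun y => Function.invFun φ (g y) := by
    rw [← continuousOn_univ]
    exact (continuousOn_invFun hφ).comp g.continuous.continuousOn fun y _ => hg y
  refine ⟨⟨⟨fun p => φ ((1 - (p.1 : ℝ)) • Function.invFun φ (g p.2)), ?_⟩,
    fun y => ?_, fun y => ?_⟩⟩
  · exact hφ.continuous.comp ((by fun_prop : Continuous fun p : I × Y => 1 - (p.1 : ℝ)).smul
      (hc.comp continuous_snd))
  · simpa using Function.invFun_eq (hg y)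
  · simp

lemma IsMfd.hasPlanner (h : IsMfd n P) {φ ψ : EuclideanSpace ℝ (Fin n) → P}
    (hφ : IsOpenEmbedding φ) (hψ : IsOpenEmbedding ψ) :
    HasPlanner (Set.range φ ×ˢ Set.range ψ) := by
  classical
  set U := Set.range φ ×ˢ Set.range ψ
  have h1 := homotopic_const_of_mapsTo hφ
    (⟨fun u : U => (u : P × P).1, by fun_prop⟩ : C(U, P)) (fun u => u.2.1)
  have h2 := homotopic_const_of_mapsTo hψ
    (⟨fun u : U => (u : P × P).2, by fun_prop⟩ : C(U, P)) (fun u => u.2.2)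
  obtain ⟨γ⟩ := h.joined (φ 0) (ψ 0)
  have h3 : (ContinuousMap.const U (φ 0)).Homotopic (ContinuousMap.const U (ψ 0)) :=
    ⟨⟨⟨fun p => γ p.1, by fun_prop⟩, fun u => by simp, fun u => by simp⟩⟩
  obtain ⟨F⟩ := (h1.trans h3).trans h2.symm
  let G : C(U, C(I, P)) := (F.toContinuousMap.comp ContinuousMap.prodSwap).curry
  have hG0 : ∀ u : U, G u 0 = (u : P × P).1 := fun u => F.map_zero_left u
  have hG1 : ∀ u : U, G u 1 = (u : P × P).2 := fun u => F.map_one_left u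
  refine ⟨fun p => if hp : p ∈ U then G ⟨p, hp⟩ else ContinuousMap.const I p.1, ?_, fun p hp => ?_⟩
  · rw [continuousOn_iff_continuous_domRestrict]
    refine G.continuous.congr fun u => ?_
    simp [Set.domRestrict]
  · simp only [dif_pos hp]
    exact ⟨hG0 _, hG1 _⟩

/-- Topological complexity of a closed `n`-manifold is at most `2 n + 1`. -/
lemma IsMfd.tcCoverable (h : IsMfd n P) : TCCoverable P (2 * n + 1) := by
  classical
  have := h.compact
  have := h.t2
  have hch : ∀ x : P, ∃ φ : EuclideanSpace ℝ (Fin n) → P, IsOpenEmbedding φ ∧ φ 0 = x := fun x => by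
    obtain ⟨φ, hφ, v, rfl⟩ := h.chart x
    exact ⟨φ ∘ (Homeomorph.addLeft v), hφ.comp (Homeomorph.addLeft v).isOpenEmbedding, by simp⟩
  choose φ hφ hφ0 using hch
  obtain ⟨t, ht⟩ := isCompact_univ.elim_finite_subcover (fun x => φ x '' Metric.ball 0 1)
    (fun x => (hφ x).isOpenMap _ Metric.isOpen_ball)
    (fun x _ => Set.mem_iUnion.2 ⟨x, 0, by simp, hφ0 x⟩)
  have ht' : ∀ x : P, ∃ a : t, x ∈ φ a '' Metric.ball 0 1 := fun x => by
    obtain ⟨a, ha, hx⟩ := Set.mem_iUnion₂.1 (ht (Set.mem_univ x))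
    exact ⟨⟨a, ha⟩, hx⟩
  let B : P → Set P := fun a => φ a '' Metric.closedBall 0 1
  have hB : ∀ a, IsCompact (B a) := fun a =>
    (isCompact_closedBall _ _).image (hφ a).continuous
  have hBr : ∀ a, B a ⊆ Set.range (φ a) := fun a => Set.image_subset_range _ _
  let A : t × t → Set (P × P) := fun q => B q.1 ×ˢ B q.2
  let f : t × t → P × P → Fin n ⊕ Fin n → ℝ := fun q p =>
    Sum.elim (fun j => Function.invFun (φ q.1) p.1 j) (fun j => Function.invFun (φ q.2) p.2 j)
  have hinv : ∀ a, ∀ x ∈ B a, φ a (Function.invFun (φ a) x) = x := fun a x hx =>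
    Function.invFun_eq (hBr a hx)
  have hcB : ∀ a, ContinuousOn (Function.invFun (φ a)) (B a) := fun a =>
    (continuousOn_invFun (hφ a)).mono (hBr a)
  obtain ⟨V, hV, hVU, hVc, hVo⟩ := exists_shrinking (Finset.univ : Finset (t × t)) (A := A) (f := f)
    (U := fun q : t × t => Set.range (φ q.1) ×ˢ Set.range (φ q.2))
    (fun q _ => (hB _).prod (hB _)) (fun q _ => ((hB _).prod (hB _)).isClosed)
    (fun q _ => by
      refine continuousOn_pi.2 ?_
      rintro (j | j)
      · have h1 : ContinuousOn (fun p : P × P => Function.invFun (φ q.1) p.1) (A q) :=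
          (hcB _).comp continuousOn_fst fun p hp => hp.1
        exact (EuclideanSpace.proj (𝕜 := ℝ) j).continuous.comp_continuousOn h1
      · have h1 : ContinuousOn (fun p : P × P => Function.invFun (φ q.2) p.2) (A q) :=
          (hcB _).comp continuousOn_snd fun p hp => hp.2
        exact (EuclideanSpace.proj (𝕜 := ℝ) j).continuous.comp_continuousOn h1)
    (fun q _ p hp p' hp' e => by
      have e1 : Function.invFun (φ q.1) p.1 = Function.invFun (φ q.1) p'.1 :=
        PiLp.ext fun j => congrFun e (Sum.inl j)
      have e2 : Function.invFun (φ q.2) p.2 = Function.invFun (φ q.2) p'.2 :=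
        PiLp.ext fun j => congrFun e (Sum.inr j)
      refine Prod.ext ?_ ?_
      · rw [← hinv _ _ hp.1, e1, hinv _ _ hp'.1]
      · rw [← hinv _ _ hp.2, e2, hinv _ _ hp'.2])
    (fun q => (hφ _).isOpen_range.prod (hφ _).isOpen_range)
    (by
      refine Set.eq_univ_of_forall fun p => ?_
      obtain ⟨a, ha⟩ := ht' p.1
      obtain ⟨b, hb⟩ := ht' p.2
      exact Set.mem_iUnion.2 ⟨(a, b), Set.image_subset_range _ _ ha, Set.image_subset_range _ _ hb⟩)
  have := tcCoverable_of_order_le hV hVc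
    (fun p => by
      obtain ⟨a, ha⟩ := ht' p.1
      obtain ⟨b, hb⟩ := ht' p.2
      exact hVo (a, b) (Finset.mem_univ _) p
        ⟨Set.image_mono Metric.ball_subset_closedBall ha,
          Set.image_mono Metric.ball_subset_closedBall hb⟩)
    (fun q => (h.hasPlanner (hφ _) (hφ _)).mono (hVU q))
  simpa [two_mul] using this

end Charts

end Vietoris

/-- **Example.**  For every `m ≥ 2`, the connected sum of `m` copies of the `4`-torus
`T⁴ = S¹ × S¹ × S¹ × S¹` satisfies `TC(#ₘT⁴) = 9`. -/
theorem tc_connectedSum_four_torus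
    (m : ℕ) (hm : 2 ≤ m) (N : Type) [TopologicalSpace N]
    (hN : IsIteratedConnectedSum 4 N m
      (fun _ => TopCat.of (unitSphere 1 × unitSphere 1 × unitSphere 1 × unitSphere 1))) :
    topologicalComplexity N = 9 := by
  obtain ⟨k, rfl⟩ : ∃ k, m = k + 1 := ⟨m - 1, by omega⟩
  have hM := (Vietoris.isMfd_and_hasDeg_of_iterated k N hN).1
  refine le_antisymm (sInf_le ⟨9, rfl, hM.tcCoverable⟩) (le_sInf ?_)
  rintro _ ⟨c, rfl, hc⟩
  by_contra h
  rw [not_le] at h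
  have h' : c < 9 := by exact_mod_cast h
  exact Vietoris.not_tcCoverable_of_iterated hm N hN (by omega) hc

end
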